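/- Rational form of the AAT: suppose the meromorphic mapping Φ = (φ₁,…,φ_n) admits an algebraic addition theorem, and let θ be a primitive element as described. Then there exist rational functions R₀, R₁,…,R_n of 2n+2 variables (quotients of polynomials in ℂ[x₀, x₁,…,x_n, y₀, y₁,…,y_n] with denominators not identically vanishing along the functions) such that θ(u+v) = R₀(θ(u), φ₁(u),…,φ_n(u); θ(v), φ₁(v),…,φ_n(v)) and φ_k(u+v) = R_k(θ(u), φ₁(u),…,φ_n(u); θ(v), φ₁(v),…,φ_n(v)) for k = 1,…,n, for all (u, v) in a nonempty open subset of ℂⁿ × ℂⁿ on which all functions involved are analytic and the denominators are nonzero. -/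

import Mathlib

open MvPolynomial

/-- The partial derivative `∂f/∂u_p` of a function on ℂⁿ. -/
noncomputable def pd {n : ℕ} (f : (Fin n → ℂ) → ℂ) (p : Fin n) (u : Fin n → ℂ) : ℂ :=
  fderiv ℂ f u (Pi.single p 1)

/-- `f` is meromorphic on ℂⁿ: a quotient of two everywhere-analytic functions. -/
def Mero {n : ℕ} (f : (Fin n → ℂ) → ℂ) : Prop :=
  ∃ g h : (Fin n → ℂ) → ℂ, (∀ u, AnalyticAt ℂ g u) ∧ (∀ u, AnalyticAt ℂ h u) ∧
    (∃ u, h u ≠ 0) ∧ ∀ u, h u ≠ 0 → f u = g u / h u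

/-- The Jacobian determinant of the family `φ` is not identically zero. -/
def AnalyticallyIndep {n : ℕ} (φ : Fin n → (Fin n → ℂ) → ℂ) : Prop :=
  ∃ u : Fin n → ℂ, (∀ j, AnalyticAt ℂ (φ j) u) ∧
    Matrix.det (Matrix.of fun k p => pd (φ k) p u) ≠ 0

/-- `Φ = (φ₁,…,φ_n)` admits an algebraic addition theorem: for each `k` there is a
polynomial `G_k` in the variables `λ` (= `none`), `x_j` (= `some (inl j)`) and
`y_j` (= `some (inr j)`), of degree ≥ 1 in `λ`, with
`G_k(φ_k(u+v); φ(u), φ(v)) = 0` wherever all functions involved are analytic. -/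
def AdmitsAAT {n : ℕ} (φ : Fin n → (Fin n → ℂ) → ℂ) : Prop :=
  ∀ k : Fin n, ∃ G : MvPolynomial (Option (Fin n ⊕ Fin n)) ℂ,
    1 ≤ G.degreeOf none ∧
    ∀ u v : Fin n → ℂ, (∀ j, AnalyticAt ℂ (φ j) u) → (∀ j, AnalyticAt ℂ (φ j) v) →
      AnalyticAt ℂ (φ k) (u + v) →
      eval (fun i => i.elim (φ k (u + v)) (Sum.elim (fun j => φ j u) fun j => φ j v)) G = 0

/-- The valuation sending the variable `none` to `θ(u)` and `some j` to `φ_j(u)`. -/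
noncomputable def tval {n : ℕ} (θ : (Fin n → ℂ) → ℂ) (φ : Fin n → (Fin n → ℂ) → ℂ)
    (u : Fin n → ℂ) : Option (Fin n) → ℂ :=
  fun i => i.elim (θ u) fun j => φ j u

/-- `f` is a rational function on ℂⁿ. -/
def RatFn {n : ℕ} (f : (Fin n → ℂ) → ℂ) : Prop :=
  ∃ P Q : MvPolynomial (Fin n) ℂ, Q ≠ 0 ∧
    ∃ s : Set (Fin n → ℂ), IsOpen s ∧ s.Nonempty ∧
      ∀ u ∈ s, f u = eval u P / eval u Q

open Filter Topology

lemma removable_finset (Z : Finset ℂ) : ∀ (U : Set ℂ) (s : ℂ → ℂ), IsOpen U →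
    DifferentiableOn ℂ s (U \ Z) →
    (∀ z ∈ U, ∃ M : ℝ, ∀ᶠ w in 𝓝 z, w ∉ Z → ‖s w‖ ≤ M) →
    ∃ f : ℂ → ℂ, DifferentiableOn ℂ f U ∧ ∀ z ∈ U, z ∉ Z → f z = s z := by
  induction Z using Finset.induction_on with
  | empty =>
    intro U s hU hs hb
    exact ⟨s, by simpa using hs, fun _ _ _ => rfl⟩
  | insert a Z ha ih =>
    intro U s hU hs hb
    have hZc : ∀ z : ℂ, ∀ᶠ w in 𝓝[≠] z, w ∉ insert a Z := by
      intro z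
      have h1 : ((insert a Z : Finset ℂ) : Set ℂ) \ {z} ∈ (𝓝[≠] z ⊓ 𝓟 ((insert a Z : Finset ℂ) : Set ℂ)) := by
        rw [inf_comm]
        exact Filter.mem_of_superset (Filter.inter_mem_inf (mem_principal_self _) (self_mem_nhdsWithin))
          (fun x hx => hx)
      have h2 : IsClosed (((insert a Z : Finset ℂ) : Set ℂ) \ {z}) :=
        ((insert a Z).finite_toSet.subset Set.diff_subset).isClosed
      have h3 : ∀ᶠ w in 𝓝 z, w ∉ ((insert a Z : Finset ℂ) : Set ℂ) \ {z} :=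
        h2.isOpen_compl.mem_nhds (by simp)
      filter_upwards [nhdsWithin_le_nhds h3, self_mem_nhdsWithin] with w hw hwz hmem
      exact hw ⟨by exact_mod_cast hmem, hwz⟩
    obtain ⟨f, hf, hfs⟩ := ih (U \ {a}) s (hU.sdiff isClosed_singleton)
      (hs.mono (by
        rintro z ⟨⟨hzU, hza⟩, hzZ⟩
        refine ⟨hzU, ?_⟩
        simpa using ⟨hza, hzZ⟩))
      (by
        rintro z ⟨hzU, hza⟩
        obtain ⟨M, hM⟩ := hb z hzU
        refine ⟨M, ?_⟩
        have : ∀ᶠ w in 𝓝 z, w ≠ a := isOpen_ne.mem_nhds hza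
        filter_upwards [hM, this] with w hw hwa hwZ
        exact hw (by simp [hwa, hwZ]))
    by_cases haU : a ∈ U
    · obtain ⟨M, hM⟩ := hb a haU
      have hbd : ∀ᶠ w in 𝓝[≠] a, ‖f w‖ ≤ M := by
        filter_upwards [nhdsWithin_le_nhds hM, hZc a, nhdsWithin_le_nhds (hU.mem_nhds haU),
          self_mem_nhdsWithin] with w h1 h2 h3 h4
        rw [hfs w ⟨h3, h4⟩ (fun h => h2 (Finset.mem_insert_of_mem h))]
        exact h1 h2
      rw [eventually_nhdsWithin_iff] at hbd
      obtain ⟨V, hVsub, hVo, haV⟩ := mem_nhds_iff.1 (hbd.and (hU.mem_nhds haU))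
      have hd := Complex.differentiableOn_update_limUnder_of_bddAbove (f := f) (hVo.mem_nhds haV)
        (hf.mono (fun z hz => ⟨(hVsub hz.1).2, hz.2⟩))
        ⟨M, by rintro _ ⟨z, hz, rfl⟩; exact (hVsub hz.1).1 hz.2⟩
      refine ⟨Function.update f a (limUnder (𝓝[≠] a) f), ?_, ?_⟩
      · intro z hz
        by_cases hza : z = a
        · subst hza
          exact (hd.differentiableAt (hVo.mem_nhds haV)).differentiableWithinAt
        · have h1 : DifferentiableAt ℂ f z :=
            hf.differentiableAt ((hU.sdiff isClosed_singleton).mem_nhds ⟨hz, hza⟩)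
          refine (h1.congr_of_eventuallyEq ?_).differentiableWithinAt
          have : ∀ᶠ w in 𝓝 z, w ≠ a := isOpen_ne.mem_nhds hza
          filter_upwards [this] with w hw
          simp [Function.update_of_ne hw]
      · intro z hz hzn
        have hza : z ≠ a := fun h => hzn (by simp [h])
        rw [Function.update_of_ne hza]
        exact hfs z ⟨hz, hza⟩ (fun h => hzn (Finset.mem_insert_of_mem h))
    · have : U \ {a} = U := by
        ext z; constructor
        · exact fun h => h.1
        · exact fun h => ⟨h, fun h' => haU (h' ▸ h)⟩
      rw [this] at hf hfs
      exact ⟨f, hf, fun z hz hzn => hfs z hz (fun h => hzn (Finset.mem_insert_of_mem h))⟩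

lemma entire_poly_growth (N : ℕ) : ∀ (f : ℂ → ℂ) (C : ℝ), Differentiable ℂ f →
    (∀ z, ‖f z‖ ≤ C * (1 + ‖z‖) ^ N) →
    ∃ p : Polynomial ℂ, p.natDegree ≤ N ∧ ∀ z, f z = p.eval z := by
  induction N with
  | zero =>
    intro f C hf hb
    refine ⟨Polynomial.C (f 0), by simp, fun z => ?_⟩
    have : Bornology.IsBounded (Set.range f) := by
      refine (isBounded_iff_forall_norm_le).2 ⟨C, ?_⟩
      rintro _ ⟨z, rfl⟩
      simpa using hb z
    simpa using hf.apply_eq_apply_of_bounded this z 0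
  | succ N ih =>
    intro f C hf hb
    have hC : 0 ≤ C := by
      have := (norm_nonneg _).trans (hb 0); simpa using this
    have hd : Differentiable ℂ (dslope f 0) := by
      rw [← differentiableOn_univ]
      exact (Complex.differentiableOn_dslope univ_mem).2 hf.differentiableOn
    obtain ⟨K, hK⟩ := (isCompact_closedBall (0:ℂ) 1).exists_bound_of_continuousOn
      (f := dslope f 0) hd.continuous.continuousOn
    have hK0 : 0 ≤ K := (norm_nonneg _).trans (hK 0 (by simp))
    obtain ⟨p, hp, hpe⟩ := ih (dslope f 0) (K + 2 * (C + ‖f 0‖)) hd (by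
      intro z
      have h1 : 1 ≤ (1 + ‖z‖) ^ N := one_le_pow₀ (by linarith [norm_nonneg z])
      by_cases hz : ‖z‖ ≤ 1
      · have := hK z (by simpa using hz)
        calc ‖dslope f 0 z‖ ≤ K := this
          _ ≤ (K + 2 * (C + ‖f 0‖)) * 1 := by nlinarith [norm_nonneg (f 0)]
          _ ≤ _ := by gcongr
      · push Not at hz
        have hz0 : z ≠ 0 := by rintro rfl; simp at hz; linarith
        rw [dslope_of_ne _ hz0, slope_def_field, norm_div, sub_zero, div_le_iff₀ (by linarith)]
        calc ‖f z - f 0‖ ≤ ‖f z‖ + ‖f 0‖ := norm_sub_le _ _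
          _ ≤ C * (1 + ‖z‖) ^ (N+1) + ‖f 0‖ * (1 + ‖z‖) ^ (N+1) := by
              gcongr
              · exact hb z
              · exact le_mul_of_one_le_right (norm_nonneg _) (one_le_pow₀ (by linarith [norm_nonneg z]))
          _ = (C + ‖f 0‖) * (1 + ‖z‖) ^ N * (1 + ‖z‖) := by ring
          _ ≤ (C + ‖f 0‖) * (1 + ‖z‖) ^ N * (2 * ‖z‖) := by
              gcongr; linarith
          _ ≤ (K + 2 * (C + ‖f 0‖)) * (1 + ‖z‖) ^ N * ‖z‖ := by
              nlinarith [mul_nonneg (mul_nonneg hK0 (by linarith : (0:ℝ) ≤ (1 + ‖z‖) ^ N)) (norm_nonneg z)])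
    refine ⟨Polynomial.X * p + Polynomial.C (f 0), ?_, fun z => ?_⟩
    · refine (Polynomial.natDegree_add_C).le.trans ?_
      refine Polynomial.natDegree_mul_le.trans ?_
      have := Polynomial.natDegree_X_le (R := ℂ)
      omega
    · have := sub_smul_dslope f 0 z
      simp only [Polynomial.eval_add, Polynomial.eval_mul, Polynomial.eval_X, Polynomial.eval_C,
        ← hpe]
      simp at this
      rw [this]; ring

lemma oneD_poly (Z : Finset ℂ) (s : ℂ → ℂ) (C : ℝ) (N : ℕ)
    (hs : ∀ z ∉ Z, DifferentiableAt ℂ s z) (hb : ∀ z ∉ Z, ‖s z‖ ≤ C * (1 + ‖z‖) ^ N) :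
    ∃ p : Polynomial ℂ, p.natDegree ≤ N ∧ ∀ z ∉ Z, s z = p.eval z := by
  obtain ⟨f, hf, hfs⟩ := removable_finset Z Set.univ s isOpen_univ
    (fun z hz => (hs z (by simpa using hz.2)).differentiableWithinAt) (by
      intro z _
      have hc : Continuous (fun w : ℂ => C * (1 + ‖w‖) ^ N) := by fun_prop
      refine ⟨C * (1 + ‖z‖) ^ N + 1, ?_⟩
      filter_upwards [hc.continuousAt.eventually_lt continuousAt_const
        (show C * (1 + ‖z‖) ^ N < C * (1 + ‖z‖) ^ N + 1 by linarith)] with w hw hwZ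
      exact (hb w hwZ).trans hw.le)
  rw [differentiableOn_univ] at hf
  have hdense : Dense ((Z : Set ℂ)ᶜ) := by
    exact (Z.finite_toSet.countable).dense_compl ℝ
  have hcl : ∀ z, ‖f z‖ ≤ C * (1 + ‖z‖) ^ N := by
    have h1 : IsClosed {z : ℂ | ‖f z‖ ≤ C * (1 + ‖z‖) ^ N} :=
      isClosed_le hf.continuous.norm (by fun_prop)
    intro z
    have h2 : closure ((Z : Set ℂ)ᶜ) ⊆ {z : ℂ | ‖f z‖ ≤ C * (1 + ‖z‖) ^ N} := by
      apply h1.closure_subset_iff.2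
      intro w hw
      have hw' : w ∉ Z := by simpa using hw
      simp only [Set.mem_setOf_eq]
      rw [hfs w trivial hw']; exact hb w hw'
    exact h2 (hdense z)
  obtain ⟨p, hp, hpe⟩ := entire_poly_growth N f C hf hcl
  exact ⟨p, hp, fun z hz => by rw [← hpe, hfs z trivial hz]⟩

lemma ext_poly_fin (n : ℕ) : ∀ (Δ : MvPolynomial (Fin n) ℂ) (s : (Fin n → ℂ) → ℂ) (C : ℝ) (N : ℕ),
    (∀ x, eval x Δ ≠ 0 → ∀ i, DifferentiableAt ℂ (fun z => s (Function.update x i z)) (x i)) →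
    (∀ x, eval x Δ ≠ 0 → ‖s x‖ ≤ C * (1 + ‖x‖) ^ N) →
    ∃ p : MvPolynomial (Fin n) ℂ, ∀ x, eval x Δ ≠ 0 → s x = eval x p := by
  induction n with
  | zero =>
    intro Δ s C N hd hb
    refine ⟨MvPolynomial.C (s 0), fun x _ => ?_⟩
    rw [Subsingleton.elim x 0]; simp
  | succ n ih =>
    intro Δ s C N hd hb
    have evc : ∀ (P : MvPolynomial (Fin (n+1)) ℂ) (a : ℂ) (x : Fin n → ℂ),
        eval (Fin.cons a x : Fin (n+1) → ℂ) P
          = Polynomial.eval a (Polynomial.map (eval x) (finSuccEquiv ℂ n P)) := by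
      intro P a x
      rw [eval_eq_eval_mv_eval']
    have key : ∀ x0, eval x0 Δ ≠ 0 → ∃ p Δ' : MvPolynomial (Fin (n+1)) ℂ, eval x0 Δ' ≠ 0 ∧
        ∀ x, eval x Δ' ≠ 0 → s x = eval x p := by
      intro x0 hx0
      obtain ⟨a0, y0, rfl⟩ : ∃ (a0 : ℂ) (y0 : Fin n → ℂ), x0 = (Fin.cons a0 y0 : Fin (n+1) → ℂ) :=
        ⟨x0 0, Fin.tail x0, (Fin.cons_self_tail x0).symm⟩
      have hfin : ∀ y : Fin n → ℂ, (∃ a, eval (Fin.cons a y : Fin (n+1) → ℂ) Δ ≠ 0) →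
          ∃ Z : Finset ℂ, ∀ a, a ∉ Z ↔ eval (Fin.cons a y : Fin (n+1) → ℂ) Δ ≠ 0 := by
        rintro y ⟨a, ha⟩
        have hne : Polynomial.map (eval y) (finSuccEquiv ℂ n Δ) ≠ 0 := by
          intro h; apply ha; rw [evc, h]; simp
        refine ⟨(Polynomial.map (eval y) (finSuccEquiv ℂ n Δ)).roots.toFinset, fun b => ?_⟩
        rw [evc, Multiset.mem_toFinset, Polynomial.mem_roots hne, Polynomial.IsRoot.def]
      obtain ⟨Z0, hZ0⟩ := hfin y0 ⟨a0, hx0⟩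
      obtain ⟨T, hT, hTc⟩ := (Z0.finite_toSet.infinite_compl).exists_subset_card_eq (N+1)
      let Δt : ℂ → MvPolynomial (Fin n) ℂ := fun t => (finSuccEquiv ℂ n Δ).eval (MvPolynomial.C t)
      have hΔt : ∀ t y, eval y (Δt t) = eval (Fin.cons t y : Fin (n+1) → ℂ) Δ := by
        intro t y
        rw [evc, Polynomial.eval_map, ← Polynomial.eval₂_at_apply]
        simp
      have hp : ∀ t, ∃ p : MvPolynomial (Fin n) ℂ, ∀ y, eval y (Δt t) ≠ 0 →
          s (Fin.cons t y : Fin (n+1) → ℂ) = eval y p := by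
        intro t
        refine ih (Δt t) (fun y => s (Fin.cons t y : Fin (n+1) → ℂ)) (C * (1 + ‖t‖) ^ N) N ?_ ?_
        · intro y hy i
          rw [hΔt] at hy
          have := hd _ hy i.succ
          simp only [Fin.cons_succ] at this
          convert this using 2 with z
          rw [Fin.cons_update]
        · intro y hy
          rw [hΔt] at hy
          refine (hb _ hy).trans ?_
          have hC : 0 ≤ C := by
            by_contra h
            have := (norm_nonneg _).trans (hb _ hy)
            have h2 : 0 < (1 + ‖(Fin.cons t y : Fin (n+1) → ℂ)‖) ^ N := by positivity
            nlinarith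
          have hn : ‖(Fin.cons t y : Fin (n+1) → ℂ)‖ ≤ ‖t‖ + ‖y‖ := by
            refine (pi_norm_le_iff_of_nonneg (by positivity)).2 (fun i => ?_)
            refine Fin.cases ?_ (fun j => ?_) i
            · simp
            · simp only [Fin.cons_succ]
              exact (norm_le_pi_norm y j).trans (by linarith [norm_nonneg t])
          rw [mul_assoc, ← mul_pow]
          gcongr
          nlinarith [mul_nonneg (norm_nonneg t) (norm_nonneg y)]
      choose p hp using hp
      refine ⟨∑ t ∈ T, rename Fin.succ (p t) *
        Polynomial.aeval (X 0 : MvPolynomial (Fin (n+1)) ℂ) (Lagrange.basis T id t),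
        Δ * ∏ t ∈ T, rename Fin.succ (Δt t), ?_, ?_⟩
      · rw [map_mul, map_prod]
        refine mul_ne_zero hx0 (Finset.prod_ne_zero_iff.2 fun t ht => ?_)
        rw [eval_rename]
        have : (Fin.cons a0 y0 : Fin (n+1) → ℂ) ∘ Fin.succ = y0 := by ext i; simp
        rw [this, hΔt]
        exact (hZ0 t).1 (by simpa using hT ht)
      · intro x hx
        obtain ⟨a, y, rfl⟩ : ∃ (a0 : ℂ) (y0 : Fin n → ℂ), x = (Fin.cons a0 y0 : Fin (n+1) → ℂ) :=
          ⟨x 0, Fin.tail x, (Fin.cons_self_tail x).symm⟩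
        have hcs : (Fin.cons a y : Fin (n+1) → ℂ) ∘ Fin.succ = y := by ext i; simp
        rw [map_mul, map_prod] at hx
        have hxΔ := left_ne_zero_of_mul hx
        have hxt := Finset.prod_ne_zero_iff.1 (right_ne_zero_of_mul hx)
        simp only [eval_rename, hcs] at hxt
        obtain ⟨Z, hZ⟩ := hfin y ⟨a, hxΔ⟩
        obtain ⟨q, hq, hqe⟩ := oneD_poly Z (fun z => s (Fin.cons z y : Fin (n+1) → ℂ))
          (C * (1 + ‖y‖) ^ N) N (by
            intro z hz
            have := hd _ ((hZ z).1 hz) 0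
            simpa [Fin.update_cons_zero] using this) (by
            intro z hz
            refine (hb _ ((hZ z).1 hz)).trans ?_
            have hC : 0 ≤ C := by
              by_contra h
              have := (norm_nonneg _).trans (hb _ hxΔ)
              have h2 : 0 < (1 + ‖(Fin.cons a y : Fin (n+1) → ℂ)‖) ^ N := by positivity
              nlinarith
            have hn : ‖(Fin.cons z y : Fin (n+1) → ℂ)‖ ≤ ‖z‖ + ‖y‖ := by
              refine (pi_norm_le_iff_of_nonneg (by positivity)).2 (fun i => ?_)
              refine Fin.cases ?_ (fun j => ?_) i
              · simp
              · simp only [Fin.cons_succ]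
                exact (norm_le_pi_norm y j).trans (by linarith [norm_nonneg z])
            rw [mul_assoc, ← mul_pow]
            gcongr
            nlinarith [mul_nonneg (norm_nonneg z) (norm_nonneg y)])
        have hqT : q = Lagrange.interpolate T id (fun t => q.eval t) := by
          refine Lagrange.eq_interpolate (Set.injOn_id _) ?_
          rw [hTc]
          exact (Polynomial.degree_le_natDegree).trans_lt (by exact_mod_cast Nat.lt_succ_of_le hq)
        rw [hqe a ((hZ a).2 hxΔ), hqT, Lagrange.interpolate_apply, Polynomial.eval_finset_sum,
          map_sum]
        refine Finset.sum_congr rfl fun t ht => ?_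
        rw [map_mul, eval_rename, hcs, ← hp t y (hxt t ht), Polynomial.eval_mul, Polynomial.eval_C,
          ← hqe t ((hZ t).2 (by rw [← hΔt]; exact hxt t ht))]
        congr 1
        have : eval (Fin.cons a y : Fin (n+1) → ℂ)
            (Polynomial.aeval (X 0 : MvPolynomial (Fin (n+1)) ℂ) (Lagrange.basis T id t)) =
            Polynomial.aeval (eval (Fin.cons a y : Fin (n+1) → ℂ) (X 0)) (Lagrange.basis T id t) := by
          have := Polynomial.aeval_algHom_apply (MvPolynomial.aeval (Fin.cons a y : Fin (n+1) → ℂ))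
            (X 0 : MvPolynomial (Fin (n+1)) ℂ) (Lagrange.basis T id t)
          rw [MvPolynomial.aeval_eq_eval] at this
          exact this.symm
        rw [this]; simp [Polynomial.aeval_def, Polynomial.eval₂_eq_eval_map]
    by_cases hex : ∃ x0, eval x0 Δ ≠ 0
    · obtain ⟨x1, hx1⟩ := hex
      obtain ⟨p, Δ1, h1, hp1⟩ := key x1 hx1
      refine ⟨p, fun x hx => ?_⟩
      obtain ⟨q, Δ2, h2, hp2⟩ := key x hx
      have hpq : (p - q) * (Δ1 * Δ2) = 0 := by
        apply MvPolynomial.funext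
        intro z
        by_cases hz : eval z (Δ1 * Δ2) = 0
        · simp [hz]
        · rw [map_mul] at hz
          simp [← hp1 z (left_ne_zero_of_mul hz), ← hp2 z (right_ne_zero_of_mul hz)]
      have : p = q := by
        rcases mul_eq_zero.1 hpq with h | h
        · exact sub_eq_zero.1 h
        · rcases mul_eq_zero.1 h with h | h
          · simp [h] at h1
          · simp [h] at h2
      rw [this]; exact hp2 x h2
    · push Not at hex
      exact ⟨0, fun x hx => absurd (hex x) hx⟩

/-- Functions with polynomial growth, holomorphic in each variable off a hypersurface,
are polynomials. -/
lemma ext_poly {σ : Type} [Fintype σ] [DecidableEq σ] (Δ : MvPolynomial σ ℂ) (s : (σ → ℂ) → ℂ)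
    (C : ℝ) (N : ℕ)
    (hd : ∀ x, eval x Δ ≠ 0 → DifferentiableAt ℂ s x)
    (hb : ∀ x, eval x Δ ≠ 0 → ‖s x‖ ≤ C * (1 + ‖x‖) ^ N) :
    ∃ p : MvPolynomial σ ℂ, ∀ x, eval x Δ ≠ 0 → s x = eval x p := by
  let e := Fintype.equivFin σ
  have hnorm : ∀ y : Fin (Fintype.card σ) → ℂ, ‖y ∘ e‖ ≤ ‖y‖ := fun y =>
    (pi_norm_le_iff_of_nonneg (norm_nonneg _)).2 fun i => norm_le_pi_norm y (e i)
  obtain ⟨p, hp⟩ := ext_poly_fin (Fintype.card σ) (rename e Δ) (fun y => s (y ∘ e)) |C| N (by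
      intro y hy i
      rw [eval_rename] at hy
      have h1 := hd _ hy
      have h2 : DifferentiableAt ℂ (fun z : ℂ => (Function.update y i z) ∘ e) (y i) := by
        rw [differentiableAt_pi]
        intro j
        simp only [Function.comp]
        have := (hasDerivAt_update y i (y i)).differentiableAt
        rw [differentiableAt_pi] at this
        exact this (e j)
      refine DifferentiableAt.comp (y i) (g := s) ?_ h2
      simpa using h1) (by
      intro y hy
      rw [eval_rename] at hy
      refine (hb _ hy).trans ?_
      have := hnorm y
      gcongr
      exact le_abs_self C)
  refine ⟨rename e.symm p, fun x hx => ?_⟩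
  have := hp (x ∘ e.symm) (by rw [eval_rename]; simpa [Function.comp_assoc] using hx)
  rw [eval_rename]
  simpa [Function.comp_assoc] using this

lemma dense_ne {E : Type*} [NormedAddCommGroup E] [NormedSpace ℂ E] (h : E → ℂ)
    (hh : ∀ u, AnalyticAt ℂ h u) (h0 : ∃ u, h u ≠ 0) : Dense {u | h u ≠ 0} := by
  intro x
  by_contra hx
  rw [mem_closure_iff_frequently, not_frequently] at hx
  have hx' : h =ᶠ[𝓝 x] fun _ => 0 := by
    filter_upwards [hx] with y hy
    simpa using hy
  have : NormedSpace ℝ E := NormedSpace.restrictScalars ℝ ℂ E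
  have := AnalyticOnNhd.eq_of_eventuallyEq (f := h) (g := fun _ => 0) (fun u _ => hh u)
    (fun u _ => analyticAt_const) hx'
  obtain ⟨u, hu⟩ := h0
  exact hu (by rw [this])

lemma isOpen_hne {E : Type*} [NormedAddCommGroup E] [NormedSpace ℂ E] (h : E → ℂ)
    (hh : ∀ u, AnalyticAt ℂ h u) : IsOpen {u | h u ≠ 0} := by
  have : Continuous h := continuous_iff_continuousAt.2 fun u => (hh u).continuousAt
  exact isOpen_ne_fun this continuous_const

lemma finite_zeros (k : ℂ → ℂ) (hk : ∀ z, AnalyticAt ℂ k z) (h0 : ∃ z, k z ≠ 0) (ρ : ℝ) :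
    {z | z ∈ Metric.closedBall (0 : ℂ) ρ ∧ k z = 0}.Finite := by
  by_contra hinf
  obtain ⟨x, hx, hacc⟩ := Set.Infinite.exists_accPt_of_subset_isCompact hinf
    (isCompact_closedBall (0 : ℂ) ρ) (fun z hz => hz.1)
  rw [accPt_iff_frequently_nhdsNE] at hacc
  have := AnalyticOnNhd.eqOn_zero_of_preconnected_of_frequently_eq_zero (f := k) (U := Set.univ)
    (fun z _ => hk z) isPreconnected_univ (Set.mem_univ x) (hacc.mono fun y hy => hy.2)
  obtain ⟨z, hz⟩ := h0
  exact hz (this (Set.mem_univ z))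

lemma diff_circleAvg {E : Type*} [NormedAddCommGroup E] [NormedSpace ℂ E] (q : E → ℂ)
    (O : Set E) (hO : IsOpen O) (hq : ∀ x ∈ O, AnalyticAt ℂ q x) (e x1 : E) (ρ : ℝ)
    (hx : ∀ z ∈ Metric.sphere (0 : ℂ) |ρ|, x1 + z • e ∈ O) :
    DifferentiableAt ℂ (fun x => Real.circleAverage (fun z => q (x + z • e)) 0 ρ) x1 := by
  have hK : IsCompact (Metric.sphere (0 : ℂ) |ρ|) := isCompact_sphere _ _
  have hcont : ∀ z ∈ Metric.sphere (0 : ℂ) |ρ|, ContinuousAt (fun p : E × ℂ => p.1 + p.2 • e) (x1, z) := by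
    intro z _; fun_prop
  have hcd : ∀ z ∈ Metric.sphere (0 : ℂ) |ρ|, ContinuousAt (fun p : E × ℂ => ‖fderiv ℂ q (p.1 + p.2 • e)‖) (x1, z) := by
    intro z hz
    have h1 : ContinuousAt (fderiv ℂ q) (x1 + z • e) := ((hq _ (hx z hz)).fderiv).continuousAt
    have h2 : ContinuousAt (fun p : E × ℂ => fderiv ℂ q (p.1 + p.2 • e)) (x1, z) :=
      ContinuousAt.comp (f := fun p : E × ℂ => p.1 + p.2 • e) (g := fderiv ℂ q) h1 (hcont z hz)
    exact h2.norm
  obtain ⟨C, hC⟩ : ∃ C : ℝ, ∀ z ∈ Metric.sphere (0 : ℂ) |ρ|, ‖fderiv ℂ q (x1 + z • e)‖ < C := by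
    have : ContinuousOn (fun z : ℂ => ‖fderiv ℂ q (x1 + z • e)‖) (Metric.sphere (0 : ℂ) |ρ|) := by
      intro z hz
      have h2 : ContinuousAt (fun z : ℂ => ((x1, z) : E × ℂ)) z := by fun_prop
      have := ContinuousAt.comp (f := fun z : ℂ => ((x1, z) : E × ℂ)) (x := z) (hcd z hz) h2
      exact this.continuousWithinAt
    obtain ⟨C, hC⟩ := hK.bddAbove_image this
    exact ⟨C + 1, fun z hz => lt_of_le_of_lt (hC ⟨z, hz, rfl⟩) (by linarith)⟩
  have hev : ∀ᶠ x in 𝓝 x1, ∀ z ∈ Metric.sphere (0 : ℂ) |ρ|, x + z • e ∈ O ∧ ‖fderiv ℂ q (x + z • e)‖ < C := by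
    refine hK.eventually_forall_of_forall_eventually (P := fun x z => x + z • e ∈ O ∧ ‖fderiv ℂ q (x + z • e)‖ < C) ?_
    intro z hz
    exact ((hcont z hz).eventually (hO.mem_nhds (hx z hz))).and ((hcd z hz).eventually_lt_const (hC z hz))
  have hcm : ∀ t, circleMap 0 ρ t ∈ Metric.sphere (0 : ℂ) |ρ| := circleMap_mem_sphere' 0 ρ
  have hcx : ∀ x, (∀ z ∈ Metric.sphere (0 : ℂ) |ρ|, x + z • e ∈ O) →
      Continuous (fun t => q (x + circleMap 0 ρ t • e)) := by
    intro x hx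
    refine continuous_iff_continuousAt.2 fun t => ?_
    have h1 : ContinuousAt q (x + circleMap 0 ρ t • e) := (hq _ (hx _ (hcm t))).continuousAt
    exact ContinuousAt.comp (f := fun t => x + circleMap 0 ρ t • e) h1 (by fun_prop)
  have hcx' : Continuous (fun t => fderiv ℂ q (x1 + circleMap 0 ρ t • e)) := by
    refine continuous_iff_continuousAt.2 fun t => ?_
    have h1 : ContinuousAt (fderiv ℂ q) (x1 + circleMap 0 ρ t • e) := (hq _ (hx _ (hcm t))).fderiv.continuousAt
    exact ContinuousAt.comp (f := fun t => x1 + circleMap 0 ρ t • e) h1 (by fun_prop)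
  have := intervalIntegral.hasFDerivAt_integral_of_dominated_of_fderiv_le (𝕜 := ℂ) (a := 0) (b := 2 * Real.pi)
    (μ := MeasureTheory.volume) (F := fun x t => q (x + circleMap 0 ρ t • e))
    (F' := fun x t => fderiv ℂ q (x + circleMap 0 ρ t • e)) (bound := fun _ => C) (x₀ := x1) hev
    (by
      filter_upwards [hev] with x hx
      exact (hcx x fun z hz => (hx z hz).1).aestronglyMeasurable)
    ((hcx x1 hx).intervalIntegrable _ _) (hcx'.aestronglyMeasurable)
    (Eventually.of_forall fun t _ x hx => (hx _ (hcm t)).2.le)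
    (by simp) (Eventually.of_forall fun t _ x hx => by
      have h1 := (hq _ (hx _ (hcm t)).1).differentiableAt.hasFDerivAt
      have h2 := h1.comp x ((hasFDerivAt_id (𝕜 := ℂ) x).add_const (circleMap 0 ρ t • e))
      rw [ContinuousLinearMap.comp_id] at h2
      exact h2)
  simp only [Real.circleAverage_def]
  exact (this.differentiableAt).const_smul _

lemma riemann_ext {E : Type*} [NormedAddCommGroup E] [NormedSpace ℂ E] (g h : E → ℂ)
    (hg : ∀ u, AnalyticAt ℂ g u) (hh : ∀ u, AnalyticAt ℂ h u) (h0 : ∃ u, h u ≠ 0) (w : E) (M : ℝ)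
    (hb : ∀ᶠ x in 𝓝 w, h x ≠ 0 → ‖g x / h x‖ ≤ M) :
    ∃ F : E → ℂ, (∀ᶠ x in 𝓝 w, DifferentiableAt ℂ F x) ∧
      ∀ᶠ x in 𝓝 w, h x ≠ 0 → F x = g x / h x := by
  obtain ⟨u, hu⟩ := h0
  set e := u - w with he
  have hline : ∀ (f : E → ℂ), (∀ u, AnalyticAt ℂ f u) → ∀ x z, AnalyticAt ℂ (fun z : ℂ => f (x + z • e)) z := by
    intro f hf x z
    exact (hf _).comp_of_eq (f := fun z : ℂ => x + z • e) (by fun_prop) rfl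
  -- zeros on the line through w
  have hz : ∀ᶠ z in 𝓝[≠] (0 : ℂ), h (w + z • e) ≠ 0 := by
    rcases (hline h hh w 0).eventually_eq_zero_or_eventually_ne_zero with h1 | h1
    · exfalso
      have := AnalyticOnNhd.eqOn_zero_of_preconnected_of_eventuallyEq_zero (f := fun z : ℂ => h (w + z • e))
        (U := Set.univ) (fun z _ => hline h hh w z) isPreconnected_univ (Set.mem_univ 0) h1
        (Set.mem_univ 1)
      simp [he] at this
      exact hu this
    · exact h1
  obtain ⟨δ, hδ, hδb⟩ := Metric.eventually_nhds_iff.1 hb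
  obtain ⟨η, hη, hηz⟩ := Metric.eventually_nhds_iff.1 (eventually_nhdsWithin_iff.1 hz)
  obtain ⟨ρ, hρ, hρη, hρδ⟩ : ∃ ρ : ℝ, 0 < ρ ∧ ρ < η ∧ 2 * ρ * ‖e‖ < δ / 2 := by
    refine ⟨min (η / 2) (δ / (8 * (‖e‖ + 1))), by positivity, lt_of_le_of_lt (min_le_left _ _) (by linarith), ?_⟩
    have h1 : min (η / 2) (δ / (8 * (‖e‖ + 1))) ≤ δ / (8 * (‖e‖ + 1)) := min_le_right _ _
    have h2 : δ / (8 * (‖e‖ + 1)) * (8 * (‖e‖ + 1)) = δ := by field_simp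
    nlinarith [norm_nonneg e, mul_le_mul_of_nonneg_right h1 (norm_nonneg e), show 0 < δ / (8 * (‖e‖ + 1)) by positivity]
  have habs : |ρ| = ρ := abs_of_pos hρ
  have hcirc : ∀ᶠ x in 𝓝 w, ∀ z ∈ Metric.sphere (0 : ℂ) |ρ|, h (x + z • e) ≠ 0 := by
    refine (isCompact_sphere (0 : ℂ) |ρ|).eventually_forall_of_forall_eventually
      (P := fun x z => h (x + z • e) ≠ 0) fun z hz => ?_
    have hzn : ‖z‖ = ρ := by simpa [habs] using hz
    have h1 : h (w + z • e) ≠ 0 := hηz (by simpa [hzn] using hρη) (by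
      intro h; simp at h; rw [h] at hzn; simp at hzn; linarith)
    have h2 : ContinuousAt (fun p : E × ℂ => h (p.1 + p.2 • e)) (w, z) :=
      ContinuousAt.comp (f := fun p : E × ℂ => p.1 + p.2 • e) (g := h) (hh _).continuousAt (by fun_prop)
    exact h2.eventually_ne h1
  have hO := isOpen_hne h hh
  refine ⟨fun x => Real.circleAverage (fun z => g (x + z • e) / h (x + z • e)) 0 ρ, ?_, ?_⟩
  · filter_upwards [hcirc] with x hx
    exact diff_circleAvg (fun y => g y / h y) _ hO (fun y hy => (hg y).div (hh y) hy) e x ρ hx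
  · filter_upwards [hcirc, Metric.ball_mem_nhds w (half_pos hδ)] with x hx hxδ hhx
    have hfin := finite_zeros (fun z => h (x + z • e)) (hline h hh x) ⟨0, by simpa using hhx⟩ (2 * ρ)
    set Z := hfin.toFinset with hZ
    have hZm : ∀ z, z ∈ Z ↔ (‖z‖ ≤ 2 * ρ ∧ h (x + z • e) = 0) := by
      intro z; simp [hZ]
    have hxz : ∀ z ∈ Metric.ball (0 : ℂ) (2 * ρ), dist (x + z • e) w < δ := by
      intro z hz
      have hz' : ‖z‖ < 2 * ρ := by simpa using hz
      have h1 : dist (x + z • e) w ≤ dist x w + ‖z • e‖ := by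
        rw [dist_eq_norm, dist_eq_norm, add_sub_right_comm]; exact norm_add_le _ _
      have h2 : dist x w < δ / 2 := hxδ
      have h3 : ‖z‖ * ‖e‖ ≤ 2 * ρ * ‖e‖ := mul_le_mul_of_nonneg_right hz'.le (norm_nonneg e)
      rw [norm_smul] at h1
      linarith
    obtain ⟨f, hf, hfe⟩ := removable_finset Z (Metric.ball 0 (2 * ρ))
      (fun z => g (x + z • e) / h (x + z • e)) Metric.isOpen_ball (by
        intro z hz
        have hz1 : ‖z‖ < 2 * ρ := by simpa using hz.1
        have hz2 : h (x + z • e) ≠ 0 := fun h => hz.2 (by exact_mod_cast (hZm z).2 ⟨hz1.le, h⟩)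
        exact ((hline g hg x z).div (hline h hh x z) hz2).differentiableAt.differentiableWithinAt) (by
        intro z hz
        refine ⟨M, ?_⟩
        filter_upwards [Metric.isOpen_ball.mem_nhds hz] with y hy hyZ
        refine hδb (hxz y hy) fun h => hyZ ((hZm y).2 ⟨?_, h⟩)
        have : ‖y‖ < 2 * ρ := by simpa using hy
        exact this.le)
    have hsub : Metric.closedBall (0 : ℂ) |ρ| ⊆ Metric.ball 0 (2 * ρ) :=
      Metric.closedBall_subset_ball (by rw [habs]; linarith)
    have h1 : Real.circleAverage f 0 ρ = f 0 :=
      circleAverage_of_differentiable_on_off_countable (s := ∅) Set.countable_empty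
        (hf.continuousOn.mono hsub) (fun z hz => hf.differentiableAt (Metric.isOpen_ball.mem_nhds
          (hsub (Metric.ball_subset_closedBall hz.1))))
    have h2 : Real.circleAverage (fun z => g (x + z • e) / h (x + z • e)) 0 ρ = Real.circleAverage f 0 ρ := by
      refine Real.circleAverage_congr_sphere fun z hz => ?_
      refine (hfe z (hsub (Metric.sphere_subset_closedBall hz)) fun h => hx z hz ((hZm z).1 h).2).symm
    rw [h2, h1, hfe 0 (by simpa using hρ) (fun h => hhx (by simpa using ((hZm 0).1 h).2))]
    simp

lemma cont_fderiv_apply {E F : Type*} [NormedAddCommGroup E] [NormedSpace ℂ E]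
    [NormedAddCommGroup F] [NormedSpace ℂ F] (f : E → F) (w v : E)
    (hf : ∀ᶠ x in 𝓝 w, DifferentiableAt ℂ f x) :
    ContinuousAt (fun x => fderiv ℂ f x v) w := by
  obtain ⟨δ, hδ, hd⟩ := Metric.eventually_nhds_iff.1 hf
  obtain ⟨r, hr, hrv⟩ : ∃ r : ℝ, 0 < r ∧ r * ‖v‖ < δ / 2 := by
    refine ⟨δ / (4 * (‖v‖ + 1)), by positivity, ?_⟩
    have h2 : δ / (4 * (‖v‖ + 1)) * (4 * (‖v‖ + 1)) = δ := by field_simp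
    nlinarith [norm_nonneg v, show 0 < δ / (4 * (‖v‖ + 1)) by positivity]
  have hin : ∀ x, dist x w < δ / 2 → ∀ z : ℂ, ‖z‖ ≤ r → dist (x + z • v) w < δ := by
    intro x hx z hz
    have h1 : dist (x + z • v) w ≤ dist x w + ‖z • v‖ := by
      rw [dist_eq_norm, dist_eq_norm, add_sub_right_comm]; exact norm_add_le _ _
    rw [norm_smul] at h1
    have := mul_le_mul_of_nonneg_right hz (norm_nonneg v)
    linarith
  have hline : ∀ x, dist x w < δ / 2 → ∀ z : ℂ, ‖z‖ ≤ r →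
      HasDerivAt (fun z : ℂ => f (x + z • v)) (fderiv ℂ f (x + z • v) v) z := by
    intro x hx z hz
    have h1 := (hd (hin x hx z hz)).hasFDerivAt
    have h2 : HasDerivAt (fun z : ℂ => x + z • v) v z := by
      simpa using ((hasDerivAt_id z).smul_const v).const_add x
    exact h1.comp_hasDerivAt z h2
  rw [Metric.continuousAt_iff']
  intro ε hε
  have hev : ∀ᶠ x in 𝓝 w, ∀ z ∈ Metric.sphere (0 : ℂ) r, ‖f (x + z • v) - f (w + z • v)‖ ≤ ε * r / 2 := by
    refine (isCompact_sphere (0 : ℂ) r).eventually_forall_of_forall_eventually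
      (P := fun x z => ‖f (x + z • v) - f (w + z • v)‖ ≤ ε * r / 2) fun z hz => ?_
    have hzr : ‖z‖ ≤ r := by simpa using (by simpa using hz : ‖z‖ = r).le
    have hc : ContinuousAt f (w + z • v) := (hd (hin w (by simpa using hδ) z hzr)).continuousAt
    have h1 : ContinuousAt (fun p : E × ℂ => f (p.1 + p.2 • v) - f (w + p.2 • v)) (w, z) :=
      (ContinuousAt.comp (f := fun p : E × ℂ => p.1 + p.2 • v) (g := f) hc (by fun_prop)).sub
      (ContinuousAt.comp (f := fun p : E × ℂ => w + p.2 • v) (g := f) hc (by fun_prop))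
    have := h1.norm.eventually_lt_const (u := ε * r / 2) (by simp; positivity)
    exact this.mono fun p hp => hp.le
  filter_upwards [hev, Metric.ball_mem_nhds w (half_pos hδ)] with x hx hxδ
  have hw : dist w w < δ / 2 := by simpa using hδ
  have hD : ∀ z : ℂ, ‖z‖ ≤ r → DifferentiableAt ℂ (fun z : ℂ => f (x + z • v) - f (w + z • v)) z :=
    fun z hz => ((hline x hxδ z hz).sub (hline w hw z hz)).differentiableAt
  have h1 := Complex.norm_deriv_le_of_forall_mem_sphere_norm_le
    (f := fun z : ℂ => f (x + z • v) - f (w + z • v)) (c := 0) hr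
    (DifferentiableOn.diffContOnCl (fun z hz => (hD z (by
      have := Metric.closure_ball_subset_closedBall hz
      simpa using this)).differentiableWithinAt)) hx
  have h3 : deriv (fun z : ℂ => f (x + z • v) - f (w + z • v)) 0 = fderiv ℂ f x v - fderiv ℂ f w v := by
    have := ((hline x hxδ 0 (by simpa using hr.le)).sub (hline w hw 0 (by simpa using hr.le))).deriv
    simp only [zero_smul, add_zero] at this
    exact this
  rw [h3] at h1
  rw [dist_eq_norm]
  have : ε * r / 2 / r = ε / 2 := by field_simp
  linarith

/-- The `x`-part of a point of the big affine space. -/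
def px {n : ℕ} (y : Option (Fin n) → ℂ) : Fin n → ℂ := fun k => y (some k)

lemma norm_px_le {n : ℕ} (y : Option (Fin n) → ℂ) : ‖px y‖ ≤ ‖y‖ :=
  (pi_norm_le_iff_of_nonneg (norm_nonneg _)).2 fun k => norm_le_pi_norm y (some k)

lemma continuous_px {n : ℕ} : Continuous (px : (Option (Fin n) → ℂ) → Fin n → ℂ) := by
  unfold px; fun_prop

/-- Analytic and algebraic data extracted from the addition theorem. -/
structure AddCore (n : ℕ) where
  h : (Fin n → ℂ) → ℂ
  g : Option (Fin n) → (Fin n → ℂ) → ℂ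
  hh : ∀ u, AnalyticAt ℂ h u
  hg : ∀ i u, AnalyticAt ℂ (g i) u
  h0 : ∃ u, h u ≠ 0
  c : MvPolynomial (Fin n) ℂ
  W : Option (Fin n) → Fin n → MvPolynomial (Option (Fin n)) ℂ
  M : Fin n → Fin n → MvPolynomial (Option (Fin n)) ℂ
  Pm : Polynomial (MvPolynomial (Fin n) ℂ)
  hPm : Pm.Monic
  d : MvPolynomial (Fin n ⊕ Fin n) ℂ
  C : ℝ
  N : ℕ
  H1 : ∀ u, h u ≠ 0 → ∀ i p, eval (px fun i => g i u / h u) c *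
    fderiv ℂ (fun x => g i x / h x) u (Pi.single p 1) = eval (fun i => g i u / h u) (W i p)
  H2 : ∀ u, h u ≠ 0 → ∀ k l, ∑ p, eval (fun i => g i u / h u) (W (some k) p) *
    eval (fun i => g i u / h u) (M p l) = if k = l then eval (px fun i => g i u / h u) c ^ 2 else 0
  H3 : ∀ u, h u ≠ 0 → Polynomial.eval (eval (px fun i => g i u / h u) c * (g none u / h u))
    (Pm.map (eval (px fun i => g i u / h u))) = 0
  H4 : ∀ u v, h u ≠ 0 → h v ≠ 0 → h (u + v) ≠ 0 → ∀ i,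
    ‖eval (Sum.elim (px fun i => g i u / h u) (px fun i => g i v / h v)) d *
      (g i (u + v) / h (u + v))‖
      ≤ C * (1 + ‖px fun i => g i u / h u‖ + ‖px fun i => g i v / h v‖) ^ N

namespace AddCore
variable {n : ℕ} (K : AddCore n)

/-- the map given by the functions -/
noncomputable def ps (u : Fin n → ℂ) : Option (Fin n) → ℂ := fun i => K.g i u / K.h u

/-- the good set -/
def H : Set (Fin n → ℂ) := {u | K.h u ≠ 0}

/-- the set where the map is locally bounded -/
def R : Set (Fin n → ℂ) := {w | ∃ B : ℝ, ∀ᶠ x in 𝓝 w, x ∈ K.H → ‖K.ps x‖ ≤ B}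

/-- the extended map -/
noncomputable def pt (u : Fin n → ℂ) : Option (Fin n) → ℂ := extendFrom K.H K.ps u

lemma denseH : Dense K.H := dense_ne K.h K.hh K.h0
lemma openH : IsOpen K.H := isOpen_hne K.h K.hh

lemma openR : IsOpen K.R := by
  rw [isOpen_iff_mem_nhds]
  rintro w ⟨B, hB⟩
  filter_upwards [eventually_eventually_nhds.2 hB] with x hx
  exact ⟨B, hx⟩

lemma ps_analytic {u} (hu : u ∈ K.H) (i) : AnalyticAt ℂ (fun x => K.g i x / K.h x) u :=
  (K.hg i u).div (K.hh u) hu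

lemma ps_diff {u} (hu : u ∈ K.H) : DifferentiableAt ℂ K.ps u :=
  differentiableAt_pi.2 fun i => (K.ps_analytic hu i).differentiableAt

lemma nhdsH_neBot (w) : (𝓝[K.H] w).NeBot := mem_closure_iff_nhdsWithin_neBot.1 (K.denseH w)

lemma exists_ext {w} (hw : w ∈ K.R) : ∃ F : (Fin n → ℂ) → Option (Fin n) → ℂ,
    (∀ᶠ x in 𝓝 w, DifferentiableAt ℂ F x) ∧ ∀ᶠ x in 𝓝 w, x ∈ K.H → F x = K.ps x := by
  obtain ⟨B, hB⟩ := hw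
  have h1 : ∀ i, ∃ F : (Fin n → ℂ) → ℂ, (∀ᶠ x in 𝓝 w, DifferentiableAt ℂ F x) ∧
      ∀ᶠ x in 𝓝 w, K.h x ≠ 0 → F x = K.g i x / K.h x := by
    intro i
    refine riemann_ext (K.g i) K.h (K.hg i) K.hh K.h0 w B ?_
    filter_upwards [hB] with x hx hhx
    exact (norm_le_pi_norm (K.ps x) i).trans (hx hhx)
  choose F hF1 hF2 using h1
  refine ⟨fun x i => F i x, ?_, ?_⟩
  · filter_upwards [eventually_all.2 hF1] with x hx
    exact differentiableAt_pi.2 hx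
  · filter_upwards [eventually_all.2 hF2] with x hx hxH
    funext i
    exact hx i hxH

lemma pt_eq_ext {F : (Fin n → ℂ) → Option (Fin n) → ℂ} {w} (hF : ContinuousAt F w)
    (hFe : ∀ᶠ x in 𝓝 w, x ∈ K.H → F x = K.ps x) : K.pt w = F w := by
  refine extendFrom_eq (K.denseH w) ?_
  refine (hF.tendsto.mono_left nhdsWithin_le_nhds).congr' ?_
  exact eventually_nhdsWithin_iff.2 hFe

lemma HsubR {u} (hu : u ∈ K.H) : u ∈ K.R := by
  refine ⟨‖K.ps u‖ + 1, ?_⟩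
  have := ((K.ps_diff hu).continuousAt.norm).eventually_lt_const (lt_add_one _)
  filter_upwards [this] with x hx _
  exact hx.le

lemma pt_eq {u} (hu : u ∈ K.H) : K.pt u = K.ps u :=
  K.pt_eq_ext (K.ps_diff hu).continuousAt (Eventually.of_forall fun _ _ => rfl)

lemma pt_diff {w} (hw : w ∈ K.R) : DifferentiableAt ℂ K.pt w := by
  obtain ⟨F, hF1, hF2⟩ := K.exists_ext hw
  have : K.pt =ᶠ[𝓝 w] F := by
    filter_upwards [hF1, eventually_eventually_nhds.2 hF2] with x h1 h2
    exact K.pt_eq_ext h1.continuousAt h2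
  exact this.differentiableAt_iff.2 hF1.self_of_nhds

lemma pt_cont {w} (hw : w ∈ K.R) : ContinuousAt K.pt w := (K.pt_diff hw).continuousAt

lemma pt_mem_closed {w} (hw : w ∈ K.R) (S : Set (Option (Fin n) → ℂ)) (hS : IsClosed S)
    (h : ∀ᶠ x in 𝓝 w, x ∈ K.H → K.ps x ∈ S) : K.pt w ∈ S := by
  have := K.nhdsH_neBot w
  refine hS.mem_of_tendsto ((K.pt_cont hw).tendsto.mono_left (nhdsWithin_le_nhds (s := K.H))) ?_
  refine eventually_nhdsWithin_iff.2 ?_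
  filter_upwards [h] with x hx hxH
  rw [K.pt_eq hxH]; exact hx hxH

lemma continuous_eval {σ : Type*} [Fintype σ] (p : MvPolynomial σ ℂ) : Continuous fun x : σ → ℂ => eval x p :=
  MvPolynomial.continuous_eval p

lemma cx : Continuous fun y : Option (Fin n) → ℂ => eval (px y) K.c :=
  (MvPolynomial.continuous_eval K.c).comp continuous_px

lemma g_eq {w} (hw : w ∈ K.R) (i) : K.g i w = K.pt w i * K.h w := by
  have := K.nhdsH_neBot w
  have h1 : Tendsto (fun x => K.g i x - K.pt x i * K.h x) (𝓝[K.H] w) (𝓝 (K.g i w - K.pt w i * K.h w)) := by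
    have hc : ContinuousAt (fun x => K.g i x - K.pt x i * K.h x) w :=
      (K.hg i w).continuousAt.sub ((continuousAt_pi.1 (K.pt_cont hw) i).mul (K.hh w).continuousAt)
    exact hc.tendsto.mono_left nhdsWithin_le_nhds
  have h2 : Tendsto (fun x => K.g i x - K.pt x i * K.h x) (𝓝[K.H] w) (𝓝 0) := by
    refine tendsto_const_nhds.congr' ?_
    filter_upwards [self_mem_nhdsWithin] with x hx
    rw [K.pt_eq hx]; unfold ps; rw [div_mul_cancel₀ _ hx, sub_self]
  exact sub_eq_zero.1 (tendsto_nhds_unique h1 h2)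

lemma E1 {w} (hw : w ∈ K.R) (i p) : eval (px (K.pt w)) K.c * fderiv ℂ K.pt w (Pi.single p 1) i =
    eval (K.pt w) (K.W i p) := by
  have := K.nhdsH_neBot w
  have hc : ContinuousAt (fun x => eval (px (K.pt x)) K.c * fderiv ℂ K.pt x (Pi.single p 1) i -
    eval (K.pt x) (K.W i p)) w := by
    refine ((K.cx.continuousAt.comp (K.pt_cont hw)).mul ?_).sub
      ((MvPolynomial.continuous_eval (K.W i p)).continuousAt.comp (K.pt_cont hw))
    refine continuousAt_pi.1 (cont_fderiv_apply K.pt w (Pi.single p 1) ?_) i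
    filter_upwards [K.openR.mem_nhds hw] with x hx using K.pt_diff hx
  have h1 := hc.tendsto.mono_left (nhdsWithin_le_nhds (s := K.H))
  have h2 : Tendsto (fun x => eval (px (K.pt x)) K.c * fderiv ℂ K.pt x (Pi.single p 1) i -
    eval (K.pt x) (K.W i p)) (𝓝[K.H] w) (𝓝 0) := by
    refine tendsto_const_nhds.congr' ?_
    filter_upwards [self_mem_nhdsWithin] with x hx
    have he : K.pt =ᶠ[𝓝 x] K.ps := by
      filter_upwards [K.openH.mem_nhds hx] with y hy using K.pt_eq hy
    rw [he.fderiv_eq, K.pt_eq hx]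
    have h3 := K.H1 x hx i p
    have h4 : fderiv ℂ K.ps x (Pi.single p 1) i = fderiv ℂ (fun x => K.g i x / K.h x) x (Pi.single p 1) := by
      have : HasFDerivAt (fun x => K.ps x i) ((ContinuousLinearMap.proj i).comp (fderiv ℂ K.ps x)) x :=
        (ContinuousLinearMap.proj (R := ℂ) (φ := fun _ : Option (Fin n) => ℂ) i).hasFDerivAt.comp x (K.ps_diff hx).hasFDerivAt
      rw [show (fun x => K.g i x / K.h x) = (fun x => K.ps x i) from rfl, this.fderiv]
      rfl
    rw [h4]
    exact (sub_eq_zero.2 h3).symm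
  exact sub_eq_zero.1 (tendsto_nhds_unique h1 h2)

lemma E2 {w} (hw : w ∈ K.R) (k l) : ∑ p, eval (K.pt w) (K.W (some k) p) *
    eval (K.pt w) (K.M p l) = if k = l then eval (px (K.pt w)) K.c ^ 2 else 0 := by
  refine K.pt_mem_closed hw {y | ∑ p, eval y (K.W (some k) p) *
    eval y (K.M p l) = if k = l then eval (px y) K.c ^ 2 else 0} (isClosed_eq ?_ ?_)
    (Eventually.of_forall fun x hx => K.H2 x hx k l)
  · exact continuous_finsetSum _ fun p _ => (MvPolynomial.continuous_eval _).mul (MvPolynomial.continuous_eval _)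
  · split_ifs
    · exact K.cx.pow 2
    · exact continuous_const

lemma E3 {w} (hw : w ∈ K.R) : Polynomial.eval (eval (px (K.pt w)) K.c * K.pt w none)
    (K.Pm.map (eval (px (K.pt w)))) = 0 := by
  refine K.pt_mem_closed hw {y | Polynomial.eval (eval (px y) K.c * y none)
    (K.Pm.map (eval (px y))) = 0} (isClosed_eq ?_ continuous_const)
    (Eventually.of_forall fun x hx => K.H3 x hx)
  simp only [Polynomial.eval_map, Polynomial.eval₂_eq_sum_range]
  refine continuous_finsetSum _ fun j _ => ((MvPolynomial.continuous_eval _).comp continuous_px).mul ((K.cx.mul (continuous_apply none)).pow j)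

lemma dense_pair : Dense {q : (Fin n → ℂ) × (Fin n → ℂ) | q.1 ∈ K.H ∧ q.2 ∈ K.H ∧ q.1 + q.2 ∈ K.H} := by
  have han : ∀ q : (Fin n → ℂ) × (Fin n → ℂ), AnalyticAt ℂ
      (fun q : (Fin n → ℂ) × (Fin n → ℂ) => K.h q.1 * (K.h q.2 * K.h (q.1 + q.2))) q := by
    intro q
    have h1 := (K.hh q.1).comp_of_eq (f := fun q : (Fin n → ℂ) × (Fin n → ℂ) => q.1) (x := q) analyticAt_fst rfl
    have h2 := (K.hh q.2).comp_of_eq (f := fun q : (Fin n → ℂ) × (Fin n → ℂ) => q.2) (x := q) analyticAt_snd rfl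
    have h3 := (K.hh (q.1 + q.2)).comp_of_eq (f := fun q : (Fin n → ℂ) × (Fin n → ℂ) => q.1 + q.2) (x := q)
      (analyticAt_fst.add analyticAt_snd) rfl
    exact h1.mul (h2.mul h3)
  have := dense_ne _ han (by
    obtain ⟨u, hu⟩ := K.h0
    obtain ⟨v, hv1, hv2⟩ := (K.denseH.inter_of_isOpen_left
      (K.denseH.preimage (Homeomorph.addLeft u).isOpenMap) K.openH).nonempty
    exact ⟨(u, v), mul_ne_zero hu (mul_ne_zero hv1 hv2)⟩)
  refine this.mono fun q hq => ?_
  have hq' : K.h q.1 * (K.h q.2 * K.h (q.1 + q.2)) ≠ 0 := hq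
  exact ⟨left_ne_zero_of_mul hq', left_ne_zero_of_mul (right_ne_zero_of_mul hq'),
    right_ne_zero_of_mul (right_ne_zero_of_mul hq')⟩

lemma E4 {u v} (hu : u ∈ K.R) (hv : v ∈ K.R) (huv : u + v ∈ K.R) (i) :
    ‖eval (Sum.elim (px (K.pt u)) (px (K.pt v))) K.d * K.pt (u + v) i‖
      ≤ K.C * (1 + ‖px (K.pt u)‖ + ‖px (K.pt v)‖) ^ K.N := by
  set D := {q : (Fin n → ℂ) × (Fin n → ℂ) | q.1 ∈ K.H ∧ q.2 ∈ K.H ∧ q.1 + q.2 ∈ K.H}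
  have : (𝓝[D] (u, v)).NeBot := mem_closure_iff_nhdsWithin_neBot.1 (K.dense_pair (u, v))
  have c1 : ContinuousAt (fun q : (Fin n → ℂ) × (Fin n → ℂ) => px (K.pt q.1)) (u, v) :=
    continuous_px.continuousAt.comp (ContinuousAt.comp (f := Prod.fst) (g := K.pt) (K.pt_cont hu) continuousAt_fst)
  have c2 : ContinuousAt (fun q : (Fin n → ℂ) × (Fin n → ℂ) => px (K.pt q.2)) (u, v) :=
    continuous_px.continuousAt.comp (ContinuousAt.comp (f := Prod.snd) (g := K.pt) (K.pt_cont hv) continuousAt_snd)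
  have c3 : ContinuousAt (fun q : (Fin n → ℂ) × (Fin n → ℂ) => K.pt (q.1 + q.2)) (u, v) :=
    ContinuousAt.comp (f := fun q : (Fin n → ℂ) × (Fin n → ℂ) => q.1 + q.2) (g := K.pt) (K.pt_cont huv) (by fun_prop)
  have c4 : ContinuousAt (fun q : (Fin n → ℂ) × (Fin n → ℂ) => (Sum.elim (px (K.pt q.1)) (px (K.pt q.2)) : Fin n ⊕ Fin n → ℂ)) (u, v) := by
    refine continuousAt_pi.2 fun j => ?_
    cases j with
    | inl j => exact continuousAt_pi.1 c1 j
    | inr j => exact continuousAt_pi.1 c2 j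
  have c5 : ContinuousAt (fun q : (Fin n → ℂ) × (Fin n → ℂ) => ‖eval (Sum.elim (px (K.pt q.1)) (px (K.pt q.2))) K.d * K.pt (q.1 + q.2) i‖) (u, v) :=
    (((MvPolynomial.continuous_eval K.d).continuousAt.comp c4).mul (continuousAt_pi.1 c3 i)).norm
  have c6 : ContinuousAt (fun q : (Fin n → ℂ) × (Fin n → ℂ) => K.C * (1 + ‖px (K.pt q.1)‖ + ‖px (K.pt q.2)‖) ^ K.N) (u, v) :=
    continuousAt_const.mul (((continuousAt_const.add c1.norm).add c2.norm).pow _)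
  refine le_of_tendsto_of_tendsto (c5.tendsto.mono_left (nhdsWithin_le_nhds (s := D)))
    (c6.tendsto.mono_left (nhdsWithin_le_nhds (s := D))) ?_
  filter_upwards [self_mem_nhdsWithin] with q hq
  simp only [K.pt_eq hq.1, K.pt_eq hq.2.1, K.pt_eq hq.2.2]
  exact K.H4 q.1 q.2 hq.1 hq.2.1 hq.2.2 i

end AddCore

lemma analyticAt_eval {σ : Type*} [Fintype σ] (p : MvPolynomial σ ℂ) (x : σ → ℂ) :
    AnalyticAt ℂ (fun x : σ → ℂ => eval x p) x :=
  AnalyticOnNhd.eval_mvPolynomial p x (Set.mem_univ x)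

namespace AddCore
variable {n : ℕ} (K : AddCore n)

/-- derivative of the map as a function of the value -/
noncomputable def A (y : Option (Fin n) → ℂ) : (Fin n → ℂ) →L[ℂ] (Option (Fin n) → ℂ) :=
  ∑ i, ∑ p, (eval y (K.W i p) / eval (px y) K.c) •
    (ContinuousLinearMap.proj (R := ℂ) (φ := fun _ : Fin n => ℂ) p).smulRight
      (Pi.single i 1 : Option (Fin n) → ℂ)

lemma A_apply (y w i) : K.A y w i = ∑ p, (eval y (K.W i p) / eval (px y) K.c) * w p := by
  simp only [A, _root_.sum_apply, Finset.sum_apply, _root_.smul_apply,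
    ContinuousLinearMap.smulRight_apply, ContinuousLinearMap.proj_apply, Pi.smul_apply, smul_eq_mul,
    Pi.single_apply]
  rw [Finset.sum_eq_single i]
  · simp
  · intro j _ hj; simp [hj.symm]
  · simp

/-- the open set of good values -/
def Gd : Set (Option (Fin n) → ℂ) := {y | eval (px y) K.c ≠ 0}

lemma openGd : IsOpen K.Gd := isOpen_ne_fun K.cx continuous_const

lemma analyticAt_c (y) : AnalyticAt ℂ (fun y : Option (Fin n) → ℂ => eval (px y) K.c) y := by
  have := (analyticAt_eval K.c (px y)).comp_of_eq (f := px) (x := y) (by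
    rw [analyticAt_pi_iff]; intro k
    exact (ContinuousLinearMap.proj (R := ℂ) (φ := fun _ : Option (Fin n) => ℂ) (some k)).analyticAt y) rfl
  exact this

lemma analyticAt_A {y} (hy : y ∈ K.Gd) : AnalyticAt ℂ K.A y := by
  unfold A
  refine Finset.analyticAt_fun_sum _ fun i _ => Finset.analyticAt_fun_sum _ fun p _ => ?_
  exact ((analyticAt_eval _ _).div (K.analyticAt_c y) hy).smul analyticAt_const

lemma fderiv_pt {w} (hw : w ∈ K.R) (hc : K.pt w ∈ K.Gd) : HasFDerivAt K.pt (K.A (K.pt w)) w := by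
  convert (K.pt_diff hw).hasFDerivAt using 1
  ext v i
  rw [K.A_apply]
  have hv : v = ∑ p, v p • (Pi.single p 1 : Fin n → ℂ) := by
    ext q; simp [Pi.single_apply]
  conv_rhs => rw [hv]
  rw [map_sum, Finset.sum_apply]
  refine Finset.sum_congr rfl fun p _ => ?_
  rw [map_smul, Pi.smul_apply, ← K.E1 hw i p, mul_div_cancel_left₀ _ hc, smul_eq_mul, mul_comm]

lemma hasDerivAt_ray {u w} {t : ℝ} (hw : u + t • w ∈ K.R) (hc : K.pt (u + t • w) ∈ K.Gd) :
    HasDerivAt (fun t : ℝ => K.pt (u + t • w)) (K.A (K.pt (u + t • w)) w) t := by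
  have h1 := (K.fderiv_pt hw hc).restrictScalars ℝ
  have h2 : HasDerivAt (fun t : ℝ => u + t • w) w t := by
    simpa using ((hasDerivAt_id t).smul_const w).const_add u
  exact h1.comp_hasDerivAt t h2

lemma period_local {u u'} (hu : u ∈ K.R) (hu' : u' ∈ K.R) (he : K.pt u = K.pt u')
    (hc : K.pt u ∈ K.Gd) : ∀ᶠ w in 𝓝 0, (u + w ∈ K.R ∧ u' + w ∈ K.R) ∧ K.pt (u + w) = K.pt (u' + w) := by
  obtain ⟨L, S, hS, hL⟩ := ((K.analyticAt_A hc).contDiffAt (n := 1)).exists_lipschitzOnWith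
  have key : ∀ v, v ∈ K.R → K.pt v = K.pt u → ∀ᶠ w in 𝓝 (0 : Fin n → ℂ), v + w ∈ K.R ∧ K.pt (v + w) ∈ S ∧ K.pt (v + w) ∈ K.Gd := by
    intro v hv hvu
    have ht : Tendsto (fun w : Fin n → ℂ => v + w) (𝓝 0) (𝓝 v) := by
      have : Continuous (fun w : Fin n → ℂ => v + w) := by fun_prop
      simpa using this.tendsto 0
    have h2 : ∀ᶠ x in 𝓝 v, x ∈ K.R ∧ K.pt x ∈ S ∧ K.pt x ∈ K.Gd := by
      have hcv := (K.pt_cont hv)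
      rw [ContinuousAt, hvu] at hcv
      exact Eventually.and (K.openR.mem_nhds hv) ((hcv.eventually hS).and (hcv.eventually (K.openGd.mem_nhds hc)))
    exact ht.eventually h2
  obtain ⟨δ, hδ, hd⟩ := Metric.eventually_nhds_iff.1 ((key u hu rfl).and (key u' hu' he.symm))
  refine Metric.eventually_nhds_iff.2 ⟨δ, hδ, fun w hw => ⟨⟨(hd hw).1.1, (hd hw).2.1⟩, ?_⟩⟩
  have hd' : ∀ t ∈ Set.Icc (0 : ℝ) 1, dist (t • w) 0 < δ := by
    intro t ht
    rw [dist_zero_right, norm_smul, Real.norm_eq_abs, abs_of_nonneg ht.1]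
    rw [dist_zero_right] at hw
    nlinarith [ht.2, norm_nonneg w]
  have hder : ∀ t ∈ Set.Icc (0 : ℝ) 1, HasDerivAt (fun t : ℝ => K.pt (u + t • w) - K.pt (u' + t • w))
      (K.A (K.pt (u + t • w)) w - K.A (K.pt (u' + t • w)) w) t := fun t ht =>
    (K.hasDerivAt_ray (hd (hd' t ht)).1.1 (hd (hd' t ht)).1.2.2).sub
    (K.hasDerivAt_ray (hd (hd' t ht)).2.1 (hd (hd' t ht)).2.2.2)
  have := eq_zero_of_abs_deriv_le_mul_abs_self_of_eq_zero_right (K := L * ‖w‖)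
    (fun t ht => (hder t ht).continuousAt.continuousWithinAt)
    (fun t ht => (hder t ⟨ht.1, ht.2.le⟩).hasDerivWithinAt) (by simp [he]) (by
      intro t ht
      have ht' : t ∈ Set.Icc (0 : ℝ) 1 := ⟨ht.1, ht.2.le⟩
      rw [← _root_.sub_apply]
      refine (ContinuousLinearMap.le_opNorm _ _).trans ?_
      have := hL.norm_sub_le (hd (hd' t ht')).1.2.1 (hd (hd' t ht')).2.2.1
      nlinarith [norm_nonneg w]) 1 (by simp)
  simpa [sub_eq_zero] using this

/-- Transfer between points where the maps agree generically. -/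
lemma transfer {a b} (hab : ∀ x, a + x ∈ K.H → b + x ∈ K.H → K.ps (a + x) = K.ps (b + x))
    (ha : a ∈ K.R) : b ∈ K.R ∧ K.pt b = K.pt a := by
  have hda : Dense {x | a + x ∈ K.H} := K.denseH.preimage (Homeomorph.addLeft a).isOpenMap
  have hdb : Dense {x | b + x ∈ K.H} := K.denseH.preimage (Homeomorph.addLeft b).isOpenMap
  have hoa : IsOpen {x | a + x ∈ K.H} := K.openH.preimage (Homeomorph.addLeft a).continuous
  have htend : ∀ v : Fin n → ℂ, Tendsto (fun w : Fin n → ℂ => v + w) (𝓝 0) (𝓝 v) := fun v => by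
    have : Continuous (fun w : Fin n → ℂ => v + w) := by fun_prop
    simpa using this.tendsto 0
  have hb : b ∈ K.R := by
    obtain ⟨B, hB⟩ := ha
    refine ⟨B, ?_⟩
    have h1 := eventually_eventually_nhds.2 ((htend a).eventually hB)
    have h2 : Tendsto (fun y => y - b) (𝓝 b) (𝓝 0) := by
      have : Continuous (fun y : Fin n → ℂ => y - b) := by fun_prop
      simpa using this.tendsto b
    filter_upwards [h2.eventually h1] with y hy hyH
    have hne : (𝓝[{x | a + x ∈ K.H}] (y - b)).NeBot := mem_closure_iff_nhdsWithin_neBot.1 (hda _)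
    have hyb : b + (y - b) = y := by abel
    have hcont : ContinuousAt (fun x => ‖K.ps (b + x)‖) (y - b) := by
      have hc := (K.ps_diff hyH).continuousAt
      rw [← hyb] at hc
      exact (ContinuousAt.comp (f := fun x => b + x) (g := K.ps) hc (by fun_prop)).norm
    have hfin : ‖K.ps (b + (y - b))‖ ≤ B := by
      refine le_of_tendsto (hcont.tendsto.mono_left (nhdsWithin_le_nhds (s := {x | a + x ∈ K.H}))) ?_
      have hbo : ∀ᶠ x in 𝓝 (y - b), b + x ∈ K.H := by
        have hc : ContinuousAt (fun x => b + x) (y - b) := by fun_prop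
        refine hc.eventually (K.openH.mem_nhds ?_)
        show b + (y - b) ∈ K.H
        rw [hyb]; exact hyH
      filter_upwards [self_mem_nhdsWithin, nhdsWithin_le_nhds hy, nhdsWithin_le_nhds hbo] with x h1 h2 h3
      rw [← hab x h1 h3]; exact h2 h1
    rwa [hyb] at hfin
  refine ⟨hb, ?_⟩
  have hd2 := hda.inter_of_isOpen_left hdb hoa
  have hne : (𝓝[{x | a + x ∈ K.H} ∩ {x | b + x ∈ K.H}] (0 : Fin n → ℂ)).NeBot :=
    mem_closure_iff_nhdsWithin_neBot.1 (hd2 _)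
  have t1 := ((K.pt_cont ha).tendsto.comp (htend a)).mono_left (nhdsWithin_le_nhds (s := {x | a + x ∈ K.H} ∩ {x | b + x ∈ K.H}))
  have t2 := ((K.pt_cont hb).tendsto.comp (htend b)).mono_left (nhdsWithin_le_nhds (s := {x | a + x ∈ K.H} ∩ {x | b + x ∈ K.H}))
  refine tendsto_nhds_unique (t2.congr' ?_) t1
  filter_upwards [self_mem_nhdsWithin] with x hx
  simp only [Function.comp]
  rw [K.pt_eq hx.1, K.pt_eq hx.2, hab x hx.1 hx.2]

lemma period {u u'} (hu : u ∈ K.R) (hu' : u' ∈ K.R) (he : K.pt u = K.pt u')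
    (hc : K.pt u ∈ K.Gd) (w) (hw : u + w ∈ K.R) : u' + w ∈ K.R ∧ K.pt (u' + w) = K.pt (u + w) := by
  have hid : ∀ i, (fun w => K.g i (u + w) * K.h (u' + w)) = fun w => K.g i (u' + w) * K.h (u + w) := by
    intro i
    have hcomp : ∀ (f : (Fin n → ℂ) → ℂ), (∀ u, AnalyticAt ℂ f u) → ∀ v w, AnalyticAt ℂ (fun w => f (v + w)) w := by
      intro f hf v w
      exact (hf _).comp_of_eq (f := fun w => v + w) (analyticAt_const.add analyticAt_id) rfl
    refine AnalyticOnNhd.eq_of_eventuallyEq (z₀ := 0) (𝕜 := ℂ)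
      (fun x _ => (hcomp _ (K.hg i) u x).mul (hcomp _ K.hh u' x))
      (fun x _ => (hcomp _ (K.hg i) u' x).mul (hcomp _ K.hh u x)) ?_
    filter_upwards [K.period_local hu hu' he hc] with x hx
    rw [K.g_eq hx.1.1, K.g_eq hx.1.2, hx.2]; ring
  refine K.transfer (a := u + w) (b := u' + w) ?_ hw
  intro x h1 h2
  funext i
  have := congrFun (hid i) (w + x)
  simp only [← add_assoc] at this
  unfold ps
  rw [div_eq_div_iff h1 h2, this]

/-- Closure of the regular set under generic addition. -/
lemma add_mem {u v} (hu : u ∈ K.R) (hv : v ∈ K.R)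
    (hd : eval (Sum.elim (px (K.pt u)) (px (K.pt v))) K.d ≠ 0) : u + v ∈ K.R := by
  have c1 : ContinuousAt (fun q : (Fin n → ℂ) × (Fin n → ℂ) => px (K.pt q.1)) (u, v) :=
    continuous_px.continuousAt.comp (ContinuousAt.comp (f := Prod.fst) (g := K.pt) (K.pt_cont hu) continuousAt_fst)
  have c2 : ContinuousAt (fun q : (Fin n → ℂ) × (Fin n → ℂ) => px (K.pt q.2)) (u, v) :=
    continuous_px.continuousAt.comp (ContinuousAt.comp (f := Prod.snd) (g := K.pt) (K.pt_cont hv) continuousAt_snd)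
  have c4 : ContinuousAt (fun q : (Fin n → ℂ) × (Fin n → ℂ) => (Sum.elim (px (K.pt q.1)) (px (K.pt q.2)) : Fin n ⊕ Fin n → ℂ)) (u, v) := by
    refine continuousAt_pi.2 fun j => ?_
    cases j with
    | inl j => exact continuousAt_pi.1 c1 j
    | inr j => exact continuousAt_pi.1 c2 j
  have c5 : ContinuousAt (fun q : (Fin n → ℂ) × (Fin n → ℂ) => ‖eval (Sum.elim (px (K.pt q.1)) (px (K.pt q.2))) K.d‖) (u, v) :=
    ((MvPolynomial.continuous_eval K.d).continuousAt.comp c4).norm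
  have c6 : ContinuousAt (fun q : (Fin n → ℂ) × (Fin n → ℂ) => K.C * (1 + ‖px (K.pt q.1)‖ + ‖px (K.pt q.2)‖) ^ K.N) (u, v) :=
    continuousAt_const.mul (((continuousAt_const.add c1.norm).add c2.norm).pow _)
  set d0 := ‖eval (Sum.elim (px (K.pt u)) (px (K.pt v))) K.d‖ with hd0
  have hd0p : 0 < d0 := norm_pos_iff.2 hd
  set B := K.C * (1 + ‖px (K.pt u)‖ + ‖px (K.pt v)‖) ^ K.N + 1 with hB
  have e1 := c5.eventually_const_lt (half_lt_self hd0p)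
  have e2 := c6.eventually_lt_const (lt_add_one _)
  obtain ⟨δ, hδ, hb⟩ := Metric.eventually_nhds_iff.1 (e1.and e2)
  refine ⟨B / (d0 / 2), ?_⟩
  filter_upwards [Metric.ball_mem_nhds (u + v) (half_pos hδ)] with x hx hxH
  have hx : dist x (u + v) < δ / 2 := hx
  -- choose a decomposition
  have hden : Dense {y | x - y ∈ K.H} := K.denseH.preimage (Homeomorph.subLeft x).isOpenMap
  obtain ⟨a, ⟨ha1, ha2⟩, ha3⟩ := (K.denseH.inter_of_isOpen_left hden K.openH).exists_dist_lt u (half_pos hδ)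
  have hsum : a + (x - a) = x := by abel
  have hdist : dist (a, x - a) (u, v) < δ := by
    rw [Prod.dist_eq, max_lt_iff]
    refine ⟨?_, ?_⟩
    · simp only; rw [dist_comm]; linarith
    · simp only
      rw [dist_eq_norm] at hx ha3 ⊢
      have : x - a - v = (x - (u + v)) + (u - a) := by abel
      rw [this]
      exact (norm_add_le _ _).trans_lt (by linarith)
  obtain ⟨h1, h2⟩ := hb hdist
  simp only [K.pt_eq ha1, K.pt_eq (show x - a ∈ K.H from ha2)] at h1 h2
  have hBp : 0 ≤ B := by
    have h3 := (norm_nonneg _).trans (K.H4 a (x - a) ha1 ha2 (by rw [hsum]; exact hxH) none)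
    exact h3.trans h2.le
  refine (pi_norm_le_iff_of_nonneg (by positivity)).2 fun i => ?_
  have h3 := K.H4 a (x - a) ha1 ha2 (by rw [hsum]; exact hxH) i
  rw [norm_mul, hsum] at h3
  rw [le_div_iff₀ (half_pos hd0p)]
  have h4 : ‖K.ps x i‖ * (d0 / 2) ≤ ‖K.ps x i‖ * ‖eval (Sum.elim (px (K.ps a)) (px (K.ps (x - a)))) K.d‖ :=
    mul_le_mul_of_nonneg_left h1.le (norm_nonneg _)
  rw [mul_comm] at h3
  exact h4.trans (h3.trans h2.le)

end AddCore

lemma poly_bound {σ : Type*} [Fintype σ] (p : MvPolynomial σ ℂ) :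
    ∃ C : ℝ, 0 ≤ C ∧ ∃ N : ℕ, ∀ x : σ → ℂ, ‖eval x p‖ ≤ C * (1 + ‖x‖) ^ N := by
  induction p using MvPolynomial.induction_on with
  | C a => exact ⟨‖a‖, norm_nonneg _, 0, fun x => by simp⟩
  | add p q hp hq =>
    obtain ⟨C1, hC1, N1, h1⟩ := hp
    obtain ⟨C2, hC2, N2, h2⟩ := hq
    refine ⟨C1 + C2, by positivity, N1 + N2, fun x => ?_⟩
    have hx : 1 ≤ 1 + ‖x‖ := by linarith [norm_nonneg x]
    have e1 : (1 + ‖x‖) ^ N1 ≤ (1 + ‖x‖) ^ (N1 + N2) := pow_le_pow_right₀ hx (by omega)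
    have e2 : (1 + ‖x‖) ^ N2 ≤ (1 + ‖x‖) ^ (N1 + N2) := pow_le_pow_right₀ hx (by omega)
    rw [map_add, add_mul]
    refine (norm_add_le _ _).trans (add_le_add ((h1 x).trans ?_) ((h2 x).trans ?_)) <;> gcongr
  | mul_X p i hp =>
    obtain ⟨C1, hC1, N1, h1⟩ := hp
    refine ⟨C1, hC1, N1 + 1, fun x => ?_⟩
    rw [map_mul, eval_X, norm_mul, pow_succ, ← mul_assoc]
    have := norm_le_pi_norm x i
    refine mul_le_mul (h1 x) (by linarith) (norm_nonneg _) (by positivity)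

lemma monic_bound {σ : Type*} [Fintype σ] (P : Polynomial (MvPolynomial σ ℂ)) (hP : P.Monic) :
    ∃ C : ℝ, 0 ≤ C ∧ ∃ N : ℕ, ∀ (x : σ → ℂ) (z : ℂ), Polynomial.eval z (P.map (eval x)) = 0 →
      ‖z‖ ≤ C * (1 + ‖x‖) ^ N := by
  have h1 : ∀ j, ∃ C : ℝ, 0 ≤ C ∧ ∃ N : ℕ, ∀ x : σ → ℂ, ‖eval x (P.coeff j)‖ ≤ C * (1 + ‖x‖) ^ N :=
    fun j => poly_bound _
  choose C hC N hN using h1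
  set s := Finset.range P.natDegree
  refine ⟨∑ j ∈ s, C j + 1, by have := Finset.sum_nonneg (s := s) fun j _ => hC j; linarith, ∑ j ∈ s, N j, fun x z hz => ?_⟩
  have hm : (P.map (eval x)).Monic := hP.map _
  have hroot : (P.map (eval x)).IsRoot z := hz
  have h2 := Polynomial.IsRoot.norm_lt_cauchyBound hm.ne_zero hroot
  have hx : 1 ≤ 1 + ‖x‖ := by linarith [norm_nonneg x]
  have hB : 0 ≤ ∑ j ∈ s, C j * (1 + ‖x‖) ^ (∑ j ∈ s, N j) :=
    Finset.sum_nonneg fun j _ => mul_nonneg (hC j) (by positivity)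
  have h3 : ((Polynomial.cauchyBound (P.map (eval x)) : NNReal) : ℝ) ≤ ∑ j ∈ s, C j * (1 + ‖x‖) ^ (∑ j ∈ s, N j) + 1 := by
    unfold Polynomial.cauchyBound
    rw [hm.leadingCoeff]
    obtain ⟨kk, hkk⟩ : ∃ kk : NNReal, (kk : ℝ) = ∑ j ∈ s, C j * (1 + ‖x‖) ^ (∑ j ∈ s, N j) :=
      ⟨Real.toNNReal _, Real.coe_toNNReal _ hB⟩
    have : (Finset.range (P.map (eval x)).natDegree).sup (fun j => ‖(P.map (eval x)).coeff j‖₊) ≤ kk := by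
      refine Finset.sup_le fun j hj => ?_
      rw [hP.natDegree_map] at hj
      rw [← NNReal.coe_le_coe, coe_nnnorm, Polynomial.coeff_map, hkk]
      refine (hN j x).trans ?_
      have h4 : C j * (1 + ‖x‖) ^ N j ≤ C j * (1 + ‖x‖) ^ (∑ j ∈ s, N j) := by
        have := hC j
        have := Finset.single_le_sum (f := N) (s := s) (fun _ _ => Nat.zero_le _) hj
        gcongr
      refine h4.trans ?_
      exact Finset.single_le_sum (f := fun j => C j * (1 + ‖x‖) ^ (∑ j ∈ s, N j)) (s := s)
        (fun j _ => mul_nonneg (hC j) (by positivity)) hj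
    have h5 := NNReal.coe_le_coe.2 this
    rw [hkk] at h5
    simp only [nnnorm_one, div_one, NNReal.coe_add, NNReal.coe_one]
    simpa using h5
  rw [← Finset.sum_mul] at h3
  have h6 : 1 ≤ (1 + ‖x‖) ^ (∑ j ∈ s, N j) := one_le_pow₀ hx
  rw [add_mul, one_mul]
  linarith

namespace AddCore
variable {n : ℕ} (K : AddCore n)

/-- projection as a continuous linear map -/
noncomputable def pL : (Option (Fin n) → ℂ) →L[ℂ] (Fin n → ℂ) :=
  ContinuousLinearMap.pi fun k => ContinuousLinearMap.proj (R := ℂ) (φ := fun _ : Option (Fin n) => ℂ) (some k)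

lemma pL_apply (y : Option (Fin n) → ℂ) : pL y = px y := rfl

lemma norm_pL_comp_le (T : (Fin n → ℂ) →L[ℂ] (Option (Fin n) → ℂ)) : ‖pL.comp T‖ ≤ ‖T‖ := by
  refine ContinuousLinearMap.opNorm_le_bound _ (norm_nonneg _) fun x => ?_
  exact (norm_px_le _).trans (T.le_opNorm x)

/-- the right inverse -/
noncomputable def Ai (y : Option (Fin n) → ℂ) : (Fin n → ℂ) →L[ℂ] (Fin n → ℂ) :=
  ∑ p, ∑ l, (eval y (K.M p l) / eval (px y) K.c) •
    (ContinuousLinearMap.proj (R := ℂ) (φ := fun _ : Fin n => ℂ) l).smulRight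
      (Pi.single p 1 : Fin n → ℂ)

lemma Ai_apply (y w p) : K.Ai y w p = ∑ l, (eval y (K.M p l) / eval (px y) K.c) * w l := by
  simp only [Ai, _root_.sum_apply, Finset.sum_apply, _root_.smul_apply,
    ContinuousLinearMap.smulRight_apply, ContinuousLinearMap.proj_apply, Pi.smul_apply, smul_eq_mul,
    Pi.single_apply]
  rw [Finset.sum_eq_single p]
  · simp
  · intro j _ hj; simp [hj.symm]
  · simp

lemma analyticAt_Ai {y} (hy : y ∈ K.Gd) : AnalyticAt ℂ K.Ai y := by
  unfold Ai
  refine Finset.analyticAt_fun_sum _ fun i _ => Finset.analyticAt_fun_sum _ fun p _ => ?_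
  exact ((analyticAt_eval _ _).div (K.analyticAt_c y) hy).smul analyticAt_const

lemma right_inv {w} (hw : w ∈ K.R) (hc : K.pt w ∈ K.Gd) (v) :
    pL.comp (K.A (K.pt w)) (K.Ai (K.pt w) v) = v := by
  have hc' : eval (px (K.pt w)) K.c ≠ 0 := hc
  ext k
  simp only [ContinuousLinearMap.comp_apply, pL_apply]
  unfold px
  rw [K.A_apply]
  simp only [K.Ai_apply, Finset.mul_sum]
  rw [Finset.sum_comm]
  have : ∀ l, ∑ p, eval (K.pt w) (K.W (some k) p) / eval (px (K.pt w)) K.c *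
      (eval (K.pt w) (K.M p l) / eval (px (K.pt w)) K.c * v l) = if k = l then v l else 0 := by
    intro l
    have h2 := K.E2 hw k l
    have : ∀ p, eval (K.pt w) (K.W (some k) p) / eval (px (K.pt w)) K.c *
      (eval (K.pt w) (K.M p l) / eval (px (K.pt w)) K.c * v l) =
      eval (K.pt w) (K.W (some k) p) * eval (K.pt w) (K.M p l) * (v l / eval (px (K.pt w)) K.c ^ 2) := by
      intro p; field_simp
    simp only [this]
    rw [← Finset.sum_mul, h2]
    split_ifs
    · field_simp
    · simp
  exact (Finset.sum_congr rfl fun l _ => this l).trans (by simp)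

lemma hasFDerivAt_px {w} (hw : w ∈ K.R) (hc : K.pt w ∈ K.Gd) :
    HasFDerivAt (fun u => px (K.pt u)) (pL.comp (K.A (K.pt w))) w :=
  (pL (n := n)).hasFDerivAt.comp w (K.fderiv_pt hw hc)

lemma box1 (x0 : Fin n → ℂ) (hx0 : eval x0 K.c ≠ 0) : ∃ ε > 0, ∃ r > 0,
    ∃ S : Set (Option (Fin n) → ℂ), IsCompact S ∧ S ⊆ K.Gd ∧
      ∀ u1 ∈ K.R, ‖px (K.pt u1) - x0‖ < ε → ∀ u ∈ Metric.ball u1 r, u ∈ K.R ∧ K.pt u ∈ S := by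
  obtain ⟨C3, hC3, N3, hb3⟩ := monic_bound K.Pm K.hPm
  have hcc : Continuous fun x : Fin n → ℂ => eval x K.c := MvPolynomial.continuous_eval K.c
  set c0 := ‖eval x0 K.c‖ / 2 with hc0
  have hc0p : 0 < c0 := half_pos (norm_pos_iff.2 hx0)
  obtain ⟨ε', hε', hcε⟩ := Metric.eventually_nhds_iff.1
    ((hcc.norm.continuousAt (x := x0)).eventually_const_lt (half_lt_self (norm_pos_iff.2 hx0)))
  set ε := ε' / 3 with hε
  have hεp : 0 < ε := by positivity
  have hc : ∀ x, ‖x - x0‖ ≤ 2 * ε → c0 < ‖eval x K.c‖ := fun x hx => hcε (by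
    rw [dist_eq_norm]; linarith)
  set Λ := max (‖x0‖ + 2 * ε) (C3 * (1 + (‖x0‖ + 2 * ε)) ^ N3 / c0) with hΛ
  set S : Set (Option (Fin n) → ℂ) := {y | ‖px y - x0‖ ≤ 2 * ε ∧ ‖y‖ ≤ Λ} with hS
  have hSc : IsCompact S := by
    have h1 : IsClosed {y : Option (Fin n) → ℂ | ‖px y - x0‖ ≤ 2 * ε} :=
      isClosed_le (continuous_px.sub continuous_const).norm continuous_const
    have : S = Metric.closedBall 0 Λ ∩ {y | ‖px y - x0‖ ≤ 2 * ε} := by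
      ext y; simp [hS, and_comm]
    rw [this]
    exact (isCompact_closedBall _ _).inter_right h1
  have hSG : S ⊆ K.Gd := fun y hy => norm_pos_iff.1 (hc0p.trans (hc _ hy.1))
  have hin : ∀ w ∈ K.R, ‖px (K.pt w) - x0‖ ≤ 2 * ε → K.pt w ∈ S := by
    intro w hw hx
    have hnx : ‖px (K.pt w)‖ ≤ ‖x0‖ + 2 * ε := by
      have := norm_add_le (px (K.pt w) - x0) x0
      simp only [sub_add_cancel] at this; linarith
    refine ⟨hx, (pi_norm_le_iff_of_nonneg ((norm_nonneg _).trans (hnx.trans (le_max_left _ _)))).2 fun i => ?_⟩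
    cases i with
    | some k => exact (norm_le_pi_norm (px (K.pt w)) k).trans (hnx.trans (le_max_left _ _))
    | none =>
      refine le_trans ?_ (le_max_right _ _)
      have h1 := hb3 _ _ (K.E3 hw)
      rw [norm_mul] at h1
      rw [le_div_iff₀ hc0p]
      have h2 := hc _ hx
      have h3 : C3 * (1 + ‖px (K.pt w)‖) ^ N3 ≤ C3 * (1 + (‖x0‖ + 2 * ε)) ^ N3 := by gcongr
      nlinarith [norm_nonneg (K.pt w none)]
  obtain ⟨Λ1, hΛ1p, hΛ1⟩ : ∃ Λ1 : ℝ, 0 < Λ1 ∧ ∀ y ∈ S, ‖K.A y‖ ≤ Λ1 := by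
    have : ContinuousOn (fun y => ‖K.A y‖) S := fun y hy =>
      (K.analyticAt_A (hSG hy)).continuousAt.norm.continuousWithinAt
    obtain ⟨B, hB⟩ := hSc.bddAbove_image this
    exact ⟨max B 1, by positivity, fun y hy => (hB ⟨y, hy, rfl⟩).trans (le_max_left _ _)⟩
  set r := ε / Λ1 with hr
  have hrp : 0 < r := by positivity
  -- step 1
  have step1 : ∀ u1 ∈ K.H, ‖px (K.pt u1) - x0‖ < ε → ∀ e : Fin n → ℂ, ‖e‖ < r →
      (∀ t ∈ Set.Icc (0 : ℝ) 1, u1 + t • e ∈ K.H) →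
      ‖px (K.pt (u1 + e)) - px (K.pt u1)‖ ≤ ε := by
    intro u1 hu1 hx1 e he hseg
    have hder : ∀ t ∈ Set.Icc (0 : ℝ) 1, HasDerivAt (fun t : ℝ => px (K.pt (u1 + t • e)) - px (K.pt u1))
        (pL (fderiv ℂ K.pt (u1 + t • e) e)) t := by
      intro t ht
      have h1 := ((pL (n := n)).hasFDerivAt.comp _ (K.pt_diff (K.HsubR (hseg t ht))).hasFDerivAt).restrictScalars ℝ
      have h2 : HasDerivAt (fun t : ℝ => u1 + t • e) e t := by
        simpa using ((hasDerivAt_id t).smul_const e).const_add u1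
      exact (h1.comp_hasDerivAt t h2).sub_const _
    have := image_norm_le_of_norm_deriv_right_lt_deriv_boundary' (B := fun t => ε * t) (B' := fun _ => ε)
      (fun t ht => (hder t ht).continuousAt.continuousWithinAt)
      (fun t ht => (hder t ⟨ht.1, ht.2.le⟩).hasDerivWithinAt) (by simp) (by fun_prop)
      (fun t _ => by simpa using ((hasDerivAt_id t).const_mul ε).hasDerivWithinAt) (by
        intro t ht hnt
        have ht' : t ∈ Set.Icc (0 : ℝ) 1 := ⟨ht.1, ht.2.le⟩
        have h3 : ‖px (K.pt (u1 + t • e)) - x0‖ ≤ 2 * ε := by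
          have := norm_add_le (px (K.pt (u1 + t • e)) - px (K.pt u1)) (px (K.pt u1) - x0)
          simp only [sub_add_sub_cancel] at this
          nlinarith [ht.2]
        have hmem := hin _ (K.HsubR (hseg t ht')) h3
        rw [(K.fderiv_pt (K.HsubR (hseg t ht')) (hSG hmem)).fderiv]
        refine (norm_px_le _).trans_lt ((ContinuousLinearMap.le_opNorm _ _).trans_lt ?_)
        have h4 := hΛ1 _ hmem
        have h5 : Λ1 * r = ε := by rw [hr]; field_simp
        nlinarith [norm_nonneg e]) (x := 1) (by simp)
    simpa using this
  -- step 2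
  have step2 : ∀ u1 ∈ K.H, ‖px (K.pt u1) - x0‖ < ε → ∀ u ∈ K.H, ‖u - u1‖ < r →
      ‖px (K.pt u) - px (K.pt u1)‖ ≤ ε := by
    intro u1 hu1 hx1 u hu hur
    set e := u - u1 with he
    have hfin := finite_zeros (fun z => K.h (u1 + z • e)) (fun z =>
      (K.hh _).comp_of_eq (f := fun z : ℂ => u1 + z • e) (by fun_prop) rfl)
      ⟨0, by have : K.h u1 ≠ 0 := hu1; simpa using this⟩ 2
    have hfin2 := hfin.image (fun z : ℂ => z.im / z.re)
    have ev1 : ∀ᶠ β : ℝ in 𝓝[≠] (0 : ℝ), β ∉ (fun z : ℂ => z.im / z.re) '' {z | z ∈ Metric.closedBall (0 : ℂ) 2 ∧ K.h (u1 + z • e) = 0} :=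
      nhdsNE_le_cofinite 0 hfin2.compl_mem_cofinite
    have hcf : Continuous fun β : ℝ => (1 + β * Complex.I : ℂ) • e := by fun_prop
    have ev2 : ∀ᶠ β : ℝ in 𝓝[≠] (0 : ℝ), ‖(1 + β * Complex.I : ℂ) • e‖ < r :=
      nhdsWithin_le_nhds ((hcf.norm.continuousAt (x := 0)).eventually_lt_const (by simpa using hur))
    have ev3 : ∀ᶠ β : ℝ in 𝓝[≠] (0 : ℝ), ‖(1 + β * Complex.I : ℂ)‖ < 2 := by
      have hc2 : Continuous fun β : ℝ => (1 + β * Complex.I : ℂ) := by fun_prop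
      exact nhdsWithin_le_nhds ((hc2.norm.continuousAt (x := 0)).eventually_lt_const (by simp))
    have hcont : ContinuousAt (fun β : ℝ => ‖px (K.pt (u1 + (1 + β * Complex.I : ℂ) • e)) - px (K.pt u1)‖) 0 := by
      have h1 : ContinuousAt K.pt (u1 + (1 + ((0 : ℝ) : ℂ) * Complex.I : ℂ) • e) := by
        have : u1 + (1 + ((0 : ℝ) : ℂ) * Complex.I : ℂ) • e = u := by simp [he]
        rw [this]; exact K.pt_cont (K.HsubR hu)
      have h2 : ContinuousAt (fun β : ℝ => K.pt (u1 + (1 + β * Complex.I : ℂ) • e)) 0 :=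
        ContinuousAt.comp (f := fun β : ℝ => u1 + (1 + β * Complex.I : ℂ) • e) (g := K.pt) h1
          (continuous_const.add hcf).continuousAt
      exact ((continuous_px.continuousAt.comp h2).sub continuousAt_const).norm
    have hlim := hcont.tendsto.mono_left (nhdsWithin_le_nhds (s := {0}ᶜ))
    have hval : u1 + (1 + ((0 : ℝ) : ℂ) * Complex.I : ℂ) • e = u := by simp [he]
    rw [hval] at hlim
    refine le_of_tendsto hlim ?_
    filter_upwards [ev1, ev2, ev3] with β h1 h2 h3
    refine step1 u1 hu1 hx1 _ h2 ?_
    intro t ht hzero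
    have hzero' : K.h (u1 + ((t : ℂ) * (1 + β * Complex.I)) • e) = 0 := by
      rw [mul_smul]; simpa using hzero
    refine h1 ⟨(t : ℂ) * (1 + β * Complex.I), ⟨?_, hzero'⟩, ?_⟩
    · rw [Metric.mem_closedBall, dist_zero_right, norm_mul, Complex.norm_real, Real.norm_eq_abs, abs_of_nonneg ht.1]
      nlinarith [ht.2, ht.1, norm_nonneg (1 + β * Complex.I : ℂ)]
    · have ht0 : t ≠ 0 := by
        rintro rfl
        simp at hzero'
        exact hu1 hzero'
      simp [ht0]
  have step3 : ∀ u1 ∈ K.H, ‖px (K.pt u1) - x0‖ < ε → ∀ u ∈ Metric.ball u1 r, u ∈ K.R ∧ K.pt u ∈ S := by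
    intro u1 hu1 hx1 u hu
    have key : ∀ᶠ x in 𝓝 u, x ∈ K.H → K.ps x ∈ S := by
      filter_upwards [Metric.isOpen_ball.mem_nhds hu] with x hx hxH
      rw [← K.pt_eq hxH]
      refine hin _ (K.HsubR hxH) ?_
      have h1 := step2 u1 hu1 hx1 x hxH (by rw [← dist_eq_norm]; exact hx)
      have := norm_add_le (px (K.pt x) - px (K.pt u1)) (px (K.pt u1) - x0)
      simp only [sub_add_sub_cancel] at this
      linarith
    have huR : u ∈ K.R := ⟨Λ, key.mono fun x hx hxH => (hx hxH).2⟩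
    exact ⟨huR, K.pt_mem_closed huR S hSc.isClosed key⟩
  refine ⟨ε, hεp, r / 2, half_pos hrp, S, hSc, hSG, ?_⟩
  intro u1 hu1 hx1 u hu
  have ev : ∀ᶠ x in 𝓝 u1, ‖px (K.pt x) - x0‖ < ε :=
    ((continuous_px.continuousAt.comp (K.pt_cont hu1)).sub continuousAt_const).norm.eventually_lt_const hx1
  obtain ⟨δ, hδ, hδb⟩ := Metric.eventually_nhds_iff.1 ev
  obtain ⟨u2, hu2, hd2⟩ := K.denseH.exists_dist_lt u1 (lt_min hδ (half_pos hrp))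
  refine step3 u2 hu2 (hδb (by rw [dist_comm]; exact hd2.trans_le (min_le_left _ _))) u ?_
  have h1 : dist u u1 < r / 2 := hu
  have h2 := hd2.trans_le (min_le_right δ (r / 2))
  have := dist_triangle u u1 u2
  exact Metric.mem_ball.2 (by linarith)

lemma box2 (x0 : Fin n → ℂ) (hx0 : eval x0 K.c ≠ 0) : ∃ ε > 0, ∃ δ > 0, ∃ L : ℝ, 0 < L ∧
    ∀ u1 ∈ K.R, ‖px (K.pt u1) - x0‖ < ε → ∀ x, ‖x - px (K.pt u1)‖ ≤ δ →
      ∃ u ∈ K.R, px (K.pt u) = x ∧ ‖u - u1‖ ≤ L * ‖x - px (K.pt u1)‖ := by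
  obtain ⟨ε, hε, r, hr, S, hSc, hSG, hbox⟩ := K.box1 x0 hx0
  obtain ⟨Λ1, hΛ1p, hΛ1⟩ : ∃ Λ1 : ℝ, 0 < Λ1 ∧ ∀ y ∈ S, ‖K.A y‖ ≤ Λ1 := by
    have : ContinuousOn (fun y => ‖K.A y‖) S := fun y hy =>
      (K.analyticAt_A (hSG hy)).continuousAt.norm.continuousWithinAt
    obtain ⟨B, hB⟩ := hSc.bddAbove_image this
    exact ⟨max B 1, by positivity, fun y hy => (hB ⟨y, hy, rfl⟩).trans (le_max_left _ _)⟩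
  obtain ⟨K0, hK0p, hK0⟩ : ∃ K0 : ℝ, 0 < K0 ∧ ∀ y ∈ S, ‖K.Ai y‖ ≤ K0 := by
    have : ContinuousOn (fun y => ‖K.Ai y‖) S := fun y hy =>
      (K.analyticAt_Ai (hSG hy)).continuousAt.norm.continuousWithinAt
    obtain ⟨B, hB⟩ := hSc.bddAbove_image this
    exact ⟨max B 1, by positivity, fun y hy => (hB ⟨y, hy, rfl⟩).trans (le_max_left _ _)⟩
  have hAc : ContinuousOn K.A S := fun y hy => (K.analyticAt_A (hSG hy)).continuousAt.continuousWithinAt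
  have hunif := hSc.uniformContinuousOn_of_continuous hAc
  obtain ⟨η, hη, hηA⟩ := Metric.uniformContinuousOn_iff.1 hunif (1 / (2 * K0)) (by positivity)
  set r' := min (r / 2) (η / (2 * Λ1)) with hr'
  have hr'p : 0 < r' := by positivity
  have hr'r : r' < r := (min_le_left _ _).trans_lt (by linarith)
  refine ⟨ε, hε, r' / (2 * K0), by positivity, 2 * K0, by positivity, ?_⟩
  intro u1 hu1 hx1 x hx
  have hb := hbox u1 hu1 hx1
  have h1 := hb u1 (Metric.mem_ball_self hr)
  have hlip : ∀ w ∈ Metric.ball u1 r, ‖K.pt w - K.pt u1‖ ≤ Λ1 * ‖w - u1‖ := fun w hw =>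
    Convex.norm_image_sub_le_of_norm_hasFDerivWithin_le (𝕜 := ℂ)
      (fun v hv => (K.fderiv_pt (hb v hv).1 (hSG (hb v hv).2)).hasFDerivWithinAt)
      (fun v hv => hΛ1 _ (hb v hv).2) (convex_ball u1 r) (Metric.mem_ball_self hr) hw
  have hsub : Metric.closedBall u1 r' ⊆ Metric.ball u1 r := Metric.closedBall_subset_ball hr'r
  obtain ⟨k1, hk1⟩ : ∃ kk : NNReal, (kk : ℝ) = 1 / (2 * K0) :=
    ⟨Real.toNNReal _, Real.coe_toNNReal _ (by positivity)⟩
  obtain ⟨k2, hk2⟩ : ∃ kk : NNReal, (kk : ℝ) = K0 :=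
    ⟨Real.toNNReal _, Real.coe_toNNReal _ hK0p.le⟩
  have happ : ApproximatesLinearOn (fun u => px (K.pt u)) (pL.comp (K.A (K.pt u1)))
      (Metric.closedBall u1 r') k1 := by
    intro a ha b hbb
    refine Convex.norm_image_sub_le_of_norm_hasFDerivWithin_le' (𝕜 := ℂ) (s := Metric.closedBall u1 r')
      (fun v hv => (K.hasFDerivAt_px (hb v (hsub hv)).1 (hSG (hb v (hsub hv)).2)).hasFDerivWithinAt)
      (fun v hv => ?_) (convex_closedBall u1 r') hbb ha
    rw [← ContinuousLinearMap.comp_sub]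
    refine (norm_pL_comp_le _).trans ?_
    have h2 : dist (K.pt v) (K.pt u1) < η := by
      rw [dist_eq_norm]
      refine (hlip v (hsub hv)).trans_lt ?_
      have h3 : ‖v - u1‖ ≤ η / (2 * Λ1) := by
        rw [← dist_eq_norm]; exact (Metric.mem_closedBall.1 hv).trans (min_le_right _ _)
      have h4 : Λ1 * (η / (2 * Λ1)) = η / 2 := by field_simp
      nlinarith
    have := hηA _ (hb v (hsub hv)).2 _ h1.2 h2
    rw [dist_eq_norm] at this
    rw [hk1]; exact this.le
  let symm : (pL.comp (K.A (K.pt u1))).NonlinearRightInverse :=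
    { toFun := K.Ai (K.pt u1)
      nnnorm := k2
      bound' := fun y => (ContinuousLinearMap.le_opNorm _ _).trans (by
        rw [hk2]; exact mul_le_mul_of_nonneg_right (hK0 _ h1.2) (norm_nonneg y))
      right_inv' := K.right_inv h1.1 (hSG h1.2) }
  have hrad : 2 * K0 * ‖x - px (K.pt u1)‖ ≤ r' := by
    rw [le_div_iff₀ (by positivity)] at hx; linarith
  have hsurj := happ.surjOn_closedBall_of_nonlinearRightInverse symm (b := u1)
    (ε := 2 * K0 * ‖x - px (K.pt u1)‖) (by positivity) (Metric.closedBall_subset_closedBall hrad)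
  have hxm : x ∈ Metric.closedBall (px (K.pt u1)) ((((symm.nnnorm : NNReal) : ℝ)⁻¹ -
      (k1 : ℝ)) * (2 * K0 * ‖x - px (K.pt u1)‖)) := by
    rw [Metric.mem_closedBall, dist_eq_norm]
    have : ((((symm.nnnorm : NNReal) : ℝ)⁻¹ -
      (k1 : ℝ)) * (2 * K0 * ‖x - px (K.pt u1)‖)) = ‖x - px (K.pt u1)‖ := by
      rw [hk1]; show ((k2 : ℝ)⁻¹ - 1 / (2 * K0)) * _ = _; rw [hk2]
      show (K0⁻¹ - 1 / (2 * K0)) * (2 * K0 * ‖x - px (K.pt u1)‖) = _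
      field_simp; ring
    rw [this]
  obtain ⟨u, hu, hue⟩ := hsurj hxm
  have hu' := Metric.mem_closedBall.1 hu
  refine ⟨u, (hb u (hsub (Metric.closedBall_subset_closedBall hrad hu))).1, hue, ?_⟩
  rw [← dist_eq_norm]; exact hu'

end AddCore

namespace AddCore
variable {n : ℕ} (K : AddCore n)

/-- the fibre of first coordinates -/
def OmS (x : Fin n → ℂ) : Set ℂ := {z | ∃ u ∈ K.R, px (K.pt u) = x ∧ K.pt u none = z}

open Classical in
/-- the fibre as a finset -/
noncomputable def Om (x : Fin n → ℂ) : Finset ℂ := if h : (K.OmS x).Finite then h.toFinset else ∅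

lemma OmS_sub {x : Fin n → ℂ} (hx : eval x K.c ≠ 0) :
    K.OmS x ⊆ ((K.Pm.map (eval x)).roots.toFinset.image (fun z => z / eval x K.c) : Finset ℂ) := by
  rintro z ⟨u, hu, rfl, rfl⟩
  rw [Finset.coe_image]
  refine ⟨eval (px (K.pt u)) K.c * K.pt u none, ?_, ?_⟩
  · simp only [Finset.mem_coe, Multiset.mem_toFinset]
    rw [Polynomial.mem_roots (K.hPm.map _).ne_zero]
    exact K.E3 hu
  · dsimp only; field_simp

lemma OmS_fin {x : Fin n → ℂ} (hx : eval x K.c ≠ 0) : (K.OmS x).Finite :=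
  (Finset.finite_toSet _).subset (K.OmS_sub hx)

lemma mem_Om {x : Fin n → ℂ} (hx : eval x K.c ≠ 0) {z} : z ∈ K.Om x ↔ z ∈ K.OmS x := by
  unfold Om; rw [dif_pos (K.OmS_fin hx)]; simp

lemma card_Om {x : Fin n → ℂ} (hx : eval x K.c ≠ 0) : (K.Om x).card ≤ K.Pm.natDegree := by
  have h1 : K.Om x ⊆ (K.Pm.map (eval x)).roots.toFinset.image (fun z => z / eval x K.c) := fun z hz =>
    K.OmS_sub hx ((K.mem_Om hx).1 hz)
  refine (Finset.card_le_card h1).trans (Finset.card_image_le.trans ((Multiset.toFinset_card_le _).trans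
    ((Polynomial.card_roots' _).trans ?_)))
  exact Polynomial.natDegree_map_le

open Classical in
/-- a chosen point of the fibre -/
noncomputable def sec (x : Fin n → ℂ) (z : ℂ) : Fin n → ℂ :=
  if h : ∃ u ∈ K.R, px (K.pt u) = x ∧ K.pt u none = z then h.choose else 0

lemma sec_spec {x : Fin n → ℂ} {z} (h : z ∈ K.OmS x) :
    K.sec x z ∈ K.R ∧ px (K.pt (K.sec x z)) = x ∧ K.pt (K.sec x z) none = z := by
  have h' : ∃ u ∈ K.R, px (K.pt u) = x ∧ K.pt u none = z := h
  unfold sec; rw [dif_pos h']; exact h'.choose_spec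

lemma ext_px {y y' : Option (Fin n) → ℂ} (h1 : px y = px y') (h2 : y none = y' none) : y = y' := by
  funext i
  cases i with
  | none => exact h2
  | some k => exact congrFun h1 k

lemma exists_inv {u} (hu : u ∈ K.R) (hc : K.pt u ∈ K.Gd) :
    ∃ s : (Fin n → ℂ) → (Fin n → ℂ), s (px (K.pt u)) = u ∧ DifferentiableAt ℂ s (px (K.pt u)) ∧
      (∀ᶠ x in 𝓝 (px (K.pt u)), px (K.pt (s x)) = x) ∧ ∀ᶠ w in 𝓝 u, s (px (K.pt w)) = w := by
  have hl : Function.LeftInverse (K.Ai (K.pt u)) (pL.comp (K.A (K.pt u))) := by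
    have h1 : ((pL.comp (K.A (K.pt u))).toLinearMap) * (K.Ai (K.pt u)).toLinearMap = 1 := by
      apply LinearMap.ext; intro v; exact K.right_inv hu hc v
    have h2 := mul_eq_one_comm.1 h1
    intro v; exact LinearMap.congr_fun h2 v
  let e : (Fin n → ℂ) ≃L[ℂ] (Fin n → ℂ) := ContinuousLinearEquiv.equivOfInverse _ _ hl (K.right_inv hu hc)
  have hev : ∀ᶠ w in 𝓝 u, w ∈ K.R ∧ K.pt w ∈ K.Gd :=
    (K.openR.eventually_mem hu).and ((K.pt_cont hu).eventually (K.openGd.mem_nhds hc))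
  have hs : HasStrictFDerivAt (fun u => px (K.pt u)) (e : (Fin n → ℂ) →L[ℂ] (Fin n → ℂ)) u := by
    have : HasStrictFDerivAt (fun u => px (K.pt u)) (pL.comp (K.A (K.pt u))) u := by
      refine hasStrictFDerivAt_of_hasFDerivAt_of_continuousAt
        (f' := fun w => pL.comp (K.A (K.pt w))) (hev.mono fun w hw => K.hasFDerivAt_px hw.1 hw.2) ?_
      have hA : ContinuousAt (fun w => K.A (K.pt w)) u :=
        ContinuousAt.comp (g := K.A) (f := K.pt) (K.analyticAt_A hc).continuousAt (K.pt_cont hu)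
      exact continuousAt_const.clm_comp hA
    exact this
  refine ⟨hs.localInverse _ _ _, hs.localInverse_apply_image, ?_, hs.eventually_right_inverse, hs.eventually_left_inverse⟩
  exact hs.to_localInverse.hasFDerivAt.differentiableAt

lemma local_struct (x0 : Fin n → ℂ) (hx0 : eval x0 K.c ≠ 0) : ∃ σ : ℂ → (Fin n → ℂ) → (Fin n → ℂ),
    (∀ z ∈ K.Om x0, DifferentiableAt ℂ (σ z) x0 ∧ K.pt (σ z x0) none = z ∧ σ z x0 ∈ K.R ∧ px (K.pt (σ z x0)) = x0) ∧
    ∀ᶠ x in 𝓝 x0, eval x K.c ≠ 0 ∧ (∀ z ∈ K.Om x0, σ z x ∈ K.R ∧ px (K.pt (σ z x)) = x) ∧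
      K.Om x = (K.Om x0).image (fun z => K.pt (σ z x) none) ∧
      Set.InjOn (fun z => K.pt (σ z x) none) (K.Om x0) := by
  have hsec : ∀ z ∈ K.Om x0, _ := fun z hz => K.sec_spec ((K.mem_Om hx0).1 hz)
  have hGd : ∀ z ∈ K.Om x0, K.pt (K.sec x0 z) ∈ K.Gd := fun z hz => by
    show eval (px (K.pt (K.sec x0 z))) K.c ≠ 0
    rw [(hsec z hz).2.1]; exact hx0
  have hinv : ∀ z : ℂ, ∃ s : (Fin n → ℂ) → (Fin n → ℂ), z ∈ K.Om x0 → (s x0 = K.sec x0 z ∧ DifferentiableAt ℂ s x0 ∧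
      (∀ᶠ x in 𝓝 x0, px (K.pt (s x)) = x) ∧ ∀ᶠ w in 𝓝 (K.sec x0 z), s (px (K.pt w)) = w) := by
    intro z
    by_cases hz : z ∈ K.Om x0
    · obtain ⟨s, hs⟩ := K.exists_inv (hsec z hz).1 (hGd z hz)
      rw [(hsec z hz).2.1] at hs
      exact ⟨s, fun _ => hs⟩
    · exact ⟨fun _ => 0, fun h => absurd h hz⟩
  choose σ hσ using hinv
  refine ⟨σ, fun z hz => ?_, ?_⟩
  · rw [(hσ z hz).1]
    exact ⟨(hσ z hz).2.1, (hsec z hz).2.2, (hsec z hz).1, (hsec z hz).2.1⟩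
  have hcσ : ∀ z ∈ K.Om x0, ContinuousAt (fun x => K.pt (σ z x) none) x0 := fun z hz => by
    refine continuousAt_pi.1 (ContinuousAt.comp (g := K.pt) (f := σ z) ?_ (hσ z hz).2.1.continuousAt) none
    rw [(hσ z hz).1]; exact K.pt_cont (hsec z hz).1
  have ev1 : ∀ᶠ x in 𝓝 x0, eval x K.c ≠ 0 :=
    (MvPolynomial.continuous_eval K.c).continuousAt.eventually_ne hx0
  have ev2 : ∀ᶠ x in 𝓝 x0, ∀ z ∈ K.Om x0, σ z x ∈ K.R ∧ px (K.pt (σ z x)) = x := by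
    refine (Finset.eventually_all _).2 fun z hz => ?_
    have := (hσ z hz).2.1.continuousAt.eventually
      (p := fun w => w ∈ K.R) (by rw [(hσ z hz).1]; exact K.openR.mem_nhds (hsec z hz).1)
    exact this.and (hσ z hz).2.2.1
  have ev3 : ∀ᶠ x in 𝓝 x0, ∀ z ∈ K.Om x0, ∀ z' ∈ K.Om x0, z ≠ z' → K.pt (σ z x) none ≠ K.pt (σ z' x) none := by
    refine (Finset.eventually_all _).2 fun z hz => (Finset.eventually_all _).2 fun z' hz' => ?_
    by_cases hzz : z = z'
    · exact Eventually.of_forall fun x h => absurd hzz h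
    · have : ∀ᶠ x in 𝓝 x0, K.pt (σ z x) none ≠ K.pt (σ z' x) none := by
        have hsub := ((hcσ z hz).sub (hcσ z' hz')).eventually_ne (y := 0) (by
          rw [Pi.sub_apply]
          rw [(hσ z hz).1, (hσ z' hz').1, (hsec z hz).2.2, (hsec z' hz').2.2]; exact sub_ne_zero.2 hzz)
        exact hsub.mono fun x hx => sub_ne_zero.1 hx
      exact this.mono fun x hx _ => hx
  obtain ⟨ε, hε, δ, hδ, L, hL, hbox⟩ := K.box2 x0 hx0
  have ev4 : ∀ᶠ x in 𝓝 x0, ∀ z ∈ K.Om x0, ∀ w, ‖w‖ ≤ L * ‖x0 - x‖ →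
      σ z (px (K.pt (K.sec x0 z + w))) = K.sec x0 z + w := by
    refine (Finset.eventually_all _).2 fun z hz => ?_
    obtain ⟨ρ, hρ, hb⟩ := Metric.eventually_nhds_iff.1 (hσ z hz).2.2.2
    have hcont : ContinuousAt (fun x => L * ‖x0 - x‖) x0 := by fun_prop
    filter_upwards [hcont.eventually_lt_const (u := ρ) (by simpa using hρ)] with x hx w hw
    exact hb (by simpa using hw.trans_lt hx)
  have ev5 : ∀ᶠ x in 𝓝 x0, ‖x - x0‖ < min ε δ := by
    have hcont : ContinuousAt (fun x => ‖x - x0‖) x0 := by fun_prop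
    exact hcont.eventually_lt_const (by simpa using ⟨hε, hδ⟩)
  filter_upwards [ev1, ev2, ev3, ev4, ev5] with x h1 h2 h3 h4 h5
  refine ⟨h1, h2, ?_, ?_⟩
  · ext z
    rw [Finset.mem_image, K.mem_Om h1]
    constructor
    · rintro ⟨u', hu', hx', rfl⟩
      have hle1 : ‖px (K.pt u') - x0‖ < ε := by rw [hx']; exact h5.trans_le (min_le_left _ _)
      have hle2 : ‖x0 - px (K.pt u')‖ ≤ δ := by
        rw [hx', norm_sub_rev]; exact (h5.trans_le (min_le_right _ _)).le
      obtain ⟨u0, hu0, hpx, hn⟩ := hbox u' hu' hle1 x0 hle2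
      have hm : K.pt u0 none ∈ K.Om x0 := (K.mem_Om hx0).2 ⟨u0, hu0, hpx, rfl⟩
      refine ⟨K.pt u0 none, hm, ?_⟩
      have hs := hsec _ hm
      have hpe : K.pt u0 = K.pt (K.sec x0 (K.pt u0 none)) :=
        ext_px (by rw [hs.2.1, hpx]) (by rw [hs.2.2])
      have hg0 : K.pt u0 ∈ K.Gd := by rw [hpe]; exact hGd _ hm
      have hper := K.period hu0 hs.1 hpe hg0 (u' - u0) (by simpa using hu')
      have h6 := h4 _ hm (u' - u0) (by rw [norm_sub_rev, ← hx']; exact hn)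
      rw [hper.2, add_sub_cancel, hx'] at h6
      rw [h6, hper.2, add_sub_cancel]
    · rintro ⟨z', hz', rfl⟩
      exact ⟨σ z' x, (h2 z' hz').1, (h2 z' hz').2, rfl⟩
  · intro z hz z' hz' he
    by_contra hne
    exact h3 z hz z' hz' hne he

end AddCore

lemma diffAt_prod {E : Type*} [NormedAddCommGroup E] [NormedSpace ℂ E] {ι : Type*} {s : Finset ι}
    {f : ι → E → ℂ} {x : E} (h : ∀ i ∈ s, DifferentiableAt ℂ (f i) x) :
    DifferentiableAt ℂ (fun y => ∏ i ∈ s, f i y) x := by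
  classical
  induction s using Finset.induction_on with
  | empty => simp
  | insert a s ha ih =>
    simp only [Finset.prod_insert ha]
    exact (h a (by simp)).mul (ih fun i hi => h i (by simp [hi]))

namespace AddCore
variable {n : ℕ} (K : AddCore n)

open Classical in
/-- Lagrange type factor -/
noncomputable def Fp (x : Fin n → ℂ) (s z : ℂ) : ℂ :=
  ∏ z' ∈ K.Om x, if z' = z then 1 else eval x K.c * (s - z')

lemma Fp_bound : ∃ B : ℝ, 0 ≤ B ∧ ∃ N : ℕ, ∀ (x : Fin n → ℂ) (s z : ℂ), eval x K.c ≠ 0 →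
    ‖K.Fp x s z‖ ≤ B * (1 + ‖x‖ + ‖s‖) ^ N := by
  obtain ⟨C1, hC1, N1, h1⟩ := poly_bound K.c
  obtain ⟨C3, hC3, N3, h3⟩ := monic_bound K.Pm K.hPm
  refine ⟨(1 + C1 + C3) ^ K.Pm.natDegree, by positivity, (N1 + 1 + N3) * K.Pm.natDegree, fun x s z hx => ?_⟩
  set b := 1 + ‖x‖ + ‖s‖ with hb
  have hb1 : 1 ≤ b := by have := norm_nonneg x; have := norm_nonneg s; linarith
  have hxb : 1 + ‖x‖ ≤ b := by have := norm_nonneg s; linarith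
  have hsb : ‖s‖ ≤ b := by have := norm_nonneg x; linarith
  set Q := (1 + C1 + C3) * b ^ (N1 + 1 + N3) with hQ
  have hQ1 : 1 ≤ Q := one_le_mul_of_one_le_of_one_le (by linarith) (one_le_pow₀ hb1)
  have hfac : ∀ z' ∈ K.Om x, ‖(if z' = z then 1 else eval x K.c * (s - z') : ℂ)‖ ≤ Q := by
    intro z' hz'
    split_ifs
    · simpa using hQ1
    obtain ⟨u, hu, hux, huz⟩ := (K.mem_Om hx).1 hz'
    have e3 := h3 _ _ (K.E3 hu)
    rw [hux, huz] at e3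
    have e1 := h1 x
    rw [mul_sub]
    refine (norm_sub_le _ _).trans ?_
    rw [norm_mul (eval x K.c) s]
    have f1 : ‖eval x K.c‖ * ‖s‖ ≤ C1 * b ^ (N1 + 1 + N3) := by
      calc ‖eval x K.c‖ * ‖s‖ ≤ (C1 * b ^ N1) * b := by
            gcongr
            exact e1.trans (by gcongr)
        _ = C1 * b ^ (N1 + 1) := by ring
        _ ≤ C1 * b ^ (N1 + 1 + N3) := mul_le_mul_of_nonneg_left (pow_le_pow_right₀ hb1 (by omega)) (by assumption)
    have f2 : C3 * (1 + ‖x‖) ^ N3 ≤ C3 * b ^ (N1 + 1 + N3) := by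
      calc C3 * (1 + ‖x‖) ^ N3 ≤ C3 * b ^ N3 := by gcongr
        _ ≤ _ := mul_le_mul_of_nonneg_left (pow_le_pow_right₀ hb1 (by omega)) (by assumption)
    have f3 : 0 ≤ b ^ (N1 + 1 + N3) := by positivity
    rw [hQ, add_mul, add_mul]
    linarith
  unfold Fp
  rw [norm_prod]
  calc _ ≤ ∏ z' ∈ K.Om x, Q := Finset.prod_le_prod (fun _ _ => norm_nonneg _) (fun z' hz' => by
        convert hfac z' hz')
    _ = Q ^ (K.Om x).card := by rw [Finset.prod_const]
    _ ≤ Q ^ K.Pm.natDegree := pow_le_pow_right₀ hQ1 (K.card_Om hx)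
    _ = _ := by rw [hQ, mul_pow, ← pow_mul]

lemma Fp_ne {x : Fin n → ℂ} (hx : eval x K.c ≠ 0) (s : ℂ) : K.Fp x s s ≠ 0 := by
  unfold Fp
  rw [Finset.prod_ne_zero_iff]
  intro z' _
  split_ifs with h
  · exact one_ne_zero
  · exact mul_ne_zero hx (sub_ne_zero.2 (Ne.symm h))

lemma Fp_zero {x : Fin n → ℂ} {s z : ℂ} (hs : s ∈ K.Om x) (hsz : s ≠ z) : K.Fp x s z = 0 := by
  unfold Fp
  exact Finset.prod_eq_zero hs (by simp [hsz])

/-- the trace type function -/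
noncomputable def Tr (k : (Fin n → ℂ) → (Fin n → ℂ) → ℂ) (z : Option (Fin n) ⊕ Option (Fin n) → ℂ) : ℂ :=
  ∑ a ∈ K.Om (px fun i => z (.inl i)), ∑ b ∈ K.Om (px fun i => z (.inr i)),
    eval (Sum.elim (px fun i => z (.inl i)) (px fun i => z (.inr i))) K.d *
      k (K.sec (px fun i => z (.inl i)) a) (K.sec (px fun i => z (.inr i)) b) *
      (K.Fp (px fun i => z (.inl i)) (z (.inl none)) a * K.Fp (px fun i => z (.inr i)) (z (.inr none)) b)

lemma Tr_eq (k : (Fin n → ℂ) → (Fin n → ℂ) → ℂ)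
    (hinv : ∀ u u' v v', u ∈ K.R → u' ∈ K.R → v ∈ K.R → v' ∈ K.R → K.pt u = K.pt u' → K.pt v = K.pt v' →
      K.pt u ∈ K.Gd → K.pt v ∈ K.Gd → eval (Sum.elim (px (K.pt u)) (px (K.pt v))) K.d ≠ 0 → k u v = k u' v')
    {u v} (hu : u ∈ K.R) (hv : v ∈ K.R) (hcu : K.pt u ∈ K.Gd) (hcv : K.pt v ∈ K.Gd)
    (hd : eval (Sum.elim (px (K.pt u)) (px (K.pt v))) K.d ≠ 0) :
    K.Tr k (Sum.elim (K.pt u) (K.pt v)) = eval (Sum.elim (px (K.pt u)) (px (K.pt v))) K.d * k u v *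
      (K.Fp (px (K.pt u)) (K.pt u none) (K.pt u none) * K.Fp (px (K.pt v)) (K.pt v none) (K.pt v none)) := by
  have mu : K.pt u none ∈ K.OmS (px (K.pt u)) := ⟨u, hu, rfl, rfl⟩
  have mv : K.pt v none ∈ K.OmS (px (K.pt v)) := ⟨v, hv, rfl, rfl⟩
  have mu' := (K.mem_Om hcu).2 mu
  have mv' := (K.mem_Om hcv).2 mv
  unfold Tr
  simp only [Sum.elim_inl, Sum.elim_inr]
  rw [Finset.sum_eq_single (K.pt u none), Finset.sum_eq_single (K.pt v none)]
  · have su := K.sec_spec mu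
    have sv := K.sec_spec mv
    rw [← hinv u _ v _ hu su.1 hv sv.1 (ext_px su.2.1.symm su.2.2.symm) (ext_px sv.2.1.symm sv.2.2.symm) hcu hcv hd]
  · intro b _ hb
    rw [K.Fp_zero mv' hb.symm]; ring
  · intro h; exact absurd mv' h
  · intro a _ ha
    refine Finset.sum_eq_zero fun b _ => ?_
    rw [K.Fp_zero mu' ha.symm]; ring
  · intro h; exact absurd mu' h

lemma Tr_bound (k : (Fin n → ℂ) → (Fin n → ℂ) → ℂ) (C : ℝ) (N : ℕ)
    (hb : ∀ u v, u ∈ K.R → v ∈ K.R → eval (Sum.elim (px (K.pt u)) (px (K.pt v))) K.d ≠ 0 →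
      ‖eval (Sum.elim (px (K.pt u)) (px (K.pt v))) K.d * k u v‖ ≤ C * (1 + ‖px (K.pt u)‖ + ‖px (K.pt v)‖) ^ N) :
    ∃ C' : ℝ, ∃ N' : ℕ, ∀ z : Option (Fin n) ⊕ Option (Fin n) → ℂ,
      eval (px fun i => z (.inl i)) K.c ≠ 0 → eval (px fun i => z (.inr i)) K.c ≠ 0 →
      eval (Sum.elim (px fun i => z (.inl i)) (px fun i => z (.inr i))) K.d ≠ 0 →
      ‖K.Tr k z‖ ≤ C' * (1 + ‖z‖) ^ N' := by
  obtain ⟨B, hB, M, hM⟩ := K.Fp_bound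
  set m := K.Pm.natDegree
  refine ⟨m * (m * (|C| * 2 ^ N * ((B * 2 ^ M) * (B * 2 ^ M)))), N + (M + M), fun z h1 h2 h3 => ?_⟩
  set x := px fun i => z (.inl i) with hx
  set y := px fun i => z (.inr i) with hy
  have hxz : ‖x‖ ≤ ‖z‖ := (pi_norm_le_iff_of_nonneg (norm_nonneg _)).2 fun k => norm_le_pi_norm z _
  have hyz : ‖y‖ ≤ ‖z‖ := (pi_norm_le_iff_of_nonneg (norm_nonneg _)).2 fun k => norm_le_pi_norm z _
  have hz0 := norm_nonneg z
  have hF : ∀ (w : Fin n → ℂ) (s : ℂ), eval w K.c ≠ 0 → ‖w‖ ≤ ‖z‖ → ‖s‖ ≤ ‖z‖ → ∀ a, ‖K.Fp w s a‖ ≤ B * 2 ^ M * (1 + ‖z‖) ^ M := by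
    intro w s hw hwz hsz a
    refine (hM w s a hw).trans ?_
    rw [mul_assoc, ← mul_pow]
    have : 1 + ‖w‖ + ‖s‖ ≤ 2 * (1 + ‖z‖) := by linarith
    gcongr
  have hterm : ∀ a ∈ K.Om x, ∀ b ∈ K.Om y, ‖eval (Sum.elim x y) K.d * k (K.sec x a) (K.sec y b) *
      (K.Fp x (z (.inl none)) a * K.Fp y (z (.inr none)) b)‖ ≤
      (|C| * 2 ^ N * ((B * 2 ^ M) * (B * 2 ^ M))) * (1 + ‖z‖) ^ (N + (M + M)) := by
    intro a ha b hbb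
    have su := K.sec_spec ((K.mem_Om h1).1 ha)
    have sv := K.sec_spec ((K.mem_Om h2).1 hbb)
    have hk := hb _ _ su.1 sv.1 (by rw [su.2.1, sv.2.1]; exact h3)
    rw [su.2.1, sv.2.1] at hk
    have hk' : ‖eval (Sum.elim x y) K.d * k (K.sec x a) (K.sec y b)‖ ≤ |C| * 2 ^ N * (1 + ‖z‖) ^ N := by
      refine hk.trans ?_
      rw [mul_assoc, ← mul_pow]
      have : 1 + ‖x‖ + ‖y‖ ≤ 2 * (1 + ‖z‖) := by linarith
      have := le_abs_self C
      gcongr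
    rw [norm_mul, norm_mul (K.Fp _ _ _)]
    have fa := hF x (z (.inl none)) h1 hxz (norm_le_pi_norm z _) a
    have fb := hF y (z (.inr none)) h2 hyz (norm_le_pi_norm z _) b
    calc _ ≤ (|C| * 2 ^ N * (1 + ‖z‖) ^ N) * ((B * 2 ^ M * (1 + ‖z‖) ^ M) * (B * 2 ^ M * (1 + ‖z‖) ^ M)) := by gcongr
      _ = _ := by ring
  set Q := (|C| * 2 ^ N * ((B * 2 ^ M) * (B * 2 ^ M))) * (1 + ‖z‖) ^ (N + (M + M)) with hQ
  have hQ0 : 0 ≤ Q := by positivity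
  have hcx : ((K.Om x).card : ℝ) ≤ m := by exact_mod_cast K.card_Om h1
  have hcy : ((K.Om y).card : ℝ) ≤ m := by exact_mod_cast K.card_Om h2
  calc ‖K.Tr k z‖ ≤ ∑ a ∈ K.Om x, ∑ b ∈ K.Om y, Q := by
        unfold Tr
        refine norm_sum_le_of_le _ fun a ha => norm_sum_le_of_le _ fun b hb => hterm a ha b hb
    _ = (K.Om x).card * ((K.Om y).card * Q) := by simp
    _ ≤ m * (m * Q) := by gcongr
    _ = _ := by rw [hQ]; ring

lemma Tr_diff (k : (Fin n → ℂ) → (Fin n → ℂ) → ℂ)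
    (hinv : ∀ u u' v v', u ∈ K.R → u' ∈ K.R → v ∈ K.R → v' ∈ K.R → K.pt u = K.pt u' → K.pt v = K.pt v' →
      K.pt u ∈ K.Gd → K.pt v ∈ K.Gd → eval (Sum.elim (px (K.pt u)) (px (K.pt v))) K.d ≠ 0 → k u v = k u' v')
    (hdiff : ∀ u v, u ∈ K.R → v ∈ K.R → eval (Sum.elim (px (K.pt u)) (px (K.pt v))) K.d ≠ 0 →
      DifferentiableAt ℂ (fun q : (Fin n → ℂ) × (Fin n → ℂ) => k q.1 q.2) (u, v))
    (z0 : Option (Fin n) ⊕ Option (Fin n) → ℂ)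
    (h1 : eval (px fun i => z0 (.inl i)) K.c ≠ 0) (h2 : eval (px fun i => z0 (.inr i)) K.c ≠ 0)
    (h3 : eval (Sum.elim (px fun i => z0 (.inl i)) (px fun i => z0 (.inr i))) K.d ≠ 0) :
    DifferentiableAt ℂ (K.Tr k) z0 := by
  classical
  obtain ⟨σ, hσ, hσe⟩ := K.local_struct _ h1
  obtain ⟨τ, hτ, hτe⟩ := K.local_struct _ h2
  have dl : Differentiable ℂ fun z : Option (Fin n) ⊕ Option (Fin n) → ℂ => px fun i => z (.inl i) := by
    unfold px; fun_prop
  have dr : Differentiable ℂ fun z : Option (Fin n) ⊕ Option (Fin n) → ℂ => px fun i => z (.inr i) := by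
    unfold px; fun_prop
  have dlr : Differentiable ℂ fun z : Option (Fin n) ⊕ Option (Fin n) → ℂ =>
      (Sum.elim (px fun i => z (.inl i)) (px fun i => z (.inr i)) : Fin n ⊕ Fin n → ℂ) := by
    rw [differentiable_pi]
    rintro (i | i) <;> (unfold px; simp only [Sum.elim_inl, Sum.elim_inr]; fun_prop)
  have dd : Differentiable ℂ fun z : Option (Fin n) ⊕ Option (Fin n) → ℂ =>
      eval (Sum.elim (px fun i => z (.inl i)) (px fun i => z (.inr i))) K.d := fun z =>
    (analyticAt_eval K.d _).differentiableAt.comp z (dlr z)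
  have dcl : Differentiable ℂ fun z : Option (Fin n) ⊕ Option (Fin n) → ℂ =>
      eval (px fun i => z (.inl i)) K.c := fun z => (analyticAt_eval K.c _).differentiableAt.comp z (dl z)
  have dcr : Differentiable ℂ fun z : Option (Fin n) ⊕ Option (Fin n) → ℂ =>
      eval (px fun i => z (.inr i)) K.c := fun z => (analyticAt_eval K.c _).differentiableAt.comp z (dr z)
  set x0 := px fun i => z0 (.inl i) with hx0
  set y0 := px fun i => z0 (.inr i) with hy0
  have ev : K.Tr k =ᶠ[𝓝 z0] fun z => ∑ a ∈ K.Om x0, ∑ b ∈ K.Om y0,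
      eval (Sum.elim (px fun i => z (.inl i)) (px fun i => z (.inr i))) K.d *
      k (σ a (px fun i => z (.inl i))) (τ b (px fun i => z (.inr i))) *
      ((∏ a' ∈ K.Om x0, if a' = a then 1 else eval (px fun i => z (.inl i)) K.c * (z (.inl none) - K.pt (σ a' (px fun i => z (.inl i))) none)) *
       (∏ b' ∈ K.Om y0, if b' = b then 1 else eval (px fun i => z (.inr i)) K.c * (z (.inr none) - K.pt (τ b' (px fun i => z (.inr i))) none))) := by
    have e3 : ∀ᶠ z in 𝓝 z0, eval (Sum.elim (px fun i => z (.inl i)) (px fun i => z (.inr i))) K.d ≠ 0 :=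
      (dd z0).continuousAt.eventually_ne h3
    filter_upwards [(dl z0).continuousAt.eventually hσe, (dr z0).continuousAt.eventually hτe, e3] with z ha hb hd
    set x := px fun i => z (.inl i) with hx
    set y := px fun i => z (.inr i) with hy
    unfold Tr
    rw [← hx, ← hy, ha.2.2.1, Finset.sum_image ha.2.2.2]
    refine Finset.sum_congr rfl fun a haa => ?_
    rw [hb.2.2.1, Finset.sum_image hb.2.2.2]
    refine Finset.sum_congr rfl fun b hbb => ?_
    have ra := ha.2.1 a haa
    have rb := hb.2.1 b hbb
    have su := K.sec_spec (x := x) (z := K.pt (σ a x) none) ⟨_, ra.1, ra.2, rfl⟩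
    have sv := K.sec_spec (x := y) (z := K.pt (τ b y) none) ⟨_, rb.1, rb.2, rfl⟩
    congr 1
    · congr 1
      refine hinv _ _ _ _ su.1 ra.1 sv.1 rb.1 (ext_px (su.2.1.trans ra.2.symm) su.2.2)
        (ext_px (sv.2.1.trans rb.2.symm) sv.2.2) ?_ ?_ ?_
      · show eval (px _) K.c ≠ 0
        rw [su.2.1]; exact ha.1
      · show eval (px _) K.c ≠ 0
        rw [sv.2.1]; exact hb.1
      · rw [su.2.1, sv.2.1]; exact hd
    · congr 1
      · unfold Fp
        rw [ha.2.2.1, Finset.prod_image ha.2.2.2]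
        refine Finset.prod_congr rfl fun a' ha' => ?_
        have : K.pt (σ a' x) none = K.pt (σ a x) none ↔ a' = a := ha.2.2.2.eq_iff ha' haa
        simp only [this]
      · unfold Fp
        rw [hb.2.2.1, Finset.prod_image hb.2.2.2]
        refine Finset.prod_congr rfl fun b' hb' => ?_
        have : K.pt (τ b' y) none = K.pt (τ b y) none ↔ b' = b := hb.2.2.2.eq_iff hb' hbb
        simp only [this]
  rw [ev.differentiableAt_iff]
  have dσ : ∀ a ∈ K.Om x0, DifferentiableAt ℂ (fun z : Option (Fin n) ⊕ Option (Fin n) → ℂ => σ a (px fun i => z (.inl i))) z0 :=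
    fun a ha => DifferentiableAt.comp (g := σ a) z0 (hσ a ha).1 (dl z0)
  have dτ : ∀ a ∈ K.Om y0, DifferentiableAt ℂ (fun z : Option (Fin n) ⊕ Option (Fin n) → ℂ => τ a (px fun i => z (.inr i))) z0 :=
    fun a ha => DifferentiableAt.comp (g := τ a) z0 (hτ a ha).1 (dr z0)
  have pσ : ∀ a ∈ K.Om x0, DifferentiableAt ℂ (fun z : Option (Fin n) ⊕ Option (Fin n) → ℂ => K.pt (σ a (px fun i => z (.inl i))) none) z0 :=
    fun a ha => differentiableAt_pi.1 (DifferentiableAt.comp (g := K.pt) z0 (K.pt_diff (hσ a ha).2.2.1) (dσ a ha)) none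
  have pτ : ∀ a ∈ K.Om y0, DifferentiableAt ℂ (fun z : Option (Fin n) ⊕ Option (Fin n) → ℂ => K.pt (τ a (px fun i => z (.inr i))) none) z0 :=
    fun a ha => differentiableAt_pi.1 (DifferentiableAt.comp (g := K.pt) z0 (K.pt_diff (hτ a ha).2.2.1) (dτ a ha)) none
  refine DifferentiableAt.fun_sum fun a ha => DifferentiableAt.fun_sum fun b hb => ?_
  refine ((dd z0).mul ?_).mul (DifferentiableAt.mul ?_ ?_)
  · refine DifferentiableAt.comp (g := fun q : (Fin n → ℂ) × (Fin n → ℂ) => k q.1 q.2) z0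
      (hdiff _ _ (hσ a ha).2.2.1 (hτ b hb).2.2.1 ?_) ((dσ a ha).prodMk (dτ b hb))
    rw [(hσ a ha).2.2.2, (hτ b hb).2.2.2]; exact h3
  · refine diffAt_prod fun a' ha' => ?_
    split_ifs
    · fun_prop
    · exact (dcl z0).mul (DifferentiableAt.sub (by fun_prop) (pσ a' ha'))
  · refine diffAt_prod fun a' ha' => ?_
    split_ifs
    · fun_prop
    · exact (dcr z0).mul (DifferentiableAt.sub (by fun_prop) (pτ a' ha'))

end AddCore

namespace AddCore
variable {n : ℕ} (K : AddCore n)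

lemma Tr_poly (k : (Fin n → ℂ) → (Fin n → ℂ) → ℂ) (C : ℝ) (N : ℕ)
    (hinv : ∀ u u' v v', u ∈ K.R → u' ∈ K.R → v ∈ K.R → v' ∈ K.R → K.pt u = K.pt u' → K.pt v = K.pt v' →
      K.pt u ∈ K.Gd → K.pt v ∈ K.Gd → eval (Sum.elim (px (K.pt u)) (px (K.pt v))) K.d ≠ 0 → k u v = k u' v')
    (hdiff : ∀ u v, u ∈ K.R → v ∈ K.R → eval (Sum.elim (px (K.pt u)) (px (K.pt v))) K.d ≠ 0 →
      DifferentiableAt ℂ (fun q : (Fin n → ℂ) × (Fin n → ℂ) => k q.1 q.2) (u, v))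
    (hb : ∀ u v, u ∈ K.R → v ∈ K.R → eval (Sum.elim (px (K.pt u)) (px (K.pt v))) K.d ≠ 0 →
      ‖eval (Sum.elim (px (K.pt u)) (px (K.pt v))) K.d * k u v‖ ≤ C * (1 + ‖px (K.pt u)‖ + ‖px (K.pt v)‖) ^ N) :
    ∃ p : MvPolynomial (Option (Fin n) ⊕ Option (Fin n)) ℂ, ∀ u v, u ∈ K.R → v ∈ K.R → K.pt u ∈ K.Gd →
      K.pt v ∈ K.Gd → eval (Sum.elim (px (K.pt u)) (px (K.pt v))) K.d ≠ 0 →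
      eval (Sum.elim (K.pt u) (K.pt v)) p = eval (Sum.elim (px (K.pt u)) (px (K.pt v))) K.d * k u v *
      (K.Fp (px (K.pt u)) (K.pt u none) (K.pt u none) * K.Fp (px (K.pt v)) (K.pt v none) (K.pt v none)) := by
  obtain ⟨C', N', hT⟩ := K.Tr_bound k C N hb
  let Δ : MvPolynomial (Option (Fin n) ⊕ Option (Fin n)) ℂ :=
    rename (fun k => .inl (some k)) K.c * rename (fun k => .inr (some k)) K.c * rename (Sum.map some some) K.d
  have hΔ : ∀ z, eval z Δ = eval (px fun i => z (.inl i)) K.c * eval (px fun i => z (.inr i)) K.c *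
      eval (Sum.elim (px fun i => z (.inl i)) (px fun i => z (.inr i))) K.d := by
    intro z
    simp only [Δ, map_mul, eval_rename]
    congr 2
    congr 1
    funext i
    cases i <;> rfl
  have hne : ∀ z, eval z Δ ≠ 0 → eval (px fun i => z (.inl i)) K.c ≠ 0 ∧ eval (px fun i => z (.inr i)) K.c ≠ 0 ∧
      eval (Sum.elim (px fun i => z (.inl i)) (px fun i => z (.inr i))) K.d ≠ 0 := by
    intro z hz
    rw [hΔ] at hz
    exact ⟨left_ne_zero_of_mul (left_ne_zero_of_mul hz), right_ne_zero_of_mul (left_ne_zero_of_mul hz), right_ne_zero_of_mul hz⟩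
  obtain ⟨p, hp⟩ := ext_poly Δ (K.Tr k) C' N'
    (fun z hz => K.Tr_diff k hinv hdiff z (hne z hz).1 (hne z hz).2.1 (hne z hz).2.2)
    (fun z hz => hT z (hne z hz).1 (hne z hz).2.1 (hne z hz).2.2)
  refine ⟨p, fun u v hu hv hcu hcv hd => ?_⟩
  rw [← K.Tr_eq k hinv hu hv hcu hcv hd]
  refine (hp _ ?_).symm
  rw [hΔ]
  exact mul_ne_zero (mul_ne_zero hcu hcv) hd

theorem core : ∃ (Nn : Option (Fin n) → MvPolynomial (Option (Fin n) ⊕ Option (Fin n)) ℂ)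
    (D : MvPolynomial (Option (Fin n) ⊕ Option (Fin n)) ℂ), ∀ u v, u ∈ K.H → v ∈ K.H → u + v ∈ K.H →
      eval (px (K.ps u)) K.c ≠ 0 → eval (px (K.ps v)) K.c ≠ 0 →
      eval (Sum.elim (px (K.ps u)) (px (K.ps v))) K.d ≠ 0 →
      eval (Sum.elim (K.ps u) (K.ps v)) D ≠ 0 ∧
      ∀ i, K.ps (u + v) i = eval (Sum.elim (K.ps u) (K.ps v)) (Nn i) / eval (Sum.elim (K.ps u) (K.ps v)) D := by
  obtain ⟨Cd, hCd, Nd, hd⟩ := poly_bound K.d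
  obtain ⟨D, hD⟩ := K.Tr_poly (fun _ _ => 1) Cd Nd (fun _ _ _ _ _ _ _ _ _ _ _ _ _ => rfl)
    (fun _ _ _ _ _ => by fun_prop) (fun u v _ _ _ => by
      rw [mul_one]
      refine (hd _).trans ?_
      have : ‖(Sum.elim (px (K.pt u)) (px (K.pt v)) : Fin n ⊕ Fin n → ℂ)‖ ≤ ‖px (K.pt u)‖ + ‖px (K.pt v)‖ := by
        refine (pi_norm_le_iff_of_nonneg (by positivity)).2 ?_
        rintro (i | i)
        · exact (norm_le_pi_norm (px (K.pt u)) i).trans (le_add_of_nonneg_right (norm_nonneg _))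
        · exact (norm_le_pi_norm (px (K.pt v)) i).trans (le_add_of_nonneg_left (norm_nonneg _))
      rw [add_assoc]
      gcongr)
  have hN : ∀ i, _ := fun i => K.Tr_poly (fun u v => K.pt (u + v) i) K.C K.N (by
      intro u u' v v' hu hu' hv hv' hue hve hcu hcv hduv
      have m1 := K.add_mem hu hv hduv
      have p1 := K.period hu hu' hue hcu v m1
      have m2 : v + u' ∈ K.R := by rw [add_comm]; exact p1.1
      have p2 := K.period hv hv' hve hcv u' m2
      show K.pt (u + v) i = K.pt (u' + v') i
      rw [add_comm u' v', p2.2, add_comm v u', p1.2]) (by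
      intro u v hu hv hduv
      have m1 := K.add_mem hu hv hduv
      exact differentiableAt_pi.1 (DifferentiableAt.comp (g := K.pt)
        (f := fun q : (Fin n → ℂ) × (Fin n → ℂ) => q.1 + q.2) (u, v) (K.pt_diff m1) (by fun_prop)) i) (by
      intro u v hu hv hduv
      exact K.E4 hu hv (K.add_mem hu hv hduv) i)
  choose Nn hNn using hN
  refine ⟨Nn, D, fun u v hu hv huv hcu hcv hduv => ?_⟩
  rw [← K.pt_eq hu] at hcu hduv ⊢
  rw [← K.pt_eq hv] at hcv hduv ⊢
  rw [← K.pt_eq huv]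
  have hu' := K.HsubR hu
  have hv' := K.HsubR hv
  have hDe := hD u v hu' hv' hcu hcv hduv
  have hne : eval (Sum.elim (K.pt u) (K.pt v)) D ≠ 0 := by
    rw [hDe, mul_one]
    exact mul_ne_zero hduv (mul_ne_zero (K.Fp_ne hcu _) (K.Fp_ne hcv _))
  refine ⟨hne, fun i => ?_⟩
  rw [eq_div_iff hne, hDe, hNn i u v hu' hv' hcu hcv hduv]
  ring

end AddCore

section algebra

lemma eval2_option {S : Type*} [CommRing S] [Algebra ℂ S] {τ : Type*} (f : Option τ → S)
    (q : MvPolynomial (Option τ) ℂ) :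
    Polynomial.eval₂ (aeval (fun k => f (some k)) : MvPolynomial τ ℂ →ₐ[ℂ] S).toRingHom (f none)
      (optionEquivLeft ℂ τ q) = aeval f q := by
  induction q using MvPolynomial.induction_on with
  | C a => simp [optionEquivLeft_C]
  | add p q hp hq => simp only [map_add, Polynomial.eval₂_add, hp, hq]
  | mul_X p i hp =>
    simp only [map_mul, Polynomial.eval₂_mul, hp]
    cases i with
    | none => simp [optionEquivLeft_X_none]
    | some k => simp [optionEquivLeft_X_some]

variable {S : Type*} [CommRing S] [IsDomain S] [Algebra ℂ S] {n : ℕ} (f : Option (Fin n) → S)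

/-- rational elements -/
def RatEl (y : S) : Prop := ∃ c : MvPolynomial (Fin n) ℂ, c ≠ 0 ∧ ∃ W : MvPolynomial (Option (Fin n)) ℂ,
  aeval (fun k => f (some k)) c * y = aeval f W

lemma aeval_some (c : MvPolynomial (Fin n) ℂ) : aeval (fun k => f (some k)) c = aeval f (rename some c) := by
  rw [aeval_rename]; rfl

lemma RatEl.of (W : MvPolynomial (Option (Fin n)) ℂ) : RatEl f (aeval f W) := ⟨1, one_ne_zero, W, by simp⟩

variable {f}

lemma RatEl.add {y y' : S} (h : RatEl f y) (h' : RatEl f y') : RatEl f (y + y') := by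
  obtain ⟨c, hc, W, hW⟩ := h
  obtain ⟨c', hc', W', hW'⟩ := h'
  refine ⟨c * c', mul_ne_zero hc hc', rename some c' * W + rename some c * W', ?_⟩
  simp only [map_mul, map_add, ← aeval_some, ← hW, ← hW']
  ring

lemma RatEl.mul {y y' : S} (h : RatEl f y) (h' : RatEl f y') : RatEl f (y * y') := by
  obtain ⟨c, hc, W, hW⟩ := h
  obtain ⟨c', hc', W', hW'⟩ := h'
  refine ⟨c * c', mul_ne_zero hc hc', W * W', ?_⟩
  simp only [map_mul, ← hW, ← hW']
  ring

lemma isAlg_none {τ : Type*} {f : Option τ → S} {T : Type*} [CommRing T] [Algebra T S]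
    (hinj : ∀ p : MvPolynomial τ ℂ, aeval (fun k => f (some k)) p = 0 → p = 0)
    (hc : ∀ p : MvPolynomial τ ℂ, ∃ t : T, algebraMap T S t = aeval (fun k => f (some k)) p)
    (V : MvPolynomial (Option τ) ℂ) (hV0 : V ≠ 0) (hV : aeval f V = 0) : IsAlgebraic T (f none) := by
  choose g hg using hc
  set P := optionEquivLeft ℂ τ V with hP
  have hP0 : P ≠ 0 := by rw [hP]; simpa using hV0
  have hP2 := eval2_option f V
  rw [hV, ← hP] at hP2
  refine ⟨∑ j ∈ P.support, Polynomial.monomial j (g (P.coeff j)), ?_, ?_⟩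
  · intro h0
    apply hP0
    ext1 j
    by_contra hne
    have hne' : P.coeff j ≠ 0 := by simpa using hne
    have h1 := congrArg (fun q => Polynomial.coeff q j) h0
    simp only [Polynomial.finset_sum_coeff, Polynomial.coeff_monomial, Polynomial.coeff_zero] at h1
    rw [Finset.sum_eq_single j (by intro b _ hb; simp [hb]) (by intro h; exact absurd (Polynomial.mem_support_iff.2 hne') h)] at h1
    simp only [if_true] at h1
    apply hne'
    apply hinj
    rw [← hg, h1, map_zero]
  · rw [map_sum, ← hP2, Polynomial.eval₂_eq_sum, Polynomial.sum]
    refine Finset.sum_congr rfl fun j _ => ?_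
    rw [Polynomial.aeval_monomial, hg]; rfl

lemma RatEl.inv
    (hinj : ∀ p : MvPolynomial (Fin n) ℂ, aeval (fun k => f (some k)) p = 0 → p = 0)
    (V : MvPolynomial (Option (Fin n)) ℂ) (hV0 : V ≠ 0) (hV : aeval f V = 0)
    (b : MvPolynomial (Option (Fin n)) ℂ) (hb : aeval f b ≠ 0) :
    ∃ c : MvPolynomial (Fin n) ℂ, c ≠ 0 ∧ ∃ e : MvPolynomial (Option (Fin n)) ℂ,
      aeval f b * aeval f e = aeval (fun k => f (some k)) c := by
  letI : Algebra (MvPolynomial (Fin n) ℂ) S := (aeval (fun k => f (some k))).toAlgebra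
  have halg : ∀ p, algebraMap (MvPolynomial (Fin n) ℂ) S p = aeval (fun k => f (some k)) p := fun _ => rfl
  have h1 : IsAlgebraic (MvPolynomial (Fin n) ℂ) (f none) := isAlg_none hinj (fun p => ⟨p, rfl⟩) V hV0 hV
  have h2 : ∀ q : MvPolynomial (Option (Fin n)) ℂ, IsAlgebraic (MvPolynomial (Fin n) ℂ) (aeval f q) := by
    intro q
    induction q using MvPolynomial.induction_on with
    | C a =>
      have : aeval f (C a : MvPolynomial (Option (Fin n)) ℂ) = algebraMap (MvPolynomial (Fin n) ℂ) S (C a) := by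
        rw [halg]; simp
      rw [this]; exact isAlgebraic_algebraMap _
    | add p q hp hq => rw [map_add]; exact hp.add hq
    | mul_X p i hp =>
      rw [map_mul, aeval_X]
      refine hp.mul ?_
      cases i with
      | none => exact h1
      | some k =>
        have : f (some k) = algebraMap (MvPolynomial (Fin n) ℂ) S (X k) := by rw [halg]; simp
        rw [this]; exact isAlgebraic_algebraMap _
  obtain ⟨q, hq0, hq⟩ := (h2 b).exists_nonzero_coeff_and_aeval_eq_zero (mem_nonZeroDivisors_of_ne_zero hb)
  have h3 : ∀ r : Polynomial (MvPolynomial (Fin n) ℂ), ∃ e : MvPolynomial (Option (Fin n)) ℂ, Polynomial.aeval (aeval f b) r = aeval f e := by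
    intro r
    induction r using Polynomial.induction_on' with
    | add p q hp hq =>
      obtain ⟨e, he⟩ := hp
      obtain ⟨e', he'⟩ := hq
      exact ⟨e + e', by rw [map_add, map_add, he, he']⟩
    | monomial j a =>
      refine ⟨rename some a * b ^ j, ?_⟩
      rw [Polynomial.aeval_monomial, halg, map_mul, map_pow, ← aeval_some]
  obtain ⟨e, he⟩ := h3 q.divX
  refine ⟨-q.coeff 0, neg_ne_zero.2 hq0, e, ?_⟩
  have := congrArg (Polynomial.aeval (aeval f b)) (Polynomial.divX_mul_X_add q)
  rw [hq, map_add, map_mul, Polynomial.aeval_X, Polynomial.aeval_C, he, halg] at this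
  rw [map_neg]
  linear_combination this

lemma RatEl.of_frac
    (hinj : ∀ p : MvPolynomial (Fin n) ℂ, aeval (fun k => f (some k)) p = 0 → p = 0)
    (V : MvPolynomial (Option (Fin n)) ℂ) (hV0 : V ≠ 0) (hV : aeval f V = 0)
    {y : S} (b : MvPolynomial (Option (Fin n)) ℂ) (hb : aeval f b ≠ 0) (hy : RatEl f (aeval f b * y)) : RatEl f y := by
  obtain ⟨c, hc, e, he⟩ := RatEl.inv hinj V hV0 hV b hb
  obtain ⟨c', hc', W, hW⟩ := hy
  refine ⟨c * c', mul_ne_zero hc hc', W * e, ?_⟩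
  rw [map_mul, map_mul, ← hW, ← he]
  ring

lemma RatEl.deriv_some (D : Derivation ℂ S S) (hD : ∀ k, RatEl f (D (f (some k)))) (a : MvPolynomial (Fin n) ℂ) :
    RatEl f (D (aeval (fun k => f (some k)) a)) := by
  induction a using MvPolynomial.induction_on with
  | C a => simpa using RatEl.of f 0
  | add p q hp hq => rw [map_add, map_add]; exact hp.add hq
  | mul_X p i hp =>
    rw [map_mul, aeval_X, Derivation.leibniz, smul_eq_mul, smul_eq_mul]
    refine RatEl.add (RatEl.mul ?_ (hD i)) (RatEl.mul ?_ hp)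
    · rw [aeval_some]; exact RatEl.of f _
    · simpa using RatEl.of f (X (some i))

lemma RatEl.deriv_none
    (hinj : ∀ p : MvPolynomial (Fin n) ℂ, aeval (fun k => f (some k)) p = 0 → p = 0)
    (V : MvPolynomial (Option (Fin n)) ℂ) (hV0 : V ≠ 0) (hV : aeval f V = 0)
    (D : Derivation ℂ S S) (hD : ∀ k, RatEl f (D (f (some k)))) : RatEl f (D (f none)) := by
  classical
  set ev := Polynomial.eval₂ (aeval (fun k => f (some k)) : MvPolynomial (Fin n) ℂ →ₐ[ℂ] S).toRingHom (f none) with hev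
  have hex : ∃ d : ℕ, ∃ P : Polynomial (MvPolynomial (Fin n) ℂ), P ≠ 0 ∧ ev P = 0 ∧ P.natDegree = d :=
    ⟨_, optionEquivLeft ℂ _ V, by simpa using hV0, by rw [hev, eval2_option, hV], rfl⟩
  obtain ⟨P, hP0, hP, hPd⟩ := Nat.find_spec hex
  have hmin : ∀ Q, Q ≠ 0 → ev Q = 0 → P.natDegree ≤ Q.natDegree := fun Q hQ0 hQ => by
    rw [hPd]; exact Nat.find_min' hex ⟨Q, hQ0, hQ, rfl⟩
  have hdeg : P.natDegree ≠ 0 := by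
    intro h0
    rw [Polynomial.eq_C_of_natDegree_eq_zero h0, hev, Polynomial.eval₂_C] at hP
    have := hinj _ hP
    rw [Polynomial.eq_C_of_natDegree_eq_zero h0, this] at hP0
    simp at hP0
  have hder : ev P.derivative ≠ 0 := by
    intro h0
    have h1 : P.derivative ≠ 0 := by
      intro h; exact hdeg (Polynomial.natDegree_eq_zero_of_derivative_eq_zero h)
    have := hmin _ h1 h0
    have := Polynomial.natDegree_derivative_lt hdeg
    omega
  have key : ∀ Q : Polynomial (MvPolynomial (Fin n) ℂ), ∃ y, RatEl f y ∧ D (ev Q) = ev Q.derivative * D (f none) + y := by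
    intro Q
    induction Q using Polynomial.induction_on' with
    | add p q hp hq =>
      obtain ⟨y, hy, e⟩ := hp
      obtain ⟨y', hy', e'⟩ := hq
      refine ⟨y + y', hy.add hy', ?_⟩
      simp only [hev, Polynomial.derivative_add, Polynomial.eval₂_add, map_add] at e e' ⊢
      rw [e, e']; ring
    | monomial j a =>
      refine ⟨f none ^ j * D (aeval (fun k => f (some k)) a), RatEl.mul ?_ (RatEl.deriv_some D hD a), ?_⟩
      · simpa using RatEl.of f (X none ^ j)
      · simp only [hev, Polynomial.derivative_monomial, Polynomial.eval₂_monomial, AlgHom.toRingHom_eq_coe, RingHom.coe_coe,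
          Derivation.leibniz, Derivation.leibniz_pow, map_mul, map_natCast, smul_eq_mul, nsmul_eq_mul]
        ring
  obtain ⟨y, hy, e⟩ := key P
  rw [hP, map_zero] at e
  have hpd : ev P.derivative = aeval f ((optionEquivLeft ℂ _).symm P.derivative) := by
    rw [← eval2_option]; simp [hev]
  refine RatEl.of_frac hinj V hV0 hV ((optionEquivLeft ℂ _).symm P.derivative) (hpd ▸ hder) ?_
  rw [← hpd]
  have h5 : ev P.derivative * D (f none) = aeval f (-1 : MvPolynomial (Option (Fin n)) ℂ) * y := by
    rw [map_neg, map_one]; linear_combination -e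
  rw [h5]
  exact (RatEl.of f _).mul hy

lemma RatEl.common {ι : Type*} (s : Finset ι) (y : ι → S) (hy : ∀ i, RatEl f (y i)) :
    ∃ c : MvPolynomial (Fin n) ℂ, c ≠ 0 ∧ ∃ W : ι → MvPolynomial (Option (Fin n)) ℂ,
      ∀ i ∈ s, aeval (fun k => f (some k)) c * y i = aeval f (W i) := by
  classical
  choose c hc W hW using hy
  refine ⟨∏ i ∈ s, c i, Finset.prod_ne_zero_iff.2 fun i _ => hc i,
    fun i => rename some (∏ j ∈ s.erase i, c j) * W i, fun i hi => ?_⟩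
  rw [← Finset.mul_prod_erase s c hi, map_mul, map_mul, ← aeval_some, ← hW]
  ring

theorem alg_core
    (hinj : ∀ p : MvPolynomial (Fin n) ℂ, aeval (fun k => f (some k)) p = 0 → p = 0)
    (V : MvPolynomial (Option (Fin n)) ℂ) (hV0 : V ≠ 0) (hV : aeval f V = 0)
    (D : Fin n → Derivation ℂ S S) (A B : Fin n → Fin n → MvPolynomial (Option (Fin n)) ℂ)
    (hB : ∀ k p, aeval f (B k p) ≠ 0)
    (hAB : ∀ k p, aeval f (B k p) * D p (f (some k)) = aeval f (A k p))
    (hdet : Matrix.det (Matrix.of fun k p => D p (f (some k))) ≠ 0) :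
    ∃ c : MvPolynomial (Fin n) ℂ, c ≠ 0 ∧ ∃ (W : Option (Fin n) → Fin n → MvPolynomial (Option (Fin n)) ℂ)
      (M : Fin n → Fin n → MvPolynomial (Option (Fin n)) ℂ) (Pm : Polynomial (MvPolynomial (Fin n) ℂ)),
      Pm.Monic ∧
      (∀ i p, aeval (fun k => f (some k)) c * D p (f i) = aeval f (W i p)) ∧
      (∀ k l, ∑ p, aeval f (W (some k) p) * aeval f (M p l) =
        if k = l then (aeval (fun k => f (some k)) c : S) ^ 2 else 0) ∧
      Polynomial.eval₂ (aeval (fun k => f (some k)) : MvPolynomial (Fin n) ℂ →ₐ[ℂ] S).toRingHom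
        (aeval (fun k => f (some k)) c * f none) Pm = 0 := by
  classical
  have hsome : ∀ p k, RatEl f (D p (f (some k))) := fun p k =>
    RatEl.of_frac hinj V hV0 hV (B k p) (hB k p) (by rw [hAB]; exact RatEl.of f _)
  have hall : ∀ q : Option (Fin n) × Fin n, RatEl f (D q.2 (f q.1)) := by
    rintro ⟨i, p⟩
    cases i with
    | none => exact RatEl.deriv_none hinj V hV0 hV (D p) (hsome p)
    | some k => exact hsome p k
  obtain ⟨c1, hc1, W1, hW1⟩ := RatEl.common Finset.univ _ hall
  have hW1' : ∀ i p, aeval (fun k => f (some k)) c1 * D p (f i) = aeval f (W1 (i, p)) := fun i p =>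
    hW1 (i, p) (Finset.mem_univ _)
  set Wm : Matrix (Fin n) (Fin n) (MvPolynomial (Option (Fin n)) ℂ) := Matrix.of fun k p => W1 (some k, p) with hWm
  have hc1' : (aeval (fun k => f (some k)) c1 : S) ≠ 0 := fun h => hc1 (hinj _ h)
  have hdW : aeval f Wm.det ≠ 0 := by
    have h1 : aeval f Wm.det = (aeval (fun k => f (some k)) c1 : S) ^ n * Matrix.det (Matrix.of fun k p => D p (f (some k))) := by
      rw [AlgHom.map_det]
      have : (aeval f).mapMatrix Wm = (aeval (fun k => f (some k)) c1 : S) • Matrix.of fun k p => D p (f (some k)) := by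
        ext k p
        simp [hWm, hW1']
      rw [this, Matrix.det_smul, Fintype.card_fin]
    rw [h1]
    exact mul_ne_zero (pow_ne_zero _ hc1') hdet
  obtain ⟨c0, hc0, e0, he0⟩ := RatEl.inv hinj V hV0 hV _ hdW
  letI : Algebra (MvPolynomial (Fin n) ℂ) S := (aeval (fun k => f (some k))).toAlgebra
  have halg : ∀ p, algebraMap (MvPolynomial (Fin n) ℂ) S p = aeval (fun k => f (some k)) p := fun _ => rfl
  have h1 : IsAlgebraic (MvPolynomial (Fin n) ℂ) (f none) := isAlg_none hinj (fun p => ⟨p, rfl⟩) V hV0 hV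
  obtain ⟨e, he, hI1⟩ := h1.exists_integral_multiple
  have hI2 : IsIntegral (MvPolynomial (Fin n) ℂ) ((c1 * c0 * e) • f none) := by
    rw [mul_smul]; exact hI1.smul _
  obtain ⟨Pm, hPm, hPe⟩ := hI2
  refine ⟨c1 * c0 * e, mul_ne_zero (mul_ne_zero hc1 hc0) he, fun i p => rename some (c0 * e) * W1 (i, p),
    fun p l => rename some (c1 ^ 2 * e) * (Wm.adjugate p l * e0), Pm, hPm, ?_, ?_, ?_⟩
  · intro i p
    simp only [map_mul, ← aeval_some, ← hW1']
    ring
  · intro k l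
    have h2 := congrFun (congrFun Wm.mul_adjugate k) l
    rw [Matrix.mul_apply, Matrix.smul_apply, Matrix.one_apply] at h2
    have h3 := congrArg (aeval f) h2
    rw [map_sum] at h3
    have h4 : ∀ p, (aeval f) (rename some (c0 * e) * W1 (some k, p)) * (aeval f) (rename some (c1 ^ 2 * e) * (Wm.adjugate p l * e0)) =
        aeval f (Wm k p * Wm.adjugate p l) * (aeval (fun k => f (some k)) (c0 * e * (c1 ^ 2 * e)) * aeval f e0) := by
      intro p
      simp only [map_mul, ← aeval_some, hWm, Matrix.of_apply]
      ring
    rw [Finset.sum_congr rfl fun p _ => h4 p, ← Finset.sum_mul, h3]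
    split_ifs
    · simp only [smul_eq_mul, mul_one, map_mul, map_pow]
      linear_combination (aeval (fun k => f (some k)) c0 * aeval (fun k => f (some k)) e * aeval (fun k => f (some k)) c1 ^ 2 * aeval (fun k => f (some k)) e) * he0
    · simp
  · rw [Algebra.smul_def, halg] at hPe
    exact hPe

end algebra

section MRing
variable {E : Type*} [NormedAddCommGroup E] [NormedSpace ℂ E]

/-- The ring of functions of the form `Q / h ^ N` with `Q` entire. -/
def MSub (h : E → ℂ) (hh : ∀ u, AnalyticAt ℂ h u) : Subalgebra ℂ ({u : E // h u ≠ 0} → ℂ) where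
  carrier := {f | ∃ (N : ℕ) (Q : E → ℂ), (∀ u, AnalyticAt ℂ Q u) ∧
    ∀ u : {u : E // h u ≠ 0}, f u * h u ^ N = Q u}
  mul_mem' := by
    rintro f g ⟨N, Q, hQ, e⟩ ⟨M, R, hR, e'⟩
    refine ⟨N + M, fun u => Q u * R u, fun u => (hQ u).mul (hR u), fun u => ?_⟩
    simp only [Pi.mul_apply, ← e, ← e']; ring
  add_mem' := by
    rintro f g ⟨N, Q, hQ, e⟩ ⟨M, R, hR, e'⟩
    refine ⟨N + M, fun u => Q u * h u ^ M + R u * h u ^ N,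
      fun u => ((hQ u).mul ((hh u).pow M)).add ((hR u).mul ((hh u).pow N)), fun u => ?_⟩
    simp only [Pi.add_apply, ← e, ← e']; ring
  algebraMap_mem' := by
    intro r
    exact ⟨0, fun _ => r, fun u => analyticAt_const, fun u => by simp⟩

variable {h : E → ℂ} {hh : ∀ u, AnalyticAt ℂ h u}

lemma MSub.domain (h0 : ∃ u, h u ≠ 0) : IsDomain (MSub h hh) := by
  have : Nontrivial (MSub h hh) := by
    obtain ⟨u, hu⟩ := h0
    refine ⟨⟨0, 1, fun e => ?_⟩⟩
    have := congrArg (fun f : MSub h hh => f.1 ⟨u, hu⟩) e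
    simp at this
  have : NoZeroDivisors (MSub h hh) := by
    refine ⟨?_⟩
    rintro ⟨f, N, Q, hQ, e⟩ ⟨g, M, R, hR, e'⟩ hfg
    by_contra hne
    push Not at hne
    obtain ⟨hf, hg⟩ := hne
    have key : ∀ (f : {u : E // h u ≠ 0} → ℂ) (N : ℕ) (Q : E → ℂ),
        (∀ u : {u : E // h u ≠ 0}, f u * h u ^ N = Q u) → f ≠ 0 → ∃ u, Q u ≠ 0 := by
      intro f N Q e hf
      obtain ⟨u, hu⟩ := Function.ne_iff.1 hf
      exact ⟨u, by rw [← e]; exact mul_ne_zero hu (pow_ne_zero _ u.2)⟩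
    have hf1 := key f N Q e (fun h => hf (Subtype.ext h))
    have hg1 := key g M R e' (fun h => hg (Subtype.ext h))
    have d1 := dense_ne Q hQ hf1
    have d2 := dense_ne R hR hg1
    have d3 := dense_ne h hh h0
    have d4 := (d1.inter_of_isOpen_left d2 (isOpen_hne Q hQ)).inter_of_isOpen_left d3
      ((isOpen_hne Q hQ).inter (isOpen_hne R hR))
    obtain ⟨u, ⟨hu1, hu2⟩, hu3⟩ := d4.nonempty
    have := congrFun (congrArg Subtype.val hfg) ⟨u, hu3⟩
    change f ⟨u, hu3⟩ * g ⟨u, hu3⟩ = 0 at this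
    have a1 := e ⟨u, hu3⟩
    have a2 := e' ⟨u, hu3⟩
    rcases mul_eq_zero.1 this with h | h
    · rw [h, zero_mul] at a1; exact hu1 a1.symm
    · rw [h, zero_mul] at a2; exact hu2 a2.symm
  exact NoZeroDivisors.to_isDomain _

/-- evaluation at a point -/
def MSub.ev (u : {u : E // h u ≠ 0}) : MSub h hh →ₐ[ℂ] ℂ :=
  (Pi.evalAlgHom ℂ (fun _ : {u : E // h u ≠ 0} => ℂ) u).comp (MSub h hh).val

lemma MSub.ev_apply (u : {u : E // h u ≠ 0}) (f : MSub h hh) : MSub.ev u f = f.1 u := rfl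

lemma MSub.ext_ev {f g : MSub h hh} (e : ∀ u, MSub.ev u f = MSub.ev u g) : f = g :=
  Subtype.ext (funext e)

lemma MSub.ev_aeval {σ : Type*} (u : {u : E // h u ≠ 0}) (f : σ → MSub h hh)
    (p : MvPolynomial σ ℂ) : MSub.ev u (aeval f p) = eval (fun i => MSub.ev u (f i)) p := by
  rw [comp_aeval_apply, ← MvPolynomial.coe_aeval_eq_eval]; rfl

open Classical in
/-- extension by zero -/
noncomputable def MSub.zext (f : {u : E // h u ≠ 0} → ℂ) (x : E) : ℂ :=
  if hx : h x ≠ 0 then f ⟨x, hx⟩ else 0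

lemma MSub.zext_of (f : {u : E // h u ≠ 0} → ℂ) {x : E} (hx : h x ≠ 0) :
    MSub.zext f x = f ⟨x, hx⟩ := dif_pos hx

lemma MSub.zext_eventually (hh : ∀ u, AnalyticAt ℂ h u) (f : {u : E // h u ≠ 0} → ℂ) (F : E → ℂ)
    (hF : ∀ u : {u : E // h u ≠ 0}, f u = F u) {x : E} (hx : h x ≠ 0) :
    MSub.zext f =ᶠ[𝓝 x] F := by
  filter_upwards [(isOpen_hne h hh).mem_nhds hx] with y hy
  rw [MSub.zext_of f hy, hF]

lemma MSub.zext_analytic (f : MSub h hh) {x : E} (hx : h x ≠ 0) :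
    AnalyticAt ℂ (MSub.zext f.1) x := by
  obtain ⟨f, N, Q, hQ, e⟩ := f
  have : MSub.zext f =ᶠ[𝓝 x] fun y => Q y / h y ^ N := by
    refine MSub.zext_eventually hh f _ (fun u => ?_) hx
    rw [← e, mul_div_cancel_right₀ _ (pow_ne_zero _ u.2)]
  exact ((hQ x).div ((hh x).pow N) (pow_ne_zero _ hx)).congr this.symm

/-- directional derivative -/
noncomputable def MSub.dirFun (e : E) (f : MSub h hh) : MSub h hh :=
  ⟨fun u => fderiv ℂ (MSub.zext f.1) u e, by
    have hf := fun x hx => MSub.zext_analytic f (x := x) hx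
    obtain ⟨f, N, Q, hQ, e'⟩ := f
    refine ⟨2 * N, fun x => h x ^ N * fderiv ℂ Q x e - Q x * fderiv ℂ (fun y => h y ^ N) x e,
      fun u => ?_, fun u => ?_⟩
    · have key : ∀ F : E → ℂ, (∀ u, AnalyticAt ℂ F u) → ∀ u, AnalyticAt ℂ (fun x => fderiv ℂ F x e) u := by
        intro F hF u
        exact (ContinuousLinearMap.analyticAt (ContinuousLinearMap.apply ℂ ℂ e) _).comp (hF u).fderiv
      exact (((hh u).pow N).mul (key Q hQ u)).sub ((hQ u).mul (key _ (fun u => (hh u).pow N) u))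
    · have hev : (fun x => MSub.zext f x * h x ^ N) =ᶠ[𝓝 (u : E)] Q := by
        filter_upwards [(isOpen_hne h hh).mem_nhds u.2] with y hy
        rw [MSub.zext_of f hy]; exact e' ⟨y, hy⟩
      have h1 := hev.fderiv_eq (𝕜 := ℂ)
      have h2 := fderiv_fun_mul (c := MSub.zext f) (d := fun y => h y ^ N)
        (hf u u.2).differentiableAt ((hh u).pow N).differentiableAt
      rw [h2] at h1
      have h3 := congrArg (fun L => L e) h1
      simp only [ContinuousLinearMap.add_apply, ContinuousLinearMap.smul_apply, smul_eq_mul] at h3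
      have h4 := e' u
      have h5 : MSub.zext f u = f u := MSub.zext_of f u.2
      rw [h5] at h3
      change fderiv ℂ (MSub.zext f) u e * h u ^ (2 * N) =
        h u ^ N * fderiv ℂ Q u e - Q u * fderiv ℂ (fun y => h y ^ N) u e
      rw [← h3, ← h4]
      ring⟩

lemma MSub.dirFun_ev (e : E) (f : MSub h hh) (u : {u : E // h u ≠ 0}) :
    MSub.ev u (MSub.dirFun e f) = fderiv ℂ (MSub.zext f.1) u e := rfl

lemma MSub.dirFun_ev_of (e : E) (f : MSub h hh) (u : {u : E // h u ≠ 0}) (F : E → ℂ)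
    (hF : ∀ u, MSub.ev u f = F u) :
    MSub.ev u (MSub.dirFun e f) = fderiv ℂ F u e := by
  rw [MSub.dirFun_ev, (MSub.zext_eventually hh f.1 F hF u.2).fderiv_eq]

/-- directional derivation -/
noncomputable def MSub.der (e : E) : Derivation ℂ (MSub h hh) (MSub h hh) :=
  Derivation.mk' { toFun := MSub.dirFun e
                   map_add' := by
                     intro f g
                     refine MSub.ext_ev fun u => ?_
                     rw [map_add, MSub.dirFun_ev_of e (f + g) u (fun x => MSub.zext f.1 x + MSub.zext g.1 x),
                       fderiv_fun_add (MSub.zext_analytic f u.2).differentiableAt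
                        (MSub.zext_analytic g u.2).differentiableAt]
                     · rfl
                     · intro u; rw [map_add, MSub.zext_of _ u.2, MSub.zext_of _ u.2]; rfl
                   map_smul' := by
                     intro a f
                     refine MSub.ext_ev fun u => ?_
                     rw [RingHom.id_apply, map_smul, MSub.dirFun_ev_of e (a • f) u (fun x => a • MSub.zext f.1 x),
                       fderiv_fun_const_smul (MSub.zext_analytic f u.2).differentiableAt]
                     · rfl
                     · intro u; rw [map_smul, MSub.zext_of _ u.2]; rfl }
    (by
      intro f g
      refine MSub.ext_ev fun u => ?_
      change MSub.ev u (MSub.dirFun e (f * g)) = MSub.ev u (f * MSub.dirFun e g + g * MSub.dirFun e f)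
      rw [map_add, map_mul, map_mul, MSub.dirFun_ev_of e (f * g) u (fun x => MSub.zext f.1 x * MSub.zext g.1 x),
        fderiv_fun_mul (MSub.zext_analytic f u.2).differentiableAt
                        (MSub.zext_analytic g u.2).differentiableAt]
      · rw [MSub.zext_of _ u.2, MSub.zext_of _ u.2]; rfl
      · intro u; rw [map_mul, MSub.zext_of _ u.2, MSub.zext_of _ u.2]; rfl)

lemma MSub.der_ev_of (e : E) (f : MSub h hh) (u : {u : E // h u ≠ 0}) (F : E → ℂ)
    (hF : ∀ u, MSub.ev u f = F u) :
    MSub.ev u (MSub.der e f) = fderiv ℂ F u e := MSub.dirFun_ev_of e f u F hF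

/-- basic element `g / h` -/
noncomputable def MSub.frac (g : E → ℂ) (hg : ∀ u, AnalyticAt ℂ g u) : MSub h hh :=
  ⟨fun u => g u / h u, 1, g, hg, fun u => by rw [pow_one, div_mul_cancel₀ _ u.2]⟩

lemma MSub.frac_ev (g : E → ℂ) (hg : ∀ u, AnalyticAt ℂ g u) (u : {u : E // h u ≠ 0}) :
    MSub.ev u (MSub.frac g hg : MSub h hh) = g u / h u := rfl

end MRing

lemma ball_image {n : ℕ} (h : (Fin n → ℂ) → ℂ) (f : Fin n → (Fin n → ℂ) → ℂ)
    (hh : ∀ u, AnalyticAt ℂ h u) (hf : ∀ u, h u ≠ 0 → ∀ k, AnalyticAt ℂ (f k) u)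
    (u0 : Fin n → ℂ) (hu0 : h u0 ≠ 0)
    (hdet : Matrix.det (Matrix.of fun k p => fderiv ℂ (f k) u0 (Pi.single p 1)) ≠ 0) :
    ∃ (x0 : Fin n → ℂ) (r : ℝ), 0 < r ∧ ∀ x : Fin n → ℂ, (∀ k, x k ∈ Metric.ball (x0 k) r) →
      ∃ u, h u ≠ 0 ∧ (fun k => f k u) = x := by
  set J := Matrix.of fun k p => fderiv ℂ (f k) u0 (Pi.single p 1) with hJ
  have hs : HasStrictFDerivAt (fun u k => f k u) (ContinuousLinearMap.pi fun k => fderiv ℂ (f k) u0) u0 :=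
    hasStrictFDerivAt_pi.2 fun k => (hf u0 hu0 k).hasStrictFDerivAt
  have hsurj : (ContinuousLinearMap.pi fun k => fderiv ℂ (f k) u0).range = ⊤ := by
    rw [LinearMap.range_eq_top]
    intro y
    refine ⟨J⁻¹.mulVec y, ?_⟩
    have hL : ∀ v k, fderiv ℂ (f k) u0 v = (J.mulVec v) k := by
      intro v k
      conv_lhs => rw [pi_eq_sum_univ' v]
      rw [map_sum]
      simp only [map_smul, Matrix.mulVec, dotProduct, hJ, Matrix.of_apply, smul_eq_mul]
      refine Finset.sum_congr rfl fun p _ => ?_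
      rw [mul_comm]
    funext k
    change fderiv ℂ (f k) u0 _ = _
    rw [hL, Matrix.mulVec_mulVec, Matrix.mul_nonsing_inv _ (isUnit_iff_ne_zero.2 hdet), Matrix.one_mulVec]
  have hmap := hs.map_nhds_eq_of_surj hsurj
  have hmem : (fun u k => f k u) '' {u | h u ≠ 0} ∈ 𝓝 (fun k => f k u0) := by
    rw [← hmap]
    exact image_mem_map ((isOpen_hne h hh).mem_nhds hu0)
  obtain ⟨r, hr, hb⟩ := Metric.mem_nhds_iff.1 hmem
  refine ⟨fun k => f k u0, r, hr, fun x hx => ?_⟩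
  obtain ⟨u, hu, e⟩ := hb (show x ∈ Metric.ball (fun k => f k u0) r from (dist_pi_lt_iff hr).2 hx)
  exact ⟨u, hu, e⟩

lemma ball_infinite (x : ℂ) {r : ℝ} (hr : 0 < r) : (Metric.ball x r).Infinite := by
  exact infinite_of_mem_nhds x (Metric.ball_mem_nhds x hr)

lemma inj1 {n : ℕ} {h : (Fin n → ℂ) → ℂ} {f : Fin n → (Fin n → ℂ) → ℂ} {x0 : Fin n → ℂ} {r : ℝ}
    (hr : 0 < r) (hb : ∀ x : Fin n → ℂ, (∀ k, x k ∈ Metric.ball (x0 k) r) →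
      ∃ u, h u ≠ 0 ∧ (fun k => f k u) = x) (p : MvPolynomial (Fin n) ℂ)
    (hp : ∀ u, h u ≠ 0 → eval (fun k => f k u) p = 0) : p = 0 := by
  refine funext_set (fun k => Metric.ball (x0 k) r) (fun k => ball_infinite _ hr) fun x hx => ?_
  obtain ⟨u, hu, e⟩ := hb x fun k => hx k (Set.mem_univ _)
  rw [← e, hp u hu, map_zero]

lemma inj2 {n : ℕ} {h : (Fin n → ℂ) → ℂ} {f : Fin n → (Fin n → ℂ) → ℂ} {x0 : Fin n → ℂ} {r : ℝ}
    (hr : 0 < r) (hb : ∀ x : Fin n → ℂ, (∀ k, x k ∈ Metric.ball (x0 k) r) →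
      ∃ u, h u ≠ 0 ∧ (fun k => f k u) = x) (p : MvPolynomial (Fin n ⊕ Fin n) ℂ)
    (hp : ∀ u v, h u ≠ 0 → h v ≠ 0 → eval (Sum.elim (fun k => f k u) (fun k => f k v)) p = 0) :
    p = 0 := by
  refine funext_set (fun k => Metric.ball (Sum.elim x0 x0 k) r) (fun k => ball_infinite _ hr)
    fun x hx => ?_
  obtain ⟨u, hu, e⟩ := hb (fun k => x (Sum.inl k)) fun k => hx (Sum.inl k) (Set.mem_univ _)
  obtain ⟨v, hv, e'⟩ := hb (fun k => x (Sum.inr k)) fun k => hx (Sum.inr k) (Set.mem_univ _)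
  have : x = Sum.elim (fun k => f k u) (fun k => f k v) := by
    rw [e, e']; funext i; cases i <;> rfl
  rw [this, hp u v hu hv, map_zero]

lemma alg_add {S : Type*} [CommRing S] [IsDomain S] [Algebra ℂ S] {τ κ : Type*} [Fintype κ]
    (x : τ → S) (hx : ∀ p : MvPolynomial τ ℂ, aeval x p = 0 → p = 0)
    (s : Option κ → S) (hs : ∀ p : MvPolynomial κ ℂ, aeval (fun k => s (some k)) p = 0 → p = 0)
    (G : κ → MvPolynomial (Option τ) ℂ) (hG0 : ∀ k, G k ≠ 0)
    (hG : ∀ k, aeval (fun i : Option τ => i.elim (s (some k)) x) (G k) = 0)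
    (V : MvPolynomial (Option κ) ℂ) (hV0 : V ≠ 0) (hV : aeval s V = 0) :
    ∃ d : MvPolynomial τ ℂ, d ≠ 0 ∧ ∀ i, ∃ P : Polynomial (MvPolynomial τ ℂ), P.Monic ∧
      Polynomial.eval₂ (aeval x : MvPolynomial τ ℂ →ₐ[ℂ] S).toRingHom (aeval x d * s i) P = 0 := by
  letI : Algebra (MvPolynomial τ ℂ) S := (aeval x : MvPolynomial τ ℂ →ₐ[ℂ] S).toRingHom.toAlgebra
  have halg : ∀ p, algebraMap (MvPolynomial τ ℂ) S p = aeval x p := fun p => rfl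
  have h1 : ∀ k, IsAlgebraic (MvPolynomial τ ℂ) (s (some k)) := fun k =>
    isAlg_none (T := MvPolynomial τ ℂ) (f := fun i : Option τ => i.elim (s (some k)) x)
      hx (fun p => ⟨p, rfl⟩) (G k) (hG0 k) (hG k)
  have h2 : IsAlgebraic (Subalgebra.algebraicClosure (MvPolynomial τ ℂ) S) (s none) := by
    refine isAlg_none (f := s) hs (fun p => ?_) V hV0 hV
    suffices hm : aeval (fun k => s (some k)) p ∈ Subalgebra.algebraicClosure (MvPolynomial τ ℂ) S from
      ⟨⟨_, hm⟩, rfl⟩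
    induction p using MvPolynomial.induction_on with
    | C a =>
      have : aeval (fun k => s (some k)) (C a) = algebraMap (MvPolynomial τ ℂ) S (C a) := by
        rw [halg, aeval_C, aeval_C]
      rw [this]; exact Subalgebra.algebraMap_mem _ _
    | add p q hp hq => rw [map_add]; exact add_mem hp hq
    | mul_X p k hp => rw [map_mul, aeval_X]; exact mul_mem hp (h1 k)
  have h3 : ∀ i, IsAlgebraic (MvPolynomial τ ℂ) (s i) := by
    rintro (_ | k)
    · exact h2.restrictScalars (MvPolynomial τ ℂ)
    · exact h1 k
  choose y hy0 hy using fun i => (h3 i).exists_integral_multiple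
  refine ⟨∏ i, y i, Finset.prod_ne_zero_iff.2 fun i _ => hy0 i, fun i => ?_⟩
  classical
  have h4 : IsIntegral (MvPolynomial τ ℂ) (aeval x (∏ i, y i) * s i) := by
    have := (hy i).smul (∏ j ∈ Finset.univ.erase i, y j)
    rw [smul_smul, mul_comm, Finset.mul_prod_erase _ _ (Finset.mem_univ i), Algebra.smul_def, halg] at this
    exact this
  exact h4

lemma ev_eval2 {E : Type*} [NormedAddCommGroup E] [NormedSpace ℂ E] {h : E → ℂ}
    {hh : ∀ u, AnalyticAt ℂ h u} {σ : Type*} (u : {u : E // h u ≠ 0}) (f : σ → MSub h hh)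
    (z : MSub h hh) (P : Polynomial (MvPolynomial σ ℂ))
    (hP : Polynomial.eval₂ (aeval f : MvPolynomial σ ℂ →ₐ[ℂ] MSub h hh).toRingHom z P = 0) :
    Polynomial.eval (MSub.ev u z) (P.map (eval fun i => MSub.ev u (f i))) = 0 := by
  have := congrArg (MSub.ev u).toRingHom hP
  rw [Polynomial.hom_eval₂, map_zero] at this
  rw [Polynomial.eval_map]
  refine Eq.trans ?_ this
  have e : (eval fun i => MSub.ev u (f i)) = (MSub.ev u).toRingHom.comp
      (aeval f : MvPolynomial σ ℂ →ₐ[ℂ] MSub h hh).toRingHom := by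
    refine RingHom.ext fun p => ?_
    exact (MSub.ev_aeval u f p).symm
  rw [e]; rfl

lemma partA {n : ℕ} (h : (Fin n → ℂ) → ℂ) (g : Option (Fin n) → (Fin n → ℂ) → ℂ)
    (hh : ∀ u, AnalyticAt ℂ h u) (hg : ∀ i u, AnalyticAt ℂ (g i) u) (u0 : Fin n → ℂ) (hu0 : h u0 ≠ 0)
    (hdet : Matrix.det (Matrix.of fun k p =>
      fderiv ℂ (fun x => g (some k) x / h x) u0 (Pi.single p 1)) ≠ 0)
    (hinj : ∀ p : MvPolynomial (Fin n) ℂ,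
      (∀ u, h u ≠ 0 → eval (fun k => g (some k) u / h u) p = 0) → p = 0)
    (V : MvPolynomial (Option (Fin n)) ℂ) (hV0 : V ≠ 0)
    (hV : ∀ u, h u ≠ 0 → eval (fun i => g i u / h u) V = 0)
    (A B : Fin n → Fin n → MvPolynomial (Option (Fin n)) ℂ)
    (hB : ∀ k p, ∃ u, h u ≠ 0 ∧ eval (fun i => g i u / h u) (B k p) ≠ 0)
    (hAB : ∀ k p u, h u ≠ 0 → eval (fun i => g i u / h u) (B k p) ≠ 0 →
      fderiv ℂ (fun x => g (some k) x / h x) u (Pi.single p 1) =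
        eval (fun i => g i u / h u) (A k p) / eval (fun i => g i u / h u) (B k p)) :
    ∃ c : MvPolynomial (Fin n) ℂ, c ≠ 0 ∧ ∃ (W : Option (Fin n) → Fin n → MvPolynomial (Option (Fin n)) ℂ)
      (M : Fin n → Fin n → MvPolynomial (Option (Fin n)) ℂ) (Pm : Polynomial (MvPolynomial (Fin n) ℂ)),
      Pm.Monic ∧
      (∀ u, h u ≠ 0 → ∀ i p, eval (px fun i => g i u / h u) c *
        fderiv ℂ (fun x => g i x / h x) u (Pi.single p 1) = eval (fun i => g i u / h u) (W i p)) ∧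
      (∀ u, h u ≠ 0 → ∀ k l, ∑ p, eval (fun i => g i u / h u) (W (some k) p) *
        eval (fun i => g i u / h u) (M p l) = if k = l then eval (px fun i => g i u / h u) c ^ 2 else 0) ∧
      (∀ u, h u ≠ 0 → Polynomial.eval (eval (px fun i => g i u / h u) c * (g none u / h u))
        (Pm.map (eval (px fun i => g i u / h u))) = 0) := by
  haveI : IsDomain (MSub h hh) := MSub.domain ⟨u0, hu0⟩
  set f : Option (Fin n) → MSub h hh := fun i => MSub.frac (g i) (hg i) with hf
  set D : Fin n → Derivation ℂ (MSub h hh) (MSub h hh) := fun p => MSub.der (Pi.single p 1) with hD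
  have ef : ∀ (u : {u : Fin n → ℂ // h u ≠ 0}) p, MSub.ev u (aeval f p) = eval (fun i => g i u / h u) p :=
    fun u p => MSub.ev_aeval u f p
  have ef' : ∀ (u : {u : Fin n → ℂ // h u ≠ 0}) p, MSub.ev u (aeval (fun k => f (some k)) p) =
      eval (px fun i => g i u / h u) p :=
    fun u p => MSub.ev_aeval u (fun k => f (some k)) p
  have eD : ∀ (u : {u : Fin n → ℂ // h u ≠ 0}) p i, MSub.ev u (D p (f i)) =
      fderiv ℂ (fun x => g i x / h x) u (Pi.single p 1) :=
    fun u p i => MSub.der_ev_of _ (f i) u _ fun u => rfl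
  have hB' : ∀ k p, aeval f (B k p) ≠ 0 := by
    intro k p e
    obtain ⟨u, hu, hne⟩ := hB k p
    apply hne
    rw [← ef ⟨u, hu⟩, e, map_zero]
  obtain ⟨c, hc, W, M, Pm, hPm, H1, H2, H3⟩ := alg_core (f := f) (fun p hp => hinj p fun u hu => by
      have := ef' ⟨u, hu⟩ p
      rw [hp, map_zero] at this; exact this.symm) V hV0
    (MSub.ext_ev fun u => by rw [ef, map_zero, hV u u.2]) D A B hB' (fun k p => by
      refine sub_eq_zero.1 ((mul_eq_zero.1 ?_).resolve_left (hB' k p))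
      refine MSub.ext_ev fun u => ?_
      rw [map_mul, map_sub, map_mul, ef, ef, eD, map_zero]
      by_cases hb : eval (fun i => g i u / h u) (B k p) = 0
      · rw [hb, zero_mul]
      · rw [hAB k p u u.2 hb]; field_simp; ring) (fun e => by
      apply hdet
      have := congrArg (MSub.ev (⟨u0, hu0⟩ : {u : Fin n → ℂ // h u ≠ 0})) e
      rw [map_zero, AlgHom.map_det] at this
      rw [← this]
      congr 1
      ext k p
      simp only [AlgHom.mapMatrix_apply, Matrix.map_apply, Matrix.of_apply]
      exact (eD ⟨u0, hu0⟩ p (some k)).symm)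
  refine ⟨c, hc, W, M, Pm, hPm, fun u hu i p => ?_, fun u hu k l => ?_, fun u hu => ?_⟩
  · have := congrArg (MSub.ev (⟨u, hu⟩ : {u : Fin n → ℂ // h u ≠ 0})) (H1 i p)
    rwa [map_mul, ef, ef', eD] at this
  · have := congrArg (MSub.ev (⟨u, hu⟩ : {u : Fin n → ℂ // h u ≠ 0})) (H2 k l)
    rw [map_sum, apply_ite (MSub.ev (⟨u, hu⟩ : {u : Fin n → ℂ // h u ≠ 0})), map_pow, ef', map_zero] at this
    rw [← this]
    refine Finset.sum_congr rfl fun p _ => ?_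
    rw [map_mul, ef, ef]
  · have := ev_eval2 ⟨u, hu⟩ _ _ _ H3
    rw [map_mul, ef'] at this
    exact this

lemma exists_split {n : ℕ} {h : (Fin n → ℂ) → ℂ} (hh : ∀ u, AnalyticAt ℂ h u)
    {u : Fin n → ℂ} (hu : h u ≠ 0) : ∃ v, h (u - v) ≠ 0 ∧ h v ≠ 0 := by
  have d1 := dense_ne h hh ⟨u, hu⟩
  have a2 : ∀ v, AnalyticAt ℂ (fun v => h (u - v)) v := fun v =>
    AnalyticAt.fun_comp (g := h) (hh _) (analyticAt_const.sub analyticAt_id)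
  have d2 := dense_ne (fun v => h (u - v)) a2 ⟨0, by simpa using hu⟩
  obtain ⟨v, hv1, hv2⟩ := (d2.inter_of_isOpen_left d1 (isOpen_hne _ a2)).nonempty
  exact ⟨v, hv1, hv2⟩

lemma partB {n : ℕ} (h : (Fin n → ℂ) → ℂ) (g : Option (Fin n) → (Fin n → ℂ) → ℂ)
    (hh : ∀ u, AnalyticAt ℂ h u) (hg : ∀ i u, AnalyticAt ℂ (g i) u) (u0 : Fin n → ℂ) (hu0 : h u0 ≠ 0)
    (hinj : ∀ p : MvPolynomial (Fin n) ℂ,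
      (∀ u, h u ≠ 0 → eval (fun k => g (some k) u / h u) p = 0) → p = 0)
    (hinj2 : ∀ p : MvPolynomial (Fin n ⊕ Fin n) ℂ,
      (∀ u v, h u ≠ 0 → h v ≠ 0 →
        eval (Sum.elim (fun k => g (some k) u / h u) (fun k => g (some k) v / h v)) p = 0) → p = 0)
    (V : MvPolynomial (Option (Fin n)) ℂ) (hV0 : V ≠ 0)
    (hV : ∀ u, h u ≠ 0 → eval (fun i => g i u / h u) V = 0)
    (G : Fin n → MvPolynomial (Option (Fin n ⊕ Fin n)) ℂ) (hG0 : ∀ k, G k ≠ 0)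
    (hG : ∀ k u v, h u ≠ 0 → h v ≠ 0 → h (u + v) ≠ 0 →
      eval (fun i => i.elim (g (some k) (u + v) / h (u + v))
        (Sum.elim (fun k => g (some k) u / h u) (fun k => g (some k) v / h v))) (G k) = 0) :
    ∃ d : MvPolynomial (Fin n ⊕ Fin n) ℂ, d ≠ 0 ∧ ∃ (C : ℝ) (N : ℕ),
      ∀ u v, h u ≠ 0 → h v ≠ 0 → h (u + v) ≠ 0 → ∀ i,
        ‖eval (Sum.elim (px fun i => g i u / h u) (px fun i => g i v / h v)) d *
          (g i (u + v) / h (u + v))‖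
        ≤ C * (1 + ‖px fun i => g i u / h u‖ + ‖px fun i => g i v / h v‖) ^ N := by
  have a1 : ∀ F : (Fin n → ℂ) → ℂ, (∀ u, AnalyticAt ℂ F u) →
      ∀ q : (Fin n → ℂ) × (Fin n → ℂ), AnalyticAt ℂ (fun q : (Fin n → ℂ) × (Fin n → ℂ) => F q.1) q :=
    fun F hF q => AnalyticAt.fun_comp (g := F) (hF _) analyticAt_fst
  have a2 : ∀ F : (Fin n → ℂ) → ℂ, (∀ u, AnalyticAt ℂ F u) →
      ∀ q : (Fin n → ℂ) × (Fin n → ℂ), AnalyticAt ℂ (fun q : (Fin n → ℂ) × (Fin n → ℂ) => F q.2) q :=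
    fun F hF q => AnalyticAt.fun_comp (g := F) (hF _) analyticAt_snd
  have a3 : ∀ F : (Fin n → ℂ) → ℂ, (∀ u, AnalyticAt ℂ F u) →
      ∀ q : (Fin n → ℂ) × (Fin n → ℂ), AnalyticAt ℂ (fun q : (Fin n → ℂ) × (Fin n → ℂ) => F (q.1 + q.2)) q :=
    fun F hF q => AnalyticAt.fun_comp (g := F) (hF _) (analyticAt_fst.add analyticAt_snd)
  set h2 : (Fin n → ℂ) × (Fin n → ℂ) → ℂ := fun q => h q.1 * h q.2 * h (q.1 + q.2) with hh2d
  have hh2 : ∀ q, AnalyticAt ℂ h2 q := fun q => ((a1 h hh q).mul (a2 h hh q)).mul (a3 h hh q)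
  have hq : ∀ q, h2 q ≠ 0 → h q.1 ≠ 0 ∧ h q.2 ≠ 0 ∧ h (q.1 + q.2) ≠ 0 := by
    intro q hq
    simp only [hh2d, ne_eq, mul_eq_zero, not_or] at hq
    exact ⟨hq.1.1, hq.1.2, hq.2⟩
  have hq' : ∀ u v, h u ≠ 0 → h v ≠ 0 → h (u + v) ≠ 0 → h2 (u, v) ≠ 0 := fun u v a b c =>
    mul_ne_zero (mul_ne_zero a b) c
  have h20 : ∃ q, h2 q ≠ 0 := by
    obtain ⟨v, h1, h3⟩ := exists_split hh hu0
    exact ⟨(u0 - v, v), hq' _ _ h1 h3 (by simpa using hu0)⟩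
  haveI : IsDomain (MSub h2 hh2) := MSub.domain h20
  set x : Fin n ⊕ Fin n → MSub h2 hh2 := Sum.elim
    (fun k => ⟨fun q => g (some k) q.1.1 / h q.1.1, 1, fun q => g (some k) q.1 * h q.2 * h (q.1 + q.2),
      fun q => ((a1 _ (hg _) q).mul (a2 h hh q)).mul (a3 h hh q), fun q => by
        have := (hq _ q.2).1
        simp only [hh2d]; field_simp⟩)
    (fun k => ⟨fun q => g (some k) q.1.2 / h q.1.2, 1, fun q => h q.1 * g (some k) q.2 * h (q.1 + q.2),
      fun q => ((a1 h hh q).mul (a2 _ (hg _) q)).mul (a3 h hh q), fun q => by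
        have := (hq _ q.2).2.1
        simp only [hh2d]; field_simp⟩) with hx
  set s : Option (Fin n) → MSub h2 hh2 := fun i =>
    ⟨fun q => g i (q.1.1 + q.1.2) / h (q.1.1 + q.1.2), 1, fun q => h q.1 * h q.2 * g i (q.1 + q.2),
      fun q => ((a1 h hh q).mul (a2 _ hh q)).mul (a3 _ (hg i) q), fun q => by
        have := (hq _ q.2).2.2
        simp only [hh2d]; field_simp⟩ with hs
  have ex : ∀ q : {q // h2 q ≠ 0}, (fun j => MSub.ev q (x j)) =
      Sum.elim (fun k => g (some k) q.1.1 / h q.1.1) (fun k => g (some k) q.1.2 / h q.1.2) := by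
    intro q; funext j; cases j <;> rfl
  have es : ∀ (q : {q // h2 q ≠ 0}) i, MSub.ev q (s i) = g i (q.1.1 + q.1.2) / h (q.1.1 + q.1.2) :=
    fun q i => rfl
  obtain ⟨d, hd0, hP⟩ := alg_add x (fun p hp => by
      refine hinj2 p fun u v hu hv => ?_
      by_contra hne
      have hc : ContinuousAt (fun q : (Fin n → ℂ) × (Fin n → ℂ) =>
          eval (Sum.elim (fun k => g (some k) q.1 / h q.1) (fun k => g (some k) q.2 / h q.2)) p) (u, v) := by
        refine ContinuousAt.comp' (g := fun y => eval y p) (analyticAt_eval p _).continuousAt ?_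
        refine continuousAt_pi.2 fun j => ?_
        cases j with
        | inl k => exact ((a1 _ (hg _) _).div (a1 h hh _) hu).continuousAt
        | inr k => exact ((a2 _ (hg _) _).div (a2 h hh _) hv).continuousAt
      have hev := hc.eventually_ne hne
      obtain ⟨q, hq1, hq2⟩ := ((dense_ne h2 hh2 h20).inter_nhds_nonempty hev)
      apply hq2
      have := MSub.ev_aeval (⟨q, hq1⟩ : {q // h2 q ≠ 0}) x p
      rw [hp, map_zero, ex] at this
      exact this.symm) s (fun p hp => by
      refine hinj p fun u hu => ?_
      obtain ⟨v, h1, h3⟩ := exists_split hh hu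
      have := MSub.ev_aeval (⟨(u - v, v), hq' _ _ h1 h3 (by simpa using hu)⟩ : {q // h2 q ≠ 0})
        (fun k => s (some k)) p
      rw [hp, map_zero] at this
      simp only [es, sub_add_cancel] at this
      exact this.symm) G hG0 (fun k => by
      refine MSub.ext_ev fun q => ?_
      obtain ⟨b1, b2, b3⟩ := hq _ q.2
      rw [MSub.ev_aeval, map_zero]
      refine Eq.trans ?_ (hG k q.1.1 q.1.2 b1 b2 b3)
      congr 1
      congr 1
      funext i
      cases i with
      | none => rfl
      | some j => cases j <;> rfl) V hV0 (by
      refine MSub.ext_ev fun q => ?_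
      obtain ⟨b1, b2, b3⟩ := hq _ q.2
      rw [MSub.ev_aeval, map_zero]
      exact hV _ b3)
  choose P hPm hPe using hP
  choose Ci hC0 Ni hCN using fun i => monic_bound (P i) (hPm i)
  refine ⟨d, hd0, ∑ i, Ci i, ∑ i, Ni i, fun u v hu hv huv i => ?_⟩
  have e := ev_eval2 (⟨(u, v), hq' u v hu hv huv⟩ : {q // h2 q ≠ 0}) _ _ _ (hPe i)
  rw [map_mul, MSub.ev_aeval, ex] at e
  refine (hCN i _ _ e).trans ?_
  have b0 : ‖Sum.elim (fun k => g (some k) u / h u) (fun k => g (some k) v / h v)‖ ≤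
      ‖px fun i => g i u / h u‖ + ‖px fun i => g i v / h v‖ := by
    refine (pi_norm_le_iff_of_nonneg (by positivity)).2 fun j => ?_
    cases j with
    | inl k =>
      exact (norm_le_pi_norm (px fun i => g i u / h u) k).trans (le_add_of_nonneg_right (norm_nonneg _))
    | inr k =>
      exact (norm_le_pi_norm (px fun i => g i v / h v) k).trans (le_add_of_nonneg_left (norm_nonneg _))
  have b1 : Ci i ≤ ∑ i, Ci i := Finset.single_le_sum (fun i _ => hC0 i) (Finset.mem_univ i)
  have b2 : Ni i ≤ ∑ i, Ni i := Finset.single_le_sum (fun i _ => Nat.zero_le _) (Finset.mem_univ i)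
  calc Ci i * (1 + ‖Sum.elim (fun k => g (some k) u / h u) (fun k => g (some k) v / h v)‖) ^ Ni i
      ≤ (∑ i, Ci i) * (1 + ‖px fun i => g i u / h u‖ + ‖px fun i => g i v / h v‖) ^ Ni i := by
        refine mul_le_mul b1 (pow_le_pow_left₀ (by positivity) (by linarith) _) (by positivity)
          ((hC0 i).trans b1)
    _ ≤ _ := by
        have : 0 ≤ ∑ i, Ci i := (hC0 i).trans b1
        gcongr
        have := norm_nonneg (px fun i => g i u / h u)
        have := norm_nonneg (px fun i => g i v / h v)
        linarith

lemma pd_analytic {n : ℕ} {f : (Fin n → ℂ) → ℂ} {u : Fin n → ℂ} (hf : AnalyticAt ℂ f u) (p : Fin n) :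
    AnalyticAt ℂ (pd f p) u :=
  (ContinuousLinearMap.analyticAt (ContinuousLinearMap.apply ℂ ℂ (Pi.single p 1 : Fin n → ℂ)) _).comp
    hf.fderiv

lemma common_den {n : ℕ} (φ : Fin n → (Fin n → ℂ) → ℂ) (hmero : ∀ k, Mero (φ k))
    (θ : (Fin n → ℂ) → ℂ) (α : Fin n → Fin n → ℂ)
    (hθ : ∀ u, θ u = ∑ k : Fin n, ∑ p : Fin n, α k p * pd (φ k) p u) :
    ∃ (h : (Fin n → ℂ) → ℂ) (g : Option (Fin n) → (Fin n → ℂ) → ℂ),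
      (∀ u, AnalyticAt ℂ h u) ∧ (∀ i u, AnalyticAt ℂ (g i) u) ∧ (∃ u, h u ≠ 0) ∧
      ∀ u, h u ≠ 0 → ∀ i, tval θ φ u i = g i u / h u := by
  choose g h hg hh h0 e using hmero
  set P : (Fin n → ℂ) → ℂ := fun u => ∏ k, h k u with hP
  set G : Fin n → (Fin n → ℂ) → ℂ := fun k u => g k u * ∏ j ∈ Finset.univ.erase k, h j u with hG
  have aP : ∀ u, AnalyticAt ℂ P u := fun u => Finset.analyticAt_fun_prod _ fun k _ => hh k u
  have aG : ∀ k u, AnalyticAt ℂ (G k) u := fun k u =>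
    (hg k u).mul (Finset.analyticAt_fun_prod _ fun k _ => hh k u)
  have hPne : ∀ u, P u ≠ 0 → ∀ k, φ k u * P u = G k u := by
    intro u hu k
    have hk : h k u ≠ 0 := Finset.prod_ne_zero_iff.1 hu k (Finset.mem_univ _)
    simp only [hP, hG]
    rw [e k u hk, ← Finset.mul_prod_erase _ _ (Finset.mem_univ k)]
    field_simp
  have P0 : ∃ u, P u ≠ 0 := by
    have key : ∀ s : Finset (Fin n), ∃ u, ∏ k ∈ s, h k u ≠ 0 := by
      intro s
      induction s using Finset.induction_on with
      | empty => exact ⟨0, by simp⟩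
      | insert a s ha ih =>
        have d1 := dense_ne (h a) (hh a) (h0 a)
        have d2 := dense_ne _ (fun u => Finset.analyticAt_fun_prod s fun k _ => hh k u) ih
        obtain ⟨u, hu1, hu2⟩ := (d1.inter_of_isOpen_left d2 (isOpen_hne _ (hh a))).nonempty
        exact ⟨u, by rw [Finset.prod_insert ha]; exact mul_ne_zero hu1 hu2⟩
    exact key _
  have hφa : ∀ u, P u ≠ 0 → ∀ k, AnalyticAt ℂ (φ k) u := by
    intro u hu k
    refine ((aG k u).div (aP u) hu).congr ?_
    filter_upwards [(isOpen_hne P aP).mem_nhds hu] with y hy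
    exact (eq_div_of_mul_eq hy (hPne y hy k)).symm
  have hpd : ∀ u, P u ≠ 0 → ∀ k p, pd (φ k) p u * P u ^ 2 = pd (G k) p u * P u - G k u * pd P p u := by
    intro u hu k p
    have hev : (fun y => φ k y * P y) =ᶠ[𝓝 u] G k := by
      filter_upwards [(isOpen_hne P aP).mem_nhds hu] with y hy
      exact hPne y hy k
    have h1 := hev.fderiv_eq (𝕜 := ℂ)
    rw [fderiv_fun_mul (hφa u hu k).differentiableAt (aP u).differentiableAt] at h1
    have h3 := congrArg (fun L => L (Pi.single p 1)) h1
    simp only [ContinuousLinearMap.add_apply, ContinuousLinearMap.smul_apply, smul_eq_mul] at h3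
    unfold pd
    rw [← h3, ← hPne u hu k]
    ring
  refine ⟨fun u => P u ^ 2, fun i u => i.elim
    (∑ k, ∑ p, α k p * (pd (G k) p u * P u - G k u * pd P p u)) (fun k => G k u * P u),
    fun u => (aP u).pow 2, ?_, ?_, ?_⟩
  · rintro (_ | k) u
    · exact Finset.analyticAt_fun_sum _ fun k _ => Finset.analyticAt_fun_sum _ fun p _ =>
        analyticAt_const.mul (((pd_analytic (aG k u) p).mul (aP u)).sub
          ((aG k u).mul (pd_analytic (aP u) p)))
    · exact (aG k u).mul (aP u)
  · obtain ⟨u, hu⟩ := P0; exact ⟨u, pow_ne_zero _ hu⟩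
  · intro u hu i
    have hPu : P u ≠ 0 := fun h => hu (by simp [h])
    rw [eq_div_iff hu]
    cases i with
    | none =>
      simp only [tval, Option.elim, hθ, Finset.sum_mul]
      refine Finset.sum_congr rfl fun k _ => Finset.sum_congr rfl fun p _ => ?_
      rw [mul_assoc, hpd u hPu]
    | some k =>
      simp only [tval, Option.elim]
      rw [← hPne u hPu k]; ring

theorem aat_rational_addition_theorem {n : ℕ} (hn : 1 ≤ n) (φ : Fin n → (Fin n → ℂ) → ℂ)
    (hmero : ∀ k, Mero (φ k)) (hindep : AnalyticallyIndep φ) (haat : AdmitsAAT φ)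
    (θ : (Fin n → ℂ) → ℂ) (α : Fin n → Fin n → ℂ)
    (hθ : ∀ u, θ u = ∑ k : Fin n, ∑ p : Fin n, α k p * pd (φ k) p u)
    (V : MvPolynomial (Option (Fin n)) ℂ) (hV0 : V ≠ 0)
    (hV : ∀ u, (∀ j, AnalyticAt ℂ (φ j) u) → (∀ j p, AnalyticAt ℂ (pd (φ j) p) u) →
      eval (tval θ φ u) V = 0)
    (A B : Fin n → Fin n → MvPolynomial (Option (Fin n)) ℂ)
    (hBne : ∀ k p, ∃ u, (∀ j, AnalyticAt ℂ (φ j) u) ∧ (∀ j q, AnalyticAt ℂ (pd (φ j) q) u) ∧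
      eval (tval θ φ u) (B k p) ≠ 0)
    (hAB : ∀ k p u, (∀ j, AnalyticAt ℂ (φ j) u) → (∀ j q, AnalyticAt ℂ (pd (φ j) q) u) →
      eval (tval θ φ u) (B k p) ≠ 0 →
      pd (φ k) p u = eval (tval θ φ u) (A k p) / eval (tval θ φ u) (B k p)) :
    ∃ N D : Option (Fin n) → MvPolynomial (Option (Fin n) ⊕ Option (Fin n)) ℂ,
      ∃ S : Set ((Fin n → ℂ) × (Fin n → ℂ)), IsOpen S ∧ S.Nonempty ∧
        ∀ w ∈ S, (∀ j, AnalyticAt ℂ (φ j) w.1) ∧ (∀ j, AnalyticAt ℂ (φ j) w.2) ∧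
          (∀ j, AnalyticAt ℂ (φ j) (w.1 + w.2)) ∧
          AnalyticAt ℂ θ w.1 ∧ AnalyticAt ℂ θ w.2 ∧ AnalyticAt ℂ θ (w.1 + w.2) ∧
          ∀ k : Option (Fin n),
            eval (Sum.elim (tval θ φ w.1) (tval θ φ w.2)) (D k) ≠ 0 ∧
            k.elim (θ (w.1 + w.2)) (fun k' => φ k' (w.1 + w.2)) =
              eval (Sum.elim (tval θ φ w.1) (tval θ φ w.2)) (N k) /
                eval (Sum.elim (tval θ φ w.1) (tval θ φ w.2)) (D k) := by
  obtain ⟨h, g, hh, hg, h0, htv⟩ := common_den φ hmero θ α hθ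
  have htv' : ∀ u, h u ≠ 0 → tval θ φ u = fun i => g i u / h u := fun u hu => funext (htv u hu)
  have hdH := dense_ne h hh h0
  have hoH := isOpen_hne h hh
  have eφ : ∀ u, h u ≠ 0 → ∀ k, (φ k) =ᶠ[𝓝 u] fun x => g (some k) x / h x := by
    intro u hu k
    filter_upwards [hoH.mem_nhds hu] with y hy
    exact htv y hy (some k)
  have eθ : ∀ u, h u ≠ 0 → θ =ᶠ[𝓝 u] fun x => g none x / h x := by
    intro u hu
    filter_upwards [hoH.mem_nhds hu] with y hy
    exact htv y hy none
  have aq : ∀ u, h u ≠ 0 → ∀ i, AnalyticAt ℂ (fun x => g i x / h x) u := fun u hu i =>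
    (hg i u).div (hh u) hu
  have aφ : ∀ u, h u ≠ 0 → ∀ k, AnalyticAt ℂ (φ k) u := fun u hu k => (aq u hu _).congr (eφ u hu k).symm
  have aθ : ∀ u, h u ≠ 0 → AnalyticAt ℂ θ u := fun u hu => (aq u hu _).congr (eθ u hu).symm
  have apd : ∀ u, h u ≠ 0 → ∀ k p, AnalyticAt ℂ (pd (φ k) p) u := fun u hu k p => pd_analytic (aφ u hu k) p
  have epd : ∀ u, h u ≠ 0 → ∀ k p, fderiv ℂ (fun x => g (some k) x / h x) u (Pi.single p 1) = pd (φ k) p u := by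
    intro u hu k p
    unfold pd
    rw [(eφ u hu k).fderiv_eq]
  obtain ⟨u0, hu0, hdet⟩ : ∃ u0, h u0 ≠ 0 ∧ Matrix.det (Matrix.of fun k p => pd (φ k) p u0) ≠ 0 := by
    obtain ⟨u1, ha, hd⟩ := hindep
    have hc : ContinuousAt (fun u => Matrix.det (Matrix.of fun k p => pd (φ k) p u)) u1 := by
      refine ContinuousAt.comp' (g := Matrix.det) (Continuous.matrix_det continuous_id).continuousAt ?_
      exact continuousAt_pi.2 fun k => continuousAt_pi.2 fun p => (pd_analytic (ha k) p).continuousAt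
    obtain ⟨u, h1, h2⟩ := hdH.inter_nhds_nonempty (hc.eventually_ne hd)
    exact ⟨u, h1, h2⟩
  have hdet' : Matrix.det (Matrix.of fun k p =>
      fderiv ℂ (fun x => g (some k) x / h x) u0 (Pi.single p 1)) ≠ 0 := by
    simp only [epd u0 hu0]; exact hdet
  obtain ⟨x0, r, hr, hball⟩ := ball_image h (fun k x => g (some k) x / h x) hh
    (fun u hu k => aq u hu _) u0 hu0 hdet'
  have hV' : ∀ u, h u ≠ 0 → eval (fun i => g i u / h u) V = 0 := by
    intro u hu
    rw [← htv' u hu]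
    exact hV u (aφ u hu) (apd u hu)
  obtain ⟨c, hc0, W, M, Pm, hPm, H1, H2, H3⟩ := partA h g hh hg u0 hu0 hdet' (inj1 hr hball) V hV0 hV'
    A B (fun k p => by
      obtain ⟨u1, ha, hpa, hne⟩ := hBne k p
      have hct : ContinuousAt (fun u => eval (tval θ φ u) (B k p)) u1 := by
        refine ContinuousAt.comp' (g := fun y => eval y (B k p)) (analyticAt_eval _ _).continuousAt ?_
        refine continuousAt_pi.2 fun i => ?_
        cases i with
        | none =>
          have : θ = fun u => ∑ k : Fin n, ∑ p : Fin n, α k p * pd (φ k) p u := funext hθ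
          change ContinuousAt θ u1
          rw [this]
          exact (Finset.analyticAt_fun_sum _ fun k _ => Finset.analyticAt_fun_sum _ fun p _ =>
            analyticAt_const.mul (hpa k p)).continuousAt
        | some k => exact (ha k).continuousAt
      obtain ⟨u, h1, h2⟩ := hdH.inter_nhds_nonempty (hct.eventually_ne hne)
      exact ⟨u, h1, by rw [← htv' u h1]; exact h2⟩)
    (fun k p u hu hb => by
      rw [epd u hu, ← htv' u hu]
      rw [← htv' u hu] at hb
      exact hAB k p u (aφ u hu) (apd u hu) hb)
  choose G hG1 hG using haat
  obtain ⟨d, hd0, C, N, H4⟩ := partB h g hh hg u0 hu0 (inj1 hr hball) (inj2 hr hball) V hV0 hV' G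
    (fun k e => by have := hG1 k; rw [e, degreeOf_zero] at this; omega)
    (fun k u v hu hv huv => by
      have := hG k u v (aφ u hu) (aφ v hv) (aφ _ huv k)
      rw [show φ k (u + v) = _ from htv _ huv (some k), show (fun j => φ j u) = _ from
        funext fun j => htv _ hu (some j), show (fun j => φ j v) = _ from
        funext fun j => htv _ hv (some j)] at this
      exact this)
  let K : AddCore n := ⟨h, g, hh, hg, h0, c, W, M, Pm, hPm, d, C, N, H1, H2, H3, H4⟩
  obtain ⟨Nn, D, hcore⟩ := K.core
  set q : MvPolynomial (Fin n ⊕ Fin n) ℂ := rename Sum.inl c * rename Sum.inr c * d with hq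
  have hq0 : q ≠ 0 := by
    refine mul_ne_zero (mul_ne_zero ?_ ?_) hd0
    · exact (map_ne_zero_iff _ (rename_injective _ Sum.inl_injective)).2 hc0
    · exact (map_ne_zero_iff _ (rename_injective _ Sum.inr_injective)).2 hc0
  set F : (Fin n → ℂ) × (Fin n → ℂ) → ℂ := fun w =>
    eval (Sum.elim (fun k => g (some k) w.1 / h w.1) (fun k => g (some k) w.2 / h w.2)) q with hF
  have hFc : ∀ w : (Fin n → ℂ) × (Fin n → ℂ), h w.1 ≠ 0 → h w.2 ≠ 0 → ContinuousAt F w := by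
    intro w hw1 hw2
    refine ContinuousAt.comp' (g := fun y => eval y q) (analyticAt_eval _ _).continuousAt ?_
    refine continuousAt_pi.2 fun j => ?_
    cases j with
    | inl k => exact ContinuousAt.comp' (g := fun x => g (some k) x / h x) (aq _ hw1 _).continuousAt continuousAt_fst
    | inr k => exact ContinuousAt.comp' (g := fun x => g (some k) x / h x) (aq _ hw2 _).continuousAt continuousAt_snd
  have hch : Continuous h := continuous_iff_continuousAt.2 fun u => (hh u).continuousAt
  have ho1 : IsOpen {w : (Fin n → ℂ) × (Fin n → ℂ) | h w.1 ≠ 0 ∧ h w.2 ≠ 0 ∧ h (w.1 + w.2) ≠ 0} := by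
    refine IsOpen.inter ?_ (IsOpen.inter ?_ ?_)
    · exact hoH.preimage continuous_fst
    · exact hoH.preimage continuous_snd
    · exact hoH.preimage (continuous_fst.add continuous_snd)
  refine ⟨Nn, fun _ => D, {w | (h w.1 ≠ 0 ∧ h w.2 ≠ 0 ∧ h (w.1 + w.2) ≠ 0) ∧ F w ≠ 0}, ?_, ?_, ?_⟩
  · rw [isOpen_iff_mem_nhds]
    rintro w ⟨hw, hFw⟩
    filter_upwards [ho1.mem_nhds hw, (hFc w hw.1 hw.2.1).eventually_ne hFw] with z h1 h2
    exact ⟨h1, h2⟩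
  · by_contra hemp
    apply hq0
    refine inj2 hr hball q fun u v hu hv => ?_
    by_contra hne
    have : F (u, v) ≠ 0 := hne
    obtain ⟨z, h1, h2⟩ := K.dense_pair.inter_nhds_nonempty ((hFc (u, v) hu hv).eventually_ne this)
    exact hemp ⟨z, h1, h2⟩
  · rintro ⟨u, v⟩ ⟨⟨hu, hv, huv⟩, hFw⟩
    refine ⟨aφ u hu, aφ v hv, aφ _ huv, aθ u hu, aθ v hv, aθ _ huv, ?_⟩
    simp only [hF, hq, map_mul, eval_rename] at hFw
    have hc1 := left_ne_zero_of_mul (left_ne_zero_of_mul hFw)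
    have hc2 := right_ne_zero_of_mul (left_ne_zero_of_mul hFw)
    have hd := right_ne_zero_of_mul hFw
    obtain ⟨hD, hR⟩ := hcore u v hu hv huv hc1 hc2 hd
    have e1 : K.ps u = tval θ φ u := (htv' u hu).symm
    have e2 : K.ps v = tval θ φ v := (htv' v hv).symm
    rw [e1, e2] at hD
    intro k
    refine ⟨hD, ?_⟩
    have e3 := hR k
    rw [e1, e2] at e3
    exact (htv _ huv k).trans e3
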